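/- arXiv:2104.08135 — 8 statements merged into one kernel-verified Lean document; each statement's English description precedes it below -/
import Mathlib

section
/- Let 𝒩 be a shallow maxout network with n inputs and a single layer of m maxout units of ranks k_1,…,k_m (with biases). Then the maximal number of linear regions over all choices of parameters is N(𝒩) = ∑_{j=0}^{n} ∑_{S ⊆ [m], |S| = j} ∏_{i ∈ S} (k_i − 1), where the empty product is 1 and ∑ over S with |S|=0 contributes the single term 1. In particular, if k_1 = … = k_m = k, then N(𝒩) = ∑_{j=0}^{n} C(m, j) (k − 1)^j. -/
open Filter Topology

noncomputable def maxoutLayer {n m : ℕ} (k : Fin m → ℕ)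
    (w : (j : Fin m) → Fin (k j) → Fin n → ℝ)
    (b : (j : Fin m) → Fin (k j) → ℝ) : (Fin n → ℝ) → (Fin m → ℝ) :=
  fun x j => ⨆ r : Fin (k j), ((∑ i, w j r i * x i) + b j r)

def nonlinearLocus {n : ℕ} {F : Type*} [AddCommGroup F] [Module ℝ F]
    (f : (Fin n → ℝ) → F) : Set (Fin n → ℝ) :=
  {x | ¬ ∃ g : (Fin n → ℝ) →ᵃ[ℝ] F, ∀ᶠ y in 𝓝 x, f y = g y}

noncomputable def numRegions {n : ℕ} {F : Type*} [AddCommGroup F] [Module ℝ F]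
    (f : (Fin n → ℝ) → F) : ℕ :=
  Nat.card (ConnectedComponents ↥((nonlinearLocus f)ᶜ))


namespace Maxout

/-- index vectors with at most `n` nonzero coordinates -/
def Zset {m : ℕ} (n : ℕ) (k : Fin m → ℕ) : Finset ((i : Fin m) → Fin (k i)) :=
  Finset.univ.filter fun z => (Finset.univ.filter fun i => (z i : ℕ) ≠ 0).card ≤ n

lemma card_Zset {m : ℕ} (n : ℕ) (k : Fin m → ℕ) (hk : ∀ i, 1 ≤ k i) :
    (Zset n k).card = ∑ j ∈ Finset.range (n + 1),
        ∑ S ∈ Finset.powersetCard j (Finset.univ : Finset (Fin m)), ∏ i ∈ S, (k i - 1) := by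
  classical
  have key : ∀ S : Finset (Fin m),
      (Finset.univ.filter fun z : (i : Fin m) → Fin (k i) =>
        (Finset.univ.filter fun i => (z i : ℕ) ≠ 0) = S).card = ∏ i ∈ S, (k i - 1) := by
    intro S
    have : (Finset.univ.filter fun z : (i : Fin m) → Fin (k i) =>
        (Finset.univ.filter fun i => (z i : ℕ) ≠ 0) = S) =
        Fintype.piFinset (fun i => if i ∈ S then
          (Finset.univ.erase (⟨0, hk i⟩ : Fin (k i))) else {⟨0, hk i⟩}) := by
      ext z
      simp only [Finset.mem_filter, Finset.mem_univ, true_and, Fintype.mem_piFinset,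
        Finset.ext_iff]
      refine forall_congr' fun i => ?_
      by_cases h : i ∈ S <;> simp [h, Fin.ext_iff]
    rw [this, Fintype.card_piFinset]
    have h2 : ∀ i, (if i ∈ S then
          (Finset.univ.erase (⟨0, hk i⟩ : Fin (k i))) else {⟨0, hk i⟩}).card
          = if i ∈ S then k i - 1 else 1 := by
      intro i; split_ifs <;> simp
    rw [Finset.prod_congr rfl fun i _ => h2 i]
    simp
  rw [← Finset.sum_congr rfl fun j _ => Finset.sum_congr rfl fun S _ => key S]
  have h3 : ∀ j ∈ Finset.range (n+1), ∑ S ∈ Finset.powersetCard j (Finset.univ : Finset (Fin m)),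
      (Finset.univ.filter fun z : (i : Fin m) → Fin (k i) =>
        (Finset.univ.filter fun i => (z i : ℕ) ≠ 0) = S).card =
      ((Zset n k).filter fun z =>
        (Finset.univ.filter fun i => (z i : ℕ) ≠ 0).card = j).card := by
    intro j hj
    rw [Finset.card_eq_sum_card_fiberwise (s := (Zset n k).filter fun z =>
        (Finset.univ.filter fun i => (z i : ℕ) ≠ 0).card = j)
        (f := fun z => Finset.univ.filter fun i => (z i : ℕ) ≠ 0)
        (t := Finset.powersetCard j (Finset.univ : Finset (Fin m)))]
    · refine Finset.sum_congr rfl fun S hS => ?_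
      congr 1
      ext z
      simp only [Finset.mem_filter, Finset.mem_univ, true_and, Zset]
      rw [Finset.mem_powersetCard] at hS
      rw [Finset.mem_range] at hj
      constructor
      · intro h
        refine ⟨⟨?_, ?_⟩, h⟩ <;> rw [h, hS.2]
        omega
      · exact fun h => h.2
    · intro z hz
      simp only [Finset.coe_filter, Set.mem_ofPred_eq] at hz
      simp [Finset.mem_powersetCard, hz.2]
  rw [Finset.sum_congr rfl h3]
  refine Finset.card_eq_sum_card_fiberwise (fun z hz => ?_)
  simp only [Zset, Finset.coe_filter, Set.mem_ofPred_eq, Finset.mem_univ, true_and] at hz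
  simp; simpa using hz

/-- indicator monomials -/
def mono {m : ℕ} {k : Fin m → ℕ} (S : Finset (Fin m)) (z : (i : Fin m) → Fin (k i)) :
    ((i : Fin m) → Fin (k i)) → ℝ :=
  fun x => ∏ i ∈ S, if x i = z i then 1 else 0

lemma mono_span {m : ℕ} {k : Fin m → ℕ} (hk : ∀ i, 1 ≤ k i) (T : Finset (Fin m)) :
    ∀ (a : (i : Fin m) → Fin (k i)),
    mono T a ∈ Submodule.span ℝ {f : ((i : Fin m) → Fin (k i)) → ℝ |
      ∃ z : (i : Fin m) → Fin (k i), (Finset.univ.filter fun i => (z i : ℕ) ≠ 0) ⊆ T ∧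
        f = mono (Finset.univ.filter fun i => (z i : ℕ) ≠ 0) z} := by
  classical
  induction T using Finset.induction_on with
  | empty =>
    intro a
    apply Submodule.subset_span
    refine ⟨fun i => ⟨0, hk i⟩, by simp, ?_⟩
    ext x; simp [mono]
  | insert i T hi ih =>
    intro a
    have h1 : mono (insert i T) a = (fun x => if x i = a i then (1:ℝ) else 0) * mono T a := by
      ext x; simp [mono, Finset.prod_insert hi]
    rw [h1]
    have key := ih a
    generalize mono T a = g at key
    induction key using Submodule.span_induction with
    | zero => simp
    | add u v _ _ hu hv => rw [mul_add]; exact Submodule.add_mem _ hu hv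
    | smul c u _ hu => rw [mul_smul_comm]; exact Submodule.smul_mem _ c hu
    | mem u hu =>
      obtain ⟨z, hz, rfl⟩ := hu
      have hzi : (z i : ℕ) = 0 := by
        by_contra h
        exact hi (hz (by simp [h]))
      -- the nonzero case
      have hnz : ∀ r : Fin (k i), (r : ℕ) ≠ 0 →
          (fun x : (i : Fin m) → Fin (k i) => if x i = r then (1:ℝ) else 0) *
            mono (Finset.univ.filter fun i => (z i : ℕ) ≠ 0) z ∈
          Submodule.span ℝ {f : ((i : Fin m) → Fin (k i)) → ℝ |
            ∃ z : (i : Fin m) → Fin (k i), (Finset.univ.filter fun i => (z i : ℕ) ≠ 0) ⊆ insert i T ∧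
            f = mono (Finset.univ.filter fun i => (z i : ℕ) ≠ 0) z} := by
        intro r hr
        apply Submodule.subset_span
        have hs : (Finset.univ.filter fun j => (Function.update z i r j : ℕ) ≠ 0) =
            insert i (Finset.univ.filter fun j => (z j : ℕ) ≠ 0) := by
          ext j
          by_cases hj : j = i
          · subst hj; simp [hr]
          · simp [hj]
        refine ⟨Function.update z i r, ?_, ?_⟩
        · rw [hs]; exact Finset.insert_subset_insert _ hz
        · rw [hs]
          ext x
          have hni : i ∉ (Finset.univ.filter fun j => (z j : ℕ) ≠ 0) := by simp [hzi]
          simp only [mono, Pi.mul_apply]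
          rw [Finset.prod_insert hni]
          simp only [Function.update_self]
          congr 1
          refine Finset.prod_congr rfl fun j hj => ?_
          have : j ≠ i := fun h => hni (h ▸ hj)
          rw [Function.update_of_ne this]
      by_cases ha : (a i : ℕ) = 0
      · have : (fun x : (i : Fin m) → Fin (k i) => if x i = a i then (1:ℝ) else 0) *
            mono (Finset.univ.filter fun i => (z i : ℕ) ≠ 0) z =
            mono (Finset.univ.filter fun i => (z i : ℕ) ≠ 0) z -
            ∑ r ∈ Finset.univ.erase (a i),
            (fun x : (i : Fin m) → Fin (k i) => if x i = r then (1:ℝ) else 0) *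
              mono (Finset.univ.filter fun i => (z i : ℕ) ≠ 0) z := by
          rw [← Finset.sum_mul, eq_sub_iff_add_eq, ← add_mul]
          rw [Finset.add_sum_erase _ (fun r => (fun x : (i : Fin m) → Fin (k i) => if x i = r then (1:ℝ) else 0)) (Finset.mem_univ _)]
          convert one_mul _
          ext x
          simp
        rw [this]
        refine Submodule.sub_mem _ (Submodule.subset_span ⟨z, hz.trans (Finset.subset_insert _ _), rfl⟩)
          (Submodule.sum_mem _ fun r hr => hnz r ?_)
        intro h
        exact (Finset.ne_of_mem_erase hr) (Fin.ext (by omega))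
      · exact hnz _ ha

lemma triangular_bound {m n : ℕ} {k : Fin m → ℕ} (hk : ∀ i, 1 ≤ k i) {G : Type*} [Fintype G]
    (R : G → (i : Fin m) → Fin (k i)) (T : G → Finset (Fin m)) (hT : ∀ g, (T g).card ≤ n)
    (c : G → ℝ)
    (htri : ∀ g g', (∀ i ∈ T g, R g' i = R g i) → g' = g ∨ c g < c g') :
    Fintype.card G ≤ (Zset n k).card := by
  classical
  let E : G → (G → ℝ) := fun g g' => mono (T g) (R g) (R g')
  have hE0 : ∀ g g', g' ≠ g → ¬ c g < c g' → E g g' = 0 := by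
    intro g g' h1 h2
    by_contra h
    have : ∀ i ∈ T g, R g' i = R g i := by
      intro i hi
      by_contra h3
      exact h (Finset.prod_eq_zero hi (by simp [h3]))
    rcases htri g g' this with h4 | h4
    · exact h1 h4
    · exact h2 h4
  have hE1 : ∀ g, E g g = 1 := by intro g; simp [E, mono]
  have hli : LinearIndependent ℝ E := by
    rw [Fintype.linearIndependent_iff]
    intro a ha
    by_contra! hcon
    obtain ⟨g0, hg0⟩ := hcon
    obtain ⟨g1, hg1, hmin⟩ := Finset.exists_min_image (Finset.univ.filter fun g => a g ≠ 0) c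
      ⟨g0, by simpa using hg0⟩
    simp only [Finset.mem_filter, Finset.mem_univ, true_and] at hg1 hmin
    have := congrFun ha g1
    simp only [Finset.sum_apply, Pi.smul_apply, smul_eq_mul, Pi.zero_apply] at this
    rw [Finset.sum_eq_single g1] at this
    · rw [hE1, mul_one] at this; exact hg1 this
    · intro g _ hg
      by_cases h : a g = 0
      · simp [h]
      · rw [hE0 g g1 hg.symm (not_lt.2 (hmin g h)), mul_zero]
    · simp
  let w : Finset (G → ℝ) := (Zset n k).image
    fun z g => mono (Finset.univ.filter fun i => (z i : ℕ) ≠ 0) z (R g)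
  have hs : Set.range E ≤ Submodule.span ℝ (w : Set (G → ℝ)) := by
    rintro _ ⟨g, rfl⟩
    have h1 := mono_span hk (T g) (R g)
    have h2 := Submodule.mem_map_of_mem (f := LinearMap.funLeft ℝ ℝ R) h1
    rw [Submodule.map_span] at h2
    refine Submodule.span_mono ?_ h2
    rintro _ ⟨_, ⟨z, hz, rfl⟩, rfl⟩
    simp only [w, Finset.coe_image, Set.mem_image, Finset.mem_coe]
    refine ⟨z, ?_, rfl⟩
    simp only [Zset, Finset.mem_filter, Finset.mem_univ, true_and]
    exact (Finset.card_le_card hz).trans (hT g)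
  have := linearIndependent_le_span_aux' E hli (w : Set (G → ℝ)) hs
  refine this.trans ?_
  simp only [Finset.coe_sort_coe, Fintype.card_coe]
  exact Finset.card_image_le


/-- squared Euclidean norm -/
def q {n : ℕ} (x : Fin n → ℝ) : ℝ := ∑ i, x i ^ 2

lemma q_cont {n : ℕ} : Continuous (q (n := n)) := by unfold q; fun_prop

lemma q_mid {n : ℕ} (x y : Fin n → ℝ) (a b : ℝ) (hab : a + b = 1) :
    q (a • x + b • y) = a * q x + b * q y - a * b * q (x - y) := by
  simp only [q, Finset.mul_sum, ← Finset.sum_add_distrib, ← Finset.sum_sub_distrib]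
  refine Finset.sum_congr rfl fun i _ => ?_
  obtain rfl : b = 1 - a := by linarith
  simp; ring

lemma q_nonneg {n : ℕ} (x : Fin n → ℝ) : 0 ≤ q x := Finset.sum_nonneg fun _ _ => sq_nonneg _

lemma q_eq_zero {n : ℕ} {x : Fin n → ℝ} (h : q x ≤ 0) : x = 0 := by
  have h0 : q x = 0 := le_antisymm h (q_nonneg x)
  rw [q, Finset.sum_eq_zero_iff_of_nonneg fun i _ => sq_nonneg _] at h0
  ext i
  simpa using h0 i (Finset.mem_univ i)

lemma convex_bound {m n : ℕ} {k : Fin m → ℕ} (hk : ∀ i, 1 ≤ k i) {G : Type*} [Fintype G]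
    (R : G → (i : Fin m) → Fin (k i)) (A : (i : Fin m) → Fin (k i) → Set (Fin n → ℝ))
    (hconv : ∀ i r, Convex ℝ (A i r)) (hclosed : ∀ i r, IsClosed (A i r))
    (p : G → Fin n → ℝ) (hp : ∀ g i, p g ∈ A i (R g i))
    (hdisj : ∀ g g' x, (∀ i, x ∈ A i (R g i)) → (∀ i, x ∈ A i (R g' i)) → g = g') :
    Fintype.card G ≤ (Zset n k).card := by
  classical
  let B : Set (Fin n → ℝ) := convexHull ℝ (Set.range p)
  have hB : IsCompact B := (Set.finite_range p).isCompact_convexHull ℝ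
  have hBc : Convex ℝ B := convex_convexHull ℝ _
  have hpB : ∀ g, p g ∈ B := fun g => subset_convexHull ℝ _ ⟨g, rfl⟩
  have hmin : ∀ g, ∃ v, (v ∈ B ∧ ∀ i, v ∈ A i (R g i)) ∧
      ∀ y, y ∈ B → (∀ i, y ∈ A i (R g i)) → q v ≤ q y := by
    intro g
    obtain ⟨v, hv, hv2⟩ := (hB.inter_right (isClosed_iInter fun i => hclosed i (R g i))).exists_isMinOn
      ⟨p g, hpB g, Set.mem_iInter.2 (hp g)⟩ q_cont.continuousOn
    exact ⟨v, ⟨hv.1, Set.mem_iInter.1 hv.2⟩, fun y hy hy2 => hv2 ⟨hy, Set.mem_iInter.2 hy2⟩⟩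
  choose v hv hvmin using hmin
  have hT : ∀ g, ∃ T : Finset (Fin m), T.card ≤ n ∧
      ∀ y, y ∈ B → (∀ i ∈ T, y ∈ A i (R g i)) → q (v g) ≤ q y := by
    intro g
    by_contra! hcon
    let Fm : Option (Fin m) → Set (Fin n → ℝ) := fun o => o.elim {y | y ∈ B ∧ q y < q (v g)}
      (fun i => A i (R g i))
    have hF : ∀ o ∈ (Finset.univ : Finset (Option (Fin m))), Convex ℝ (Fm o) := by
      rintro (_ | i) -
      · rintro x ⟨hx, hx2⟩ y ⟨hy, hy2⟩ a b ha hb hab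
        refine ⟨hBc hx hy ha hb hab, ?_⟩
        rw [q_mid _ _ _ _ hab]
        have h1 := mul_nonneg (mul_nonneg ha hb) (q_nonneg (x - y))
        rcases ha.eq_or_lt with rfl | ha'
        · obtain rfl : b = 1 := by linarith
          nlinarith
        · have h2 := mul_lt_mul_of_pos_left hx2 ha'
          have h3 := mul_le_mul_of_nonneg_left hy2.le hb
          have h4 : a * q (v g) + b * q (v g) = q (v g) := by rw [← add_mul, hab, one_mul]
          linarith
      · exact hconv _ _
    have := Convex.helly_theorem' (𝕜 := ℝ) hF (by
      intro I _ hI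
      by_cases hn : none ∈ I
      · obtain ⟨y, hy, hy2, hy3⟩ := hcon (Finset.eraseNone I) (by
          rw [Finset.card_eraseNone_of_mem hn]
          simp at hI; omega)
        refine ⟨y, ?_⟩
        simp only [Set.mem_iInter]
        rintro (_ | i) hi
        · exact ⟨hy, hy3⟩
        · exact hy2 i (by simpa using hi)
      · refine ⟨v g, ?_⟩
        simp only [Set.mem_iInter]
        rintro (_ | i) hi
        · exact absurd hi hn
        · exact (hv g).2 i)
    obtain ⟨y, hy⟩ := this
    simp only [Set.mem_iInter] at hy
    have h1 := hy none (Finset.mem_univ _)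
    have h2 := hvmin g y h1.1 fun i => hy (some i) (Finset.mem_univ _)
    exact absurd h1.2 (not_lt.2 h2)
  choose T hTc hTmin using hT
  refine triangular_bound hk R T hTc (fun g => q (v g)) ?_
  intro g g' hgg
  have h1 : ∀ i ∈ T g, v g' ∈ A i (R g i) := fun i hi => hgg i hi ▸ (hv g').2 i
  rcases (hTmin g _ (hv g').1 h1).lt_or_eq with h | h
  · exact Or.inr h
  left
  have h2 := hTmin g ((1/2 : ℝ) • v g + (1/2 : ℝ) • v g')
    (hBc (hv g).1 (hv g').1 (by norm_num) (by norm_num) (by norm_num))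
    (fun i hi => hconv _ _ ((hv g).2 i) (h1 i hi) (by norm_num) (by norm_num) (by norm_num))
  rw [q_mid _ _ _ _ (by norm_num)] at h2
  have h3 : v g - v g' = 0 := q_eq_zero (by linarith)
  have h4 := sub_eq_zero.1 h3
  exact hdisj _ _ (v g') (hv g').2 (fun i => h4 ▸ (hv g).2 i)

lemma affine_eq_of_eventually {n : ℕ} {F : Type*} [AddCommGroup F] [Module ℝ F]
    {g g' : (Fin n → ℝ) →ᵃ[ℝ] F} {x : Fin n → ℝ}
    (h : ∀ᶠ y in 𝓝 x, g y = g' y) : g = g' := by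
  obtain ⟨u, hu, ho, hx⟩ := eventually_nhds_iff.1 h
  exact AffineMap.ext_on (ho.affineSpan_eq_top ⟨x, hx⟩) hu

/-- the affine pieces which occur locally -/
def germs {n : ℕ} {F : Type*} [AddCommGroup F] [Module ℝ F]
    (f : (Fin n → ℝ) → F) : Set ((Fin n → ℝ) →ᵃ[ℝ] F) :=
  {g | ∃ x, ∀ᶠ y in 𝓝 x, f y = g y}

section
set_option linter.unusedSectionVars false
variable {n m : ℕ} {k : Fin m → ℕ} (hk : ∀ i, 1 ≤ k i)
    (w : (j : Fin m) → Fin (k j) → Fin n → ℝ)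
    (b : (j : Fin m) → Fin (k j) → ℝ)

/-- piece -/
def piece (w : (j : Fin m) → Fin (k j) → Fin n → ℝ)
    (b : (j : Fin m) → Fin (k j) → ℝ) (j : Fin m) (r : Fin (k j)) (x : Fin n → ℝ) : ℝ :=
  (∑ i, w j r i * x i) + b j r

lemma piece_mid (j : Fin m) (r : Fin (k j)) (x y : Fin n → ℝ) (s t : ℝ) (h : s + t = 1) :
    piece w b j r (s • x + t • y) = s * piece w b j r x + t * piece w b j r y := by
  obtain rfl : t = 1 - s := by linarith
  simp only [piece, mul_add, Finset.mul_sum]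
  rw [add_add_add_comm, ← Finset.sum_add_distrib]
  congr 1
  · refine Finset.sum_congr rfl fun i _ => ?_
    simp; ring
  · ring

include hk

lemma layer_ge (x : Fin n → ℝ) (j : Fin m) (r : Fin (k j)) :
    piece w b j r x ≤ maxoutLayer k w b x j :=
  le_ciSup (f := fun r => piece w b j r x) (Set.finite_range _).bddAbove r

lemma layer_attained (x : Fin n → ℝ) (j : Fin m) :
    ∃ r, maxoutLayer k w b x j = piece w b j r x := by
  have : Nonempty (Fin (k j)) := ⟨⟨0, hk j⟩⟩
  obtain ⟨r, hr⟩ := exists_eq_ciSup_of_finite (f := fun r => piece w b j r x)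
  exact ⟨r, hr.symm⟩

lemma layer_convex (j : Fin m) (x y : Fin n → ℝ) (s t : ℝ) (hs : 0 ≤ s) (ht : 0 ≤ t)
    (h : s + t = 1) : maxoutLayer k w b (s • x + t • y) j ≤
      s * maxoutLayer k w b x j + t * maxoutLayer k w b y j := by
  obtain ⟨r, hr⟩ := layer_attained hk w b (s • x + t • y) j
  rw [hr, piece_mid _ _ _ _ _ _ _ _ h]
  exact add_le_add (mul_le_mul_of_nonneg_left (layer_ge hk w b x j r) hs)
    (mul_le_mul_of_nonneg_left (layer_ge hk w b y j r) ht)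

lemma affine_mid (g : (Fin n → ℝ) →ᵃ[ℝ] (Fin m → ℝ)) (j : Fin m) (x y : Fin n → ℝ) (s t : ℝ)
    (h : s + t = 1) : g (s • x + t • y) j = s * g x j + t * g y j := by
  have := Convex.combo_affine_apply (x := x) (y := y) (f := g) h
  rw [this]; simp

/-- if `f = g` near a point in coordinate `j`, then `g ≤ f` everywhere in that coordinate -/
lemma germ_le (g : (Fin n → ℝ) →ᵃ[ℝ] (Fin m → ℝ)) (j : Fin m) (x : Fin n → ℝ)
    (hx : ∀ᶠ y in 𝓝 x, maxoutLayer k w b y j = g y j) (y : Fin n → ℝ) :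
    g y j ≤ maxoutLayer k w b y j := by
  have hc : ConvexOn ℝ Set.univ (fun y => maxoutLayer k w b y j - g y j) := by
    refine ⟨convex_univ, fun u _ v _ s t hs ht hst => ?_⟩
    have h1 := layer_convex hk w b j u v s t hs ht hst
    have h2 := affine_mid hk g j u v s t hst
    simp only [smul_eq_mul]
    rw [h2]; linarith
  have hl : IsLocalMin (fun y => maxoutLayer k w b y j - g y j) x := by
    have h0 := hx.self_of_nhds
    filter_upwards [hx] with z hz
    simp [hz, h0]
  have := IsMinOn.of_isLocalMin_of_convex_univ hl hc y
  simp only [hx.self_of_nhds, sub_self] at this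
  linarith

/-- the coordinate cell is convex -/
lemma cell_convex (g : (Fin n → ℝ) →ᵃ[ℝ] (Fin m → ℝ)) (j : Fin m) (x : Fin n → ℝ)
    (hx : ∀ᶠ y in 𝓝 x, maxoutLayer k w b y j = g y j) :
    Convex ℝ {y | maxoutLayer k w b y j = g y j} := by
  intro u hu v hv s t hs ht hst
  have h1 := layer_convex hk w b j u v s t hs ht hst
  have h2 := affine_mid hk g j u v s t hst
  simp only [Set.mem_ofPred_eq] at hu hv ⊢
  rw [hu, hv, ← h2] at h1
  exact le_antisymm h1 (germ_le hk w b g j x hx _)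

lemma germ_piece (g : (Fin n → ℝ) →ᵃ[ℝ] (Fin m → ℝ)) (j : Fin m) (x : Fin n → ℝ)
    (hx : ∀ᶠ y in 𝓝 x, maxoutLayer k w b y j = g y j) :
    ∃ r, ∀ y, g y j = piece w b j r y := by
  obtain ⟨r, hr⟩ := layer_attained hk w b x j
  refine ⟨r, fun y => ?_⟩
  have h0 := hx.self_of_nhds
  have hlin : ∀ u v s t, s + t = (1:ℝ) → (piece w b j r (s • u + t • v) - g (s • u + t • v) j)
      = s * (piece w b j r u - g u j) + t * (piece w b j r v - g v j) := by
    intro u v s t hst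
    rw [piece_mid _ _ _ _ _ _ _ _ hst, affine_mid hk g j u v s t hst]; ring
  have hc : ConcaveOn ℝ Set.univ (fun y => piece w b j r y - g y j) := by
    refine ⟨convex_univ, fun u _ v _ s t hs ht hst => ?_⟩
    simp only [smul_eq_mul]
    rw [hlin _ _ _ _ hst]
  have hl : IsLocalMax (fun y => piece w b j r y - g y j) x := by
    filter_upwards [hx] with z hz
    have := layer_ge hk w b z j r
    linarith
  have hmax := IsMaxOn.of_isLocalMax_of_convex_univ hl hc
  have e0 : piece w b j r x - g x j = 0 := by linarith
  simp only [e0] at hmax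
  have h1 := hmax y
  have h2 := hmax ((2:ℝ) • x + (-1:ℝ) • y)
  rw [hlin _ _ _ _ (by norm_num), e0] at h2
  linarith

lemma numRegions_eq : numRegions (maxoutLayer k w b) = Nat.card (germs (maxoutLayer k w b)) := by
  classical
  set f := maxoutLayer k w b with hf
  let D : Set (Fin n → ℝ) := (nonlinearLocus f)ᶜ
  have hD : ∀ x, x ∈ D ↔ ∃ g : (Fin n → ℝ) →ᵃ[ℝ] (Fin m → ℝ), ∀ᶠ y in 𝓝 x, f y = g y := by
    intro x; simp [D, nonlinearLocus]
  have hDx : ∀ x : D, ∃ g : (Fin n → ℝ) →ᵃ[ℝ] (Fin m → ℝ), ∀ᶠ y in 𝓝 (x : Fin n → ℝ), f y = g y :=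
    fun x => (hD x).1 x.2
  choose φ hφ using hDx
  have huniq : ∀ (x : D) (g : (Fin n → ℝ) →ᵃ[ℝ] (Fin m → ℝ)),
      (∀ᶠ y in 𝓝 (x : Fin n → ℝ), f y = g y) → φ x = g := by
    intro x g hg
    refine affine_eq_of_eventually (x := (x : Fin n → ℝ)) ?_
    filter_upwards [hg, hφ x] with y h1 h2
    rw [← h1, ← h2]
  have hloc : IsLocallyConstant φ := by
    rw [IsLocallyConstant.iff_eventually_eq]
    intro x
    have h1 := (hφ x).eventually_nhds
    have h2 := (continuous_subtype_val (p := fun x => x ∈ D)).continuousAt.eventually h1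
    filter_upwards [h2] with y hy
    exact huniq y _ hy
  have hch : ∀ g : germs f, ∃ x : D, φ x = g := by
    rintro ⟨g, x, hx⟩
    exact ⟨⟨x, (hD x).2 ⟨g, hx⟩⟩, huniq _ _ hx⟩
  choose x hx using hch
  refine (Nat.card_congr (Equiv.ofBijective
    (fun g : germs f => (ConnectedComponents.mk (x g) : ConnectedComponents D)) ⟨?_, ?_⟩)).symm
  · intro g g' h
    have h' : x g ∈ connectedComponent (x g') := ConnectedComponents.coe_eq_coe'.1 h
    have := hloc.apply_eq_of_isPreconnected isPreconnected_connectedComponent h'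
      mem_connectedComponent
    rw [hx, hx] at this
    exact Subtype.ext this
  · intro c
    obtain ⟨y, rfl⟩ := ConnectedComponents.surjective_coe c
    refine ⟨⟨φ y, y, hφ y⟩, ?_⟩
    refine ConnectedComponents.coe_eq_coe'.2 ?_
    set g := φ y with hg
    set y' := x ⟨φ y, y, hφ y⟩ with hy'
    have hyy : φ y' = g := hx _
    let C : Set (Fin n → ℝ) := interior (⋂ j, {z | f z j = g z j})
    have hCc : Convex ℝ C := by
      refine Convex.interior (convex_iInter fun j => cell_convex hk w b g j y ?_)
      filter_upwards [hφ y] with z hz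
      rw [← hf, hz]
    have hmemC : ∀ z : D, φ z = g → (z : Fin n → ℝ) ∈ C := by
      intro z hz
      rw [mem_interior_iff_mem_nhds]
      filter_upwards [hφ z] with u hu
      simp [hu, hz]
    have hCD : C ⊆ D := by
      intro z hz
      rw [hD]
      refine ⟨g, ?_⟩
      filter_upwards [mem_interior_iff_mem_nhds.1 hz] with u hu
      ext j
      exact Set.mem_iInter.1 hu j
    have hpre : IsPreconnected ((Subtype.val : D → _) ⁻¹' C) := by
      rw [← IsInducing.subtypeVal.isPreconnected_image, Set.image_preimage_eq_inter_range,
        Subtype.range_val, Set.inter_eq_left.2 hCD]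
      exact hCc.isPreconnected
    exact hpre.subset_connectedComponent (hmemC y rfl) (hmemC y' hyy)

lemma germs_bound : (germs (maxoutLayer k w b)).Finite ∧
    Nat.card (germs (maxoutLayer k w b)) ≤ (Zset n k).card := by
  classical
  have hR : ∀ g : germs (maxoutLayer k w b), ∃ R : (j : Fin m) → Fin (k j),
      ∀ j y, (g : (Fin n → ℝ) →ᵃ[ℝ] (Fin m → ℝ)) y j = piece w b j (R j) y := by
    rintro ⟨g, x, hx⟩
    have : ∀ j, ∃ r, ∀ y, g y j = piece w b j r y := by
      intro j
      refine germ_piece hk w b g j x ?_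
      filter_upwards [hx] with z hz
      rw [hz]
    choose R hR using this
    exact ⟨R, hR⟩
  choose R hR using hR
  have hinj : Function.Injective R := by
    intro g g' h
    apply Subtype.ext
    ext y j
    rw [hR, hR, h]
  have hfin : Finite (germs (maxoutLayer k w b)) := Finite.of_injective R hinj
  have := Fintype.ofFinite (germs (maxoutLayer k w b))
  refine ⟨hfin, ?_⟩
  rw [Nat.card_eq_fintype_card]
  choose p hp using fun g : germs (maxoutLayer k w b) => g.2
  let A : (i : Fin m) → Fin (k i) → Set (Fin n → ℝ) := fun i r =>
    convexHull ℝ (p '' {g | R g i = r})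
  have hA : ∀ g i, A i (R g i) ⊆ interior {y | maxoutLayer k w b y i = piece w b i (R g i) y} := by
    intro g i
    have e : ∀ g', R g' i = R g i → {y | maxoutLayer k w b y i = piece w b i (R g i) y} =
        {y | maxoutLayer k w b y i = g'.1 y i} := by
      intro g' h; ext y; simp [hR, h]
    refine convexHull_min ?_ ?_
    · rintro _ ⟨g', hg', rfl⟩
      rw [mem_interior_iff_mem_nhds, e g' hg']
      filter_upwards [hp g'] with z hz
      simp [hz]
    · rw [e g rfl]
      refine Convex.interior (cell_convex hk w b g.1 i (p g) ?_)
      filter_upwards [hp g] with z hz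
      rw [hz]
  refine convex_bound hk R A (fun i r => convex_convexHull ℝ _)
    (fun i r => (((Set.toFinite _).image p).isCompact_convexHull ℝ).isClosed) p
    (fun g i => subset_convexHull ℝ _ ⟨g, rfl, rfl⟩) ?_
  intro g g' x h1 h2
  apply Subtype.ext
  refine affine_eq_of_eventually (x := x) ?_
  have e1 : ∀ᶠ y in 𝓝 x, ∀ i, maxoutLayer k w b y i = piece w b i (R g i) y :=
    eventually_all.2 fun i => mem_interior_iff_mem_nhds.1 (hA g i (h1 i))
  have e2 : ∀ᶠ y in 𝓝 x, ∀ i, maxoutLayer k w b y i = piece w b i (R g' i) y :=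
    eventually_all.2 fun i => mem_interior_iff_mem_nhds.1 (hA g' i (h2 i))
  filter_upwards [e1, e2] with y h3 h4
  ext i
  rw [hR, hR, ← h3, ← h4]

end

/-- moment curve directions -/
def avec {m : ℕ} (n : ℕ) (i : Fin m) : Fin n → ℝ := fun l => ((i : ℕ) : ℝ) ^ (l : ℕ)

lemma avec_surj {m n : ℕ} (S : Finset (Fin m)) (hS : S.card ≤ n) (y : Fin m → ℝ) :
    ∃ x : Fin n → ℝ, ∀ i ∈ S, avec n i ⬝ᵥ x = y i := by
  classical
  have hinj : Set.InjOn (fun i : Fin m => ((i : ℕ) : ℝ)) S := by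
    intro i _ j _ h
    have h' : ((i : ℕ) : ℝ) = ((j : ℕ) : ℝ) := h
    exact Fin.ext (by exact_mod_cast h')
  set p := Lagrange.interpolate S (fun i : Fin m => ((i : ℕ) : ℝ)) y with hp
  refine ⟨fun l => p.coeff l, fun i hi => ?_⟩
  have hn : 0 < n := lt_of_lt_of_le (Finset.card_pos.2 ⟨i, hi⟩) hS
  have hdeg : p.natDegree < n := by
    by_cases h0 : p = 0
    · simpa [h0] using hn
    · rw [Polynomial.natDegree_lt_iff_degree_lt h0]
      exact lt_of_lt_of_le (Lagrange.degree_interpolate_lt y hinj) (by exact_mod_cast hS)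
  have := Lagrange.eval_interpolate_at_node y hinj hi
  rw [← this, ← hp, Polynomial.eval_eq_sum_range' hdeg, Finset.sum_range]
  simp only [dotProduct, avec]
  exact Finset.sum_congr rfl fun l _ => mul_comm _ _

/-- combination -/
def comb {m : ℕ} (n : ℕ) (S : Finset (Fin m)) (c : Fin m → ℝ) : Fin n → ℝ :=
  ∑ j ∈ S, c j • avec n j

lemma comb_dot {m n : ℕ} (S : Finset (Fin m)) (c : Fin m → ℝ) (x : Fin n → ℝ) :
    comb n S c ⬝ᵥ x = ∑ j ∈ S, c j * (avec n j ⬝ᵥ x) := by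
  simp [comb, sum_dotProduct, smul_dotProduct]

lemma comb_zero {m n : ℕ} (S : Finset (Fin m)) (hS : S.card ≤ n) (c : Fin m → ℝ)
    (h : ∀ i ∈ S, avec n i ⬝ᵥ comb n S c = 0) : ∀ i ∈ S, c i = 0 := by
  have h1 : comb n S c ⬝ᵥ comb n S c = 0 := by
    rw [comb_dot]; exact Finset.sum_eq_zero fun i hi => by rw [h i hi, mul_zero]
  have h2 : comb n S c = 0 := dotProduct_self_eq_zero.1 h1
  obtain ⟨x, hx⟩ := avec_surj S hS c
  have h3 := comb_dot S c x
  rw [h2, zero_dotProduct, Finset.sum_congr rfl fun i hi => by rw [hx i hi]] at h3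
  intro i hi
  have := (Finset.sum_eq_zero_iff_of_nonneg fun i _ => mul_self_nonneg (c i)).1 h3.symm i hi
  simpa using this

lemma comb_sub {m n : ℕ} (S : Finset (Fin m)) (c d : Fin m → ℝ) :
    comb n S (c - d) = comb n S c - comb n S d := by
  simp [comb, sub_smul, Finset.sum_sub_distrib]

lemma comb_unique {m n : ℕ} (S : Finset (Fin m)) (hS : S.card ≤ n) (c d : Fin m → ℝ)
    (h : ∀ i ∈ S, avec n i ⬝ᵥ comb n S c = avec n i ⬝ᵥ comb n S d) : ∀ i ∈ S, c i = d i := by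
  intro i hi
  have := comb_zero S hS (c - d) (fun i hi => by rw [comb_sub, dotProduct_sub, h i hi, sub_self]) i hi
  simpa [sub_eq_zero] using this

lemma exists_L {m n : ℕ} (S : Finset (Fin m)) : ∃ L : (Fin m → ℝ) →ₗ[ℝ] (Fin m → ℝ),
    S.card ≤ n → ∀ y, ∀ i ∈ S, avec n i ⬝ᵥ comb n S (L y) = y i := by
  classical
  by_cases hS : S.card ≤ n
  swap
  · exact ⟨0, fun h => absurd h hS⟩
  let Gm : (Fin m → ℝ) →ₗ[ℝ] (Fin m → ℝ) :=
    { toFun := fun c i => if i ∈ S then avec n i ⬝ᵥ comb n S c else c i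
      map_add' := by
        intro c d; ext i
        by_cases h : i ∈ S <;>
          simp [h, comb, add_smul, Finset.sum_add_distrib, dotProduct_add]
      map_smul' := by
        intro t c; ext i
        by_cases h : i ∈ S
        · have : comb n S (t • c) = t • comb n S c := by
            simp [comb, Finset.smul_sum, smul_smul]
          simp [h, this, dotProduct_smul]
        · simp [h] }
  have hG : ∀ c i, Gm c i = if i ∈ S then avec n i ⬝ᵥ comb n S c else c i := fun _ _ => rfl
  have hinj : Function.Injective Gm := by
    rw [injective_iff_map_eq_zero]
    intro c hc
    have h1 : ∀ i ∈ S, c i = 0 := comb_zero S hS c fun i hi => by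
      have := congrFun hc i
      rw [hG, if_pos hi] at this
      exact this
    ext i
    by_cases hi : i ∈ S
    · exact h1 i hi
    · have := congrFun hc i
      rw [hG, if_neg hi] at this
      exact this
  refine ⟨(LinearEquiv.ofInjectiveEndo Gm hinj).symm.toLinearMap, fun _ y i hi => ?_⟩
  have h2 : Gm ((LinearEquiv.ofInjectiveEndo Gm hinj).symm y) = y := by
    exact (LinearEquiv.ofInjectiveEndo Gm hinj).apply_symm_apply y
  have := congrFun h2 i
  rw [hG, if_pos hi] at this
  exact this

lemma exists_generic {m : ℕ} (n : ℕ) (k : Fin m → ℕ) :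
    ∃ β : (i : Fin m) → Fin (k i) → ℝ, (∀ i, StrictMono (β i)) ∧
      ∀ S : Finset (Fin m), S.card ≤ n → ∀ z : (i : Fin m) → Fin (k i), ∃ c : Fin m → ℝ,
        (∀ i ∈ S, c i ≠ 0 ∧ avec n i ⬝ᵥ comb n S c = β i (z i)) ∧
        ∀ j, j ∉ S → ∀ r, avec n j ⬝ᵥ comb n S c ≠ β j r := by
  classical
  suffices h : ∃ β : (i : Fin m) → Fin (k i) → ℝ, (∀ i, Function.Injective (β i)) ∧
      ∀ S : Finset (Fin m), S.card ≤ n → ∀ z : (i : Fin m) → Fin (k i), ∃ c : Fin m → ℝ,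
        (∀ i ∈ S, c i ≠ 0 ∧ avec n i ⬝ᵥ comb n S c = β i (z i)) ∧
        ∀ j, j ∉ S → ∀ r, avec n j ⬝ᵥ comb n S c ≠ β j r by
    obtain ⟨β, h1, h2⟩ := h
    refine ⟨fun i => β i ∘ Tuple.sort (β i), fun i => ?_, fun S hS z => ?_⟩
    · exact (Tuple.monotone_sort (β i)).strictMono_of_injective
        ((h1 i).comp (Tuple.sort (β i)).injective)
    · obtain ⟨c, hc1, hc2⟩ := h2 S hS (fun i => Tuple.sort (β i) (z i))
      exact ⟨c, hc1, fun j hj r => hc2 j hj _⟩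
  choose L hL using fun S : Finset (Fin m) => exists_L (n := n) S
  let I1 := {x : (Σ i : Fin m, Fin (k i) × Fin (k i)) // x.2.1 ≠ x.2.2}
  let I2 := {x : Finset (Fin m) × ((i : Fin m) → Fin (k i)) × (Σ j : Fin m, Fin (k j)) //
    x.2.2.1 ∉ x.1}
  let P := (i : Fin m) → Fin (k i) → ℝ
  let ev : (i : Fin m) → Fin (k i) → (P →ₗ[ℝ] ℝ) := fun i r =>
    (LinearMap.proj r).comp (LinearMap.proj (R := ℝ) (φ := fun i => Fin (k i) → ℝ) i)
  have hev : ∀ i r (β : P), ev i r β = β i r := fun _ _ _ => rfl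
  let rho : Finset (Fin m) → ((i : Fin m) → Fin (k i)) → (P →ₗ[ℝ] (Fin m → ℝ)) := fun S z =>
    LinearMap.pi fun i => if i ∈ S then ev i (z i) else 0
  have hrho : ∀ S z (β : P) i, rho S z β i = if i ∈ S then β i (z i) else 0 := by
    intro S z β i
    simp only [rho, LinearMap.pi_apply]
    split_ifs
    · rfl
    · rfl
  let f : I1 ⊕ I2 → Module.Dual ℝ P := Sum.elim
    (fun x => ev x.1.1 x.1.2.1 - ev x.1.1 x.1.2.2)
    (fun x => (∑ i ∈ x.1.1, (avec n x.1.2.2.1 ⬝ᵥ avec n i) •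
      ((LinearMap.proj i).comp ((L x.1.1).comp (rho x.1.1 x.1.2.1)))) - ev x.1.2.2.1 x.1.2.2.2)
  have hf2 : ∀ S z j r (hj : j ∉ S) (β : P), f (Sum.inr ⟨(S, z, ⟨j, r⟩), hj⟩) β =
      avec n j ⬝ᵥ comb n S (L S (rho S z β)) - β j r := by
    intro S z j r hj β
    rw [dotProduct_comm, comb_dot]
    simp only [f, Sum.elim_inr, LinearMap.sub_apply, LinearMap.sum_apply, LinearMap.smul_apply,
      LinearMap.comp_apply, LinearMap.proj_apply, smul_eq_mul, hev]
    congr 1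
    refine Finset.sum_congr rfl fun i _ => ?_
    rw [dotProduct_comm, mul_comm]
  obtain ⟨β, hβ⟩ := Module.Dual.exists_forall_ne_zero_of_forall_exists f (by
    rintro (⟨⟨i, r, s⟩, hrs⟩ | ⟨⟨S, z, j, r⟩, hj⟩)
    · refine ⟨Pi.single i (Pi.single r 1), ?_⟩
      have hrs' : s ≠ r := fun h => hrs h.symm
      simp [f, hev, hrs']
    · refine ⟨Pi.single j (Pi.single r 1), ?_⟩
      rw [hf2]
      have h0 : rho S z (Pi.single j (Pi.single r 1)) = 0 := by
        ext i
        rw [hrho]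
        split_ifs with hi
        · have : i ≠ j := fun h => hj (h ▸ hi)
          simp [this]
        · rfl
      rw [h0, map_zero]
      simp [comb])
  have hgen : ∀ S z j r, j ∉ S → avec n j ⬝ᵥ comb n S (L S (rho S z β)) ≠ β j r := by
    intro S z j r hj h
    apply hβ (Sum.inr ⟨(S, z, ⟨j, r⟩), hj⟩)
    rw [hf2, h, sub_self]
  have hsol : ∀ S : Finset (Fin m), S.card ≤ n → ∀ z, ∀ i ∈ S,
      avec n i ⬝ᵥ comb n S (L S (rho S z β)) = β i (z i) := by
    intro S hS z i hi
    rw [hL S hS _ i hi, hrho, if_pos hi]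
  refine ⟨β, fun i r s hrs => ?_, fun S hS z => ⟨L S (rho S z β), fun i hi => ⟨?_, hsol S hS z i hi⟩,
    fun j hj r => hgen S z j r hj⟩⟩
  · by_contra hne
    apply hβ (Sum.inl ⟨⟨i, r, s⟩, hne⟩)
    simp [f, hev, hrs]
  · intro h0
    have hS' : (S.erase i).card ≤ n := (Finset.card_erase_le).trans hS
    have e1 : comb n S (L S (rho S z β)) = comb n (S.erase i) (L S (rho S z β)) := by
      rw [comb, comb, ← Finset.add_sum_erase _ _ hi, h0]; simp
    have e2 : comb n (S.erase i) (L S (rho S z β)) =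
        comb n (S.erase i) (L (S.erase i) (rho (S.erase i) z β)) := by
      refine Finset.sum_congr rfl fun j hj => ?_
      rw [comb_unique (S.erase i) hS' (L S (rho S z β)) (L (S.erase i) (rho (S.erase i) z β)) _ j hj]
      intro l hl
      rw [← e1, hsol S hS z l (Finset.mem_of_mem_erase hl), hsol _ hS' z l hl]
    refine hgen (S.erase i) z i (z i) (Finset.notMem_erase i S) ?_
    rw [← e2, ← e1, hsol S hS z i hi]

lemma dom (k : ℕ) (B : ℕ → ℝ) (t : ℝ) (κ : ℕ) (hκ : κ < k)
    (h1 : ∀ s, 1 ≤ s → s ≤ κ → B s < t) (h2 : ∀ s, κ < s → s < k → t < B s) (r : ℕ) (hr : r < k) :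
    r * t - ∑ s ∈ Finset.range r, B (s + 1) ≤ κ * t - ∑ s ∈ Finset.range κ, B (s + 1) := by
  rcases le_total κ r with h | h
  · induction r, h using Nat.le_induction with
    | base => exact le_rfl
    | succ r hκr ih =>
      have := ih (by omega)
      have h3 := h2 (r+1) (by omega) hr
      rw [Finset.sum_range_succ]; push_cast; linarith
  · clear hr h2 hκ
    induction κ, h using Nat.le_induction with
    | base => exact le_rfl
    | succ κ hκr ih =>
      have h3 := h1 (κ+1) (by omega) le_rfl
      have h4 := ih (fun s hs hs2 => h1 s hs (by omega))
      rw [Finset.sum_range_succ]; push_cast; linarith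

lemma exists_cell {k : ℕ} (hk : 1 ≤ k) (β : Fin k → ℝ) (hβ : StrictMono β) (t : ℝ)
    (ht : ∀ s : Fin k, (s : ℕ) ≠ 0 → t ≠ β s) :
    ∃ κ : Fin k, (∀ s : Fin k, (s : ℕ) ≠ 0 → s ≤ κ → β s < t) ∧ (∀ s, κ < s → t < β s) := by
  classical
  obtain ⟨κ, hκ, hmax⟩ := Finset.exists_max_image
    (Finset.univ.filter fun s : Fin k => (s : ℕ) = 0 ∨ β s < t) id ⟨⟨0, hk⟩, by simp⟩
  simp only [Finset.mem_filter, Finset.mem_univ, true_and, id] at hκ hmax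
  refine ⟨κ, fun s hs hsκ => ?_, fun s hs => ?_⟩
  · rcases hκ with h | h
    · have : (s : ℕ) ≤ κ := hsκ
      omega
    · exact lt_of_le_of_lt (hβ.monotone hsκ) h
  · by_contra hlt
    have hs0 : (s : ℕ) ≠ 0 := by
      have : (κ : ℕ) < s := hs
      omega
    have := hmax s (Or.inr (lt_of_le_of_ne (not_lt.1 hlt) (ht s hs0).symm))
    exact absurd hs (not_lt.2 this)

lemma exists_point {m n : ℕ} {k : Fin m → ℕ} (β : (i : Fin m) → Fin (k i) → ℝ)
    (S : Finset (Fin m)) (hS : S.card ≤ n) (z : (i : Fin m) → Fin (k i)) (c : Fin m → ℝ)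
    (hc : ∀ i ∈ S, c i ≠ 0 ∧ avec n i ⬝ᵥ comb n S c = β i (z i)) :
    ∃ x : Fin n → ℝ, (∀ i s, (β i s < avec n i ⬝ᵥ comb n S c → β i s < avec n i ⬝ᵥ x) ∧
      (avec n i ⬝ᵥ comb n S c < β i s → avec n i ⬝ᵥ x < β i s)) ∧
      ∀ i ∈ S, 0 < c i * (avec n i ⬝ᵥ x - β i (z i)) := by
  obtain ⟨d, hd⟩ := avec_surj S hS c
  have hcont : ∀ i : Fin m, Tendsto (fun e : ℝ => avec n i ⬝ᵥ (comb n S c + e • d)) (𝓝[>] 0)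
      (𝓝 (avec n i ⬝ᵥ comb n S c)) := by
    intro i
    have h1 : Continuous (fun e : ℝ => avec n i ⬝ᵥ comb n S c + e * (avec n i ⬝ᵥ d)) := by fun_prop
    have h2 := h1.tendsto 0
    simp only [zero_mul, add_zero] at h2
    refine (h2.mono_left nhdsWithin_le_nhds).congr fun e => ?_
    rw [dotProduct_add, dotProduct_smul, smul_eq_mul]
  have hev : ∀ᶠ e : ℝ in 𝓝[>] 0, ∀ i s,
      (β i s < avec n i ⬝ᵥ comb n S c → β i s < avec n i ⬝ᵥ (comb n S c + e • d)) ∧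
      (avec n i ⬝ᵥ comb n S c < β i s → avec n i ⬝ᵥ (comb n S c + e • d) < β i s) := by
    refine eventually_all.2 fun i => eventually_all.2 fun s => Filter.Eventually.and ?_ ?_
    · by_cases h : β i s < avec n i ⬝ᵥ comb n S c
      · filter_upwards [(hcont i).eventually (lt_mem_nhds h)] with e he _ using he
      · exact Eventually.of_forall fun e h' => absurd h' h
    · by_cases h : avec n i ⬝ᵥ comb n S c < β i s
      · filter_upwards [(hcont i).eventually (gt_mem_nhds h)] with e he _ using he
      · exact Eventually.of_forall fun e h' => absurd h' h
  obtain ⟨e, he, he0⟩ := (hev.and self_mem_nhdsWithin).exists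
  refine ⟨comb n S c + e • d, he, fun i hi => ?_⟩
  rw [dotProduct_add, dotProduct_smul, (hc i hi).2, hd i hi, smul_eq_mul]
  have h1 : 0 < c i * c i := mul_self_pos.2 (hc i hi).1
  have h2 : (0:ℝ) < e := he0
  have : c i * (β i (z i) + e * c i - β i (z i)) = e * (c i * c i) := by ring
  rw [this]; positivity

/-- affine map with prescribed pieces -/
noncomputable def pieceAff {n m : ℕ} {k : Fin m → ℕ} (w : (j : Fin m) → Fin (k j) → Fin n → ℝ)
    (b : (j : Fin m) → Fin (k j) → ℝ) (R : (j : Fin m) → Fin (k j)) :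
    (Fin n → ℝ) →ᵃ[ℝ] (Fin m → ℝ) :=
  (Matrix.mulVecLin (Matrix.of fun j => w j (R j))).toAffineMap +
    AffineMap.const ℝ _ (fun j => b j (R j))

lemma pieceAff_apply {n m : ℕ} {k : Fin m → ℕ} (w : (j : Fin m) → Fin (k j) → Fin n → ℝ)
    (b : (j : Fin m) → Fin (k j) → ℝ) (R : (j : Fin m) → Fin (k j)) (y : Fin n → ℝ) (j : Fin m) :
    pieceAff w b R y j = piece w b j (R j) y := by
  simp [pieceAff, piece, Matrix.mulVec, dotProduct]

lemma lower {n m : ℕ} (k : Fin m → ℕ) (hk : ∀ i, 1 ≤ k i) :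
    ∃ (w : (j : Fin m) → Fin (k j) → Fin n → ℝ) (b : (j : Fin m) → Fin (k j) → ℝ),
      (Zset n k).card ≤ Nat.card (germs (maxoutLayer k w b)) := by
  classical
  obtain ⟨β, hmono, hgen⟩ := exists_generic n k
  let B : Fin m → ℕ → ℝ := fun i s => if h : s < k i then β i ⟨s, h⟩ else 0
  have hB : ∀ i (s : Fin (k i)), B i s = β i s := fun i s => by simp [B]
  let w : (j : Fin m) → Fin (k j) → Fin n → ℝ := fun j r l => (r : ℕ) * avec n j l
  let b : (j : Fin m) → Fin (k j) → ℝ := fun j r => - ∑ s ∈ Finset.range r, B j (s + 1)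
  have hpiece : ∀ j r x, piece w b j r x =
      ((r : ℕ) : ℝ) * (avec n j ⬝ᵥ x) - ∑ s ∈ Finset.range r, B j (s + 1) := by
    intro j r x
    simp [piece, w, b, dotProduct, Finset.mul_sum, mul_assoc, sub_eq_add_neg]
  have hdom : ∀ j (κ r : Fin (k j)) x, (∀ s : Fin (k j), (s : ℕ) ≠ 0 → s ≤ κ → β j s < avec n j ⬝ᵥ x) →
      (∀ s, κ < s → avec n j ⬝ᵥ x < β j s) → piece w b j r x ≤ piece w b j κ x := by
    intro j κ r x h1 h2
    rw [hpiece, hpiece]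
    refine dom (k j) (B j) _ κ κ.2 (fun s hs hsκ => ?_) (fun s hs hs2 => ?_) r r.2
    · have hsk : s < k j := lt_of_le_of_lt hsκ κ.2
      have := h1 ⟨s, hsk⟩ (by simp; omega) hsκ
      simpa [B, hsk] using this
    · have := h2 ⟨s, hs2⟩ hs
      simpa [B, hs2] using this
  refine ⟨w, b, ?_⟩
  let supp : ((i : Fin m) → Fin (k i)) → Finset (Fin m) :=
    fun z => Finset.univ.filter fun i => (z i : ℕ) ≠ 0
  have hsupp : ∀ z : Zset n k, (supp z).card ≤ n := fun z => by
    have := z.2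
    simp only [Zset, Finset.mem_filter, Finset.mem_univ, true_and] at this
    exact this
  choose c hc1 hc2 using fun z : Zset n k => hgen (supp z) (hsupp z) z
  choose x hx1 hx2 using fun z : Zset n k =>
    exists_point β (supp z) (hsupp z) z (c z) (hc1 z)
  have hoff : ∀ z i (s : Fin (k i)), avec n i ⬝ᵥ x z ≠ β i s := by
    intro z i s h
    rcases lt_trichotomy (avec n i ⬝ᵥ comb n (supp z) (c z)) (β i s) with h1 | h1 | h1
    · exact absurd h ((hx1 z i s).2 h1).ne
    · by_cases hi : i ∈ supp z
      · have h2 := hx2 z i hi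
        rw [← (hc1 z i hi).2, h1, h, sub_self, mul_zero] at h2
        exact lt_irrefl _ h2
      · exact hc2 z i hi s h1
    · exact absurd h ((hx1 z i s).1 h1).ne'
  choose κ hκ1 hκ2 using fun (z : Zset n k) i =>
    exists_cell (hk i) (β i) (hmono i) (avec n i ⬝ᵥ x z) (fun s _ => hoff z i s)
  have hgerm : ∀ z : Zset n k, pieceAff w b (κ z) ∈ germs (maxoutLayer k w b) := by
    intro z
    refine ⟨x z, ?_⟩
    have hcont : ∀ i : Fin m, Continuous fun y : Fin n → ℝ => avec n i ⬝ᵥ y := by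
      intro i; unfold dotProduct; fun_prop
    have hev : ∀ᶠ y in 𝓝 (x z), ∀ i s, ((β i s < avec n i ⬝ᵥ x z → β i s < avec n i ⬝ᵥ y) ∧
      (avec n i ⬝ᵥ x z < β i s → avec n i ⬝ᵥ y < β i s)) := by
      refine eventually_all.2 fun i => eventually_all.2 fun s => Filter.Eventually.and ?_ ?_
      · by_cases h : β i s < avec n i ⬝ᵥ x z
        · filter_upwards [((hcont i).tendsto _).eventually (lt_mem_nhds h)] with e he _ using he
        · exact Eventually.of_forall fun e h' => absurd h' h
      · by_cases h : avec n i ⬝ᵥ x z < β i s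
        · filter_upwards [((hcont i).tendsto _).eventually (gt_mem_nhds h)] with e he _ using he
        · exact Eventually.of_forall fun e h' => absurd h' h
    filter_upwards [hev] with y hy
    ext j
    rw [pieceAff_apply]
    refine le_antisymm ?_ (layer_ge hk w b y j _)
    obtain ⟨r, hr⟩ := layer_attained hk w b y j
    rw [hr]
    exact hdom j _ r y (fun s hs hs2 => (hy j s).1 (hκ1 z j s hs hs2))
      (fun s hs => (hy j s).2 (hκ2 z j s hs))
  have hinj : Function.Injective
      (fun z : Zset n k => (⟨_, hgerm z⟩ : germs (maxoutLayer k w b))) := by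
    intro z z' h
    have hg : pieceAff w b (κ z) = pieceAff w b (κ z') := congrArg Subtype.val h
    rcases Nat.eq_zero_or_pos n with hn | hn
    · apply Subtype.ext
      have e : ∀ z : Zset n k, ∀ i, (z.1 i : ℕ) = 0 := by
        intro z i
        by_contra h0
        have h1 : i ∈ supp z := by simp [supp, h0]
        have h2 := Finset.card_pos.2 ⟨i, h1⟩
        have h3 := hsupp z
        omega
      ext i
      rw [e, e]
    have hκ : ∀ i, κ z i = κ z' i := by
      intro i
      have h1 : piece w b i (κ z i) 0 = piece w b i (κ z' i) 0 := by
        rw [← pieceAff_apply, hg, pieceAff_apply]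
      have h2 : piece w b i (κ z i) (Pi.single ⟨0, hn⟩ 1) =
          piece w b i (κ z' i) (Pi.single ⟨0, hn⟩ 1) := by
        rw [← pieceAff_apply, hg, pieceAff_apply]
      rw [hpiece, hpiece, dotProduct_zero] at h1
      rw [hpiece, hpiece, dotProduct_single] at h2
      simp only [avec, pow_zero, mul_one, mul_zero] at h1 h2
      have h3 : (((κ z i : Fin (k i)) : ℕ) : ℝ) = ((κ z' i : Fin (k i)) : ℕ) := by linarith
      exact Fin.ext (by exact_mod_cast h3)
    have main : ∀ z z' : Zset n k, (∀ i, κ z i = κ z' i) →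
        0 ≤ comb n (supp z) (c z) ⬝ᵥ (comb n (supp z') (c z') - comb n (supp z) (c z)) := by
      intro z z' hκ
      rw [comb_dot]
      refine Finset.sum_nonneg fun i hi => ?_
      rw [dotProduct_sub, (hc1 z i hi).2]
      have hzi : (z.1 i : ℕ) ≠ 0 := by simpa [supp] using hi
      have hpos := hx2 z i hi
      rcases le_or_gt (z.1 i) (κ z i) with hle | hlt
      · have h1 := hκ1 z i _ hzi hle
        have h2 := hκ1 z' i _ hzi (hκ i ▸ hle)
        have hc : 0 < c z i := pos_of_mul_pos_left hpos (by linarith)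
        refine mul_nonneg hc.le ?_
        by_contra hneg
        have := (hx1 z' i (z.1 i)).2 (by linarith)
        linarith
      · have h1 := hκ2 z i _ hlt
        have h2 := hκ2 z' i _ (hκ i ▸ hlt)
        have hc : c z i < 0 := by
          by_contra hc
          have := mul_nonneg (not_lt.1 hc) (sub_nonneg.2 h1.le)
          linarith
        refine mul_nonneg_of_nonpos_of_nonpos hc.le ?_
        by_contra hneg
        have := (hx1 z' i (z.1 i)).1 (by linarith)
        linarith
    have m1 := main z z' hκ
    have m2 := main z' z fun i => (hκ i).symm
    set v := comb n (supp z) (c z) with hv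
    set v' := comb n (supp z') (c z') with hv'
    have m3 : (v' - v) ⬝ᵥ (v' - v) = 0 := by
      refine le_antisymm ?_ (by
        simp only [dotProduct]; exact Finset.sum_nonneg fun _ _ => mul_self_nonneg _)
      have : (v' - v) ⬝ᵥ (v' - v) = - (v' ⬝ᵥ (v - v')) - (v ⬝ᵥ (v' - v)) := by
        simp only [sub_dotProduct, dotProduct_sub]; ring
      rw [this]; linarith
    have m4 : v' = v := sub_eq_zero.1 (dotProduct_self_eq_zero.1 m3)
    have hsub : ∀ z z' : Zset n k, comb n (supp z') (c z') = comb n (supp z) (c z) →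
        ∀ i ∈ supp z, z.1 i = z'.1 i := by
      intro z z' hvv i hi
      have h1 := (hc1 z i hi).2
      by_cases hi' : i ∈ supp z'
      · have h2 := (hc1 z' i hi').2
        rw [hvv, h1] at h2
        exact (hmono i).injective h2
      · exact absurd (hvv ▸ h1) (hc2 z' i hi' _)
    apply Subtype.ext
    funext i
    by_cases hi : i ∈ supp z
    · exact hsub z z' m4 i hi
    · by_cases hi' : i ∈ supp z'
      · exact (hsub z' z m4.symm i hi').symm
      · simp only [supp, Finset.mem_filter, Finset.mem_univ, true_and, not_not] at hi hi'
        exact Fin.ext (hi.trans hi'.symm)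
  have : Finite (germs (maxoutLayer k w b)) := (germs_bound hk w b).1
  have h := Nat.card_le_card_of_injective _ hinj
  simpa using h

end Maxout

theorem shallow_maxout_optimal (n m : ℕ) (k : Fin m → ℕ) (hk : ∀ i, 1 ≤ k i) :
    IsGreatest {N : ℕ | ∃ (w : (j : Fin m) → Fin (k j) → Fin n → ℝ)
        (b : (j : Fin m) → Fin (k j) → ℝ), N = numRegions (maxoutLayer k w b)}
      (∑ j ∈ Finset.range (n + 1),
        ∑ S ∈ Finset.powersetCard j (Finset.univ : Finset (Fin m)), ∏ i ∈ S, (k i - 1)) ∧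
    ∀ c : ℕ, (∀ i, k i = c) →
      (∑ j ∈ Finset.range (n + 1),
          ∑ S ∈ Finset.powersetCard j (Finset.univ : Finset (Fin m)), ∏ i ∈ S, (k i - 1))
        = ∑ j ∈ Finset.range (n + 1), m.choose j * (c - 1) ^ j := by
  refine ⟨?_, ?_⟩
  · rw [← Maxout.card_Zset n k hk]
    refine ⟨?_, ?_⟩
    · obtain ⟨w, b, h⟩ := Maxout.lower (n := n) k hk
      refine ⟨w, b, ?_⟩
      rw [Maxout.numRegions_eq hk]
      exact le_antisymm h (Maxout.germs_bound hk w b).2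
    · rintro N ⟨w, b, rfl⟩
      rw [Maxout.numRegions_eq hk]
      exact (Maxout.germs_bound hk w b).2
  · intro c hc
    refine Finset.sum_congr rfl fun j _ => ?_
    have : ∀ S ∈ Finset.powersetCard j (Finset.univ : Finset (Fin m)),
        ∏ i ∈ S, (k i - 1) = (c - 1) ^ j := by
      intro S hS
      rw [Finset.prod_congr rfl fun i _ => by rw [hc i], Finset.prod_const,
        (Finset.mem_powersetCard.1 hS).2]
    rw [Finset.sum_congr rfl this]
    simp
end

section
/- Let 𝒩 be a maxout network architecture with a finite number of maxout units, with parameter space ℝ^D, and for θ ∈ ℝ^D let f_θ denote the represented function. Then for every θ ∈ ℝ^D there exist ε = ε(θ) > 0 and a Lebesgue-null set Z ⊆ ℝ^D such that for every θ′ with ‖θ′ − θ‖ < ε and θ′ ∉ Z, the number of linear regions satisfies N(f_{θ′}) ≥ N(f_θ). -/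
open Filter Topology

noncomputable def netEval (nn : ℕ → ℕ) (k : (l : ℕ) → Fin (nn (l + 1)) → ℕ)
    (θ : (l : ℕ) → (j : Fin (nn (l + 1))) → Fin (k l j) → ((Fin (nn l) → ℝ) × ℝ)) :
    (L : ℕ) → (Fin (nn 0) → ℝ) → (Fin (nn L) → ℝ)
  | 0 => id
  | L + 1 =>
      (maxoutLayer (k L) (fun j r => (θ L j r).1) (fun j r => (θ L j r).2)) ∘ netEval nn k θ L

/-- The parameter space of a maxout network with `L` layers: for each layer `l < L`,
each unit `j` and each pre-activation feature `r`, a weight vector and a bias. -/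
def ParamSpace (L : ℕ) (nn : ℕ → ℕ) (k : (l : ℕ) → Fin (nn (l + 1)) → ℕ) : Type :=
  (l : Fin L) → (j : Fin (nn ((l : ℕ) + 1))) → Fin (k (l : ℕ) j) → ((Fin (nn (l : ℕ)) → ℝ) × ℝ)

noncomputable instance (L : ℕ) (nn : ℕ → ℕ) (k : (l : ℕ) → Fin (nn (l + 1)) → ℕ) :
    NormedAddCommGroup (ParamSpace L nn k) := by unfold ParamSpace; infer_instance

noncomputable instance (L : ℕ) (nn : ℕ → ℕ) (k : (l : ℕ) → Fin (nn (l + 1)) → ℕ) :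
    MeasureTheory.MeasureSpace (ParamSpace L nn k) := by unfold ParamSpace; infer_instance

/-- Extend a finitely-indexed parameter to all layer indices (junk `0` beyond `L`). -/
noncomputable def extendParams {L : ℕ} {nn : ℕ → ℕ} {k : (l : ℕ) → Fin (nn (l + 1)) → ℕ}
    (θ : ParamSpace L nn k) :
    (l : ℕ) → (j : Fin (nn (l + 1))) → Fin (k l j) → ((Fin (nn l) → ℝ) × ℝ) :=
  fun l j r => if h : l < L then θ ⟨l, h⟩ j r else 0

section AbstractPart

variable {n m : ℕ}

theorem nll_compl_isOpen (f : (Fin n → ℝ) → (Fin m → ℝ)) : IsOpen (nonlinearLocus f)ᶜ := by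
  rw [isOpen_iff_mem_nhds]
  intro x hx
  simp only [nonlinearLocus, Set.mem_compl_iff, Set.mem_ofPred_eq, not_not] at hx
  obtain ⟨g, hg⟩ := hx
  filter_upwards [hg.eventually_nhds] with y hy
  simp only [nonlinearLocus, Set.mem_compl_iff, Set.mem_ofPred_eq, not_not]
  exact ⟨g, hy⟩

theorem mk_eq_of_preconn {W S : Set (Fin n → ℝ)} (hS : IsPreconnected S) (hSW : S ⊆ W)
    {x y : W} (hx : (x : Fin n → ℝ) ∈ S) (hy : (y : Fin n → ℝ) ∈ S) :
    (x : ConnectedComponents W) = (y : ConnectedComponents W) := by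
  have h1 : IsPreconnected ((Subtype.val : W → (Fin n → ℝ)) ⁻¹' S) := by
    refine Topology.IsInducing.subtypeVal.isPreconnected_image.mp ?_
    rwa [Subtype.image_preimage_coe, Set.inter_eq_right.mpr hSW]
  rw [ConnectedComponents.coe_eq_coe']
  exact h1.subset_connectedComponent (x := y) hy hx

theorem affine_eq_of_eventually {g h : (Fin n → ℝ) →ᵃ[ℝ] (Fin m → ℝ)} {x : Fin n → ℝ}
    (H : ∀ᶠ y in 𝓝 x, g y = h y) : g = h := by
  obtain ⟨u, hu, huo, hxu⟩ := mem_nhds_iff.1 H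
  exact AffineMap.ext_on (huo.affineSpan_eq_top ⟨x, hxu⟩) hu

theorem affine_same_of_mk_eq (f : (Fin n → ℝ) → (Fin m → ℝ))
    {x y : ↥(nonlinearLocus f)ᶜ}
    (hxy : (x : ConnectedComponents ↥(nonlinearLocus f)ᶜ) = y)
    {g h : (Fin n → ℝ) →ᵃ[ℝ] (Fin m → ℝ)}
    (hg : ∀ᶠ z in 𝓝 (x : Fin n → ℝ), f z = g z) (hh : ∀ᶠ z in 𝓝 (y : Fin n → ℝ), f z = h z) :
    g = h := by
  let T : Set ↥(nonlinearLocus f)ᶜ := {p | ∀ᶠ z in 𝓝 (p : Fin n → ℝ), f z = h z}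
  have hT : IsClopen T := by
    constructor
    · rw [← isOpen_compl_iff, isOpen_iff_mem_nhds]
      intro p hp
      have hp2 := p.2
      simp only [nonlinearLocus, Set.mem_compl_iff, Set.mem_ofPred_eq, not_not] at hp2
      obtain ⟨q, hq⟩ := hp2
      filter_upwards [continuous_subtype_val.continuousAt.eventually hq.eventually_nhds] with r hr hrT
      apply hp
      have : q = h := by
        apply affine_eq_of_eventually (x := (r : Fin n → ℝ))
        filter_upwards [hr, hrT] with z h1 h2
        rw [← h1, h2]
      rw [this] at hq
      exact hq
    · rw [isOpen_iff_mem_nhds]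
      intro p hp
      filter_upwards [continuous_subtype_val.continuousAt.eventually
        (Filter.Eventually.eventually_nhds hp)] with r hr
      exact hr
  have hxT : x ∈ T := hT.connectedComponent_subset (x := y) hh (ConnectedComponents.coe_eq_coe'.1 hxy)
  apply affine_eq_of_eventually (x := (x : Fin n → ℝ))
  filter_upwards [hg, hxT] with z h1 h2
  rw [← h1, h2]

theorem good_dense {ι : Type*} [Finite ι] (C : ι → Set (Fin n → ℝ)) (hC : ∀ s, IsClosed (C s)) :
    Dense {x | ∀ s, x ∈ C s → x ∈ interior (C s)} := by
  have : Dense (⋂ s, (frontier (C s))ᶜ) := by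
    apply dense_iInter_of_isOpen
    · intro s; exact isClosed_frontier.isOpen_compl
    · intro s
      rw [← interior_eq_empty_iff_dense_compl]
      exact interior_frontier (hC s)
  refine this.mono ?_
  intro x hx s hs
  have := Set.mem_iInter.1 hx s
  rw [(hC s).frontier_eq] at this
  by_contra h
  exact this ⟨hs, h⟩

theorem interior_cell_subset {f : (Fin n → ℝ) → (Fin m → ℝ)} {C : Set (Fin n → ℝ)}
    {g : (Fin n → ℝ) →ᵃ[ℝ] (Fin m → ℝ)} (h : ∀ x ∈ C, f x = g x) :
    ∀ x ∈ interior C, ∀ᶠ y in 𝓝 x, f y = g y := by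
  intro x hx
  filter_upwards [mem_interior_iff_mem_nhds.1 hx] with y hy using h y hy

/-- every component has a good representative -/
theorem exists_good_rep {ι : Type*} [Finite ι] (f : (Fin n → ℝ) → (Fin m → ℝ))
    (C : ι → Set (Fin n → ℝ)) (hC : ∀ s, IsClosed (C s))
    (c : ConnectedComponents ↥(nonlinearLocus f)ᶜ) :
    ∃ x : ↥(nonlinearLocus f)ᶜ, (x : ConnectedComponents ↥(nonlinearLocus f)ᶜ) = c ∧
      ∀ s, (x : Fin n → ℝ) ∈ C s → (x : Fin n → ℝ) ∈ interior (C s) := by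
  obtain ⟨x, rfl⟩ := ConnectedComponents.surjective_coe c
  obtain ⟨δ, hδ, hball⟩ := Metric.isOpen_iff.1 (nll_compl_isOpen f) x x.2
  obtain ⟨y, hy, hyG⟩ := (good_dense C hC).inter_open_nonempty _ Metric.isOpen_ball
    ⟨(x : Fin n → ℝ), Metric.mem_ball_self hδ⟩
  refine ⟨⟨y, hball hy⟩, ?_, hyG⟩
  exact mk_eq_of_preconn (convex_ball _ _).isPreconnected hball hy (Metric.mem_ball_self hδ)

theorem finite_comps {ι : Type*} [Finite ι] (f : (Fin n → ℝ) → (Fin m → ℝ))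
    (C : ι → Set (Fin n → ℝ)) (hC : ∀ s, IsClosed (C s)) (hconv : ∀ s, Convex ℝ (C s))
    (hcov : ∀ x, ∃ s, x ∈ C s) (g : ι → (Fin n → ℝ) →ᵃ[ℝ] (Fin m → ℝ))
    (hg : ∀ s, ∀ x ∈ C s, f x = g s x) :
    Finite (ConnectedComponents ↥(nonlinearLocus f)ᶜ) := by
  choose x hx hxG using exists_good_rep f C hC
  choose s hs using fun c => hcov (x c : Fin n → ℝ)
  apply Finite.of_injective s
  intro c c' h
  rw [← hx c, ← hx c']
  refine mk_eq_of_preconn (S := interior (C (s c))) (hconv _).interior.isPreconnected ?_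
    (hxG _ _ (hs c)) (by rw [h]; exact hxG _ _ (hs c'))
  intro z hz
  simp only [nonlinearLocus, Set.mem_compl_iff, Set.mem_ofPred_eq, not_not]
  exact ⟨g _, interior_cell_subset (hg _) z hz⟩

theorem abstract_main {ι Θ : Type*} [Finite ι] [TopologicalSpace Θ]
    (f : Θ → (Fin n → ℝ) → (Fin m → ℝ))
    (C : Θ → ι → Set (Fin n → ℝ))
    (hC : ∀ s, IsClosed {p : Θ × (Fin n → ℝ) | p.2 ∈ C p.1 s})
    (hconv : ∀ θ s, Convex ℝ (C θ s))
    (hcov : ∀ θ x, ∃ s, x ∈ C θ s) (g : Θ → ι → (Fin n → ℝ) →ᵃ[ℝ] (Fin m → ℝ))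
    (hg : ∀ θ s, ∀ x ∈ C θ s, f θ x = g θ s x) (θ : Θ) :
    ∀ᶠ θ' in 𝓝 θ, Function.Injective (g θ') → numRegions (f θ) ≤ numRegions (f θ') := by
  have hCc : ∀ θ s, IsClosed (C θ s) := fun θ s =>
    (hC s).preimage (f := fun x => (θ, x)) (by fun_prop)
  have hsub : ∀ θ s, interior (C θ s) ⊆ (nonlinearLocus (f θ))ᶜ := by
    intro θ s z hz
    simp only [nonlinearLocus, Set.mem_compl_iff, Set.mem_ofPred_eq, not_not]
    exact ⟨g θ s, interior_cell_subset (hg θ s) z hz⟩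
  have hfin := fun θ => finite_comps (f θ) (C θ) (hCc θ) (hconv θ) (hcov θ) (g θ) (hg θ)
  choose x hx hxG using exists_good_rep (f θ) (C θ) (hCc θ)
  have hev : ∀ c s, ∀ᶠ θ' in 𝓝 θ, ∀ᶠ y in 𝓝 (x c : Fin n → ℝ),
      y ∈ C θ' s → (x c : Fin n → ℝ) ∈ C θ s := by
    intro c s
    by_cases h : (x c : Fin n → ℝ) ∈ C θ s
    · simp [h]
    · have := (hC s).isOpen_compl.mem_nhds (x := (θ, (x c : Fin n → ℝ))) h
      have h2 : ∀ᶠ p in 𝓝 (θ, (x c : Fin n → ℝ)), p.2 ∉ C p.1 s := this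
      filter_upwards [h2.curry_nhds] with θ' h3
      filter_upwards [h3] with y hy hy2
      exact absurd hy2 hy
  have := hfin θ
  have hev2 : ∀ᶠ θ' in 𝓝 θ, ∀ c s, ∀ᶠ y in 𝓝 (x c : Fin n → ℝ),
      y ∈ C θ' s → (x c : Fin n → ℝ) ∈ C θ s := by
    rw [eventually_all]; intro c; rw [eventually_all]; exact hev c
  filter_upwards [hev2] with θ' hθ' hinj
  have hy : ∀ c, ∃ y, (∀ s, y ∈ C θ' s → (x c : Fin n → ℝ) ∈ C θ s) ∧
      ∀ s, y ∈ C θ' s → y ∈ interior (C θ' s) := by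
    intro c
    have h1 := eventually_all.2 (hθ' c)
    obtain ⟨u, hu, huo, hxu⟩ := mem_nhds_iff.1 h1
    obtain ⟨y, hy, hyG⟩ := (good_dense (C θ') (hCc θ')).inter_open_nonempty u huo ⟨_, hxu⟩
    exact ⟨y, hu hy, hyG⟩
  choose y hy1 hy2 using hy
  choose s hs using fun c => hcov θ' (y c)
  have := hfin θ'
  apply Nat.card_le_card_of_injective
    (fun c => ((⟨y c, hsub θ' _ (hy2 c _ (hs c))⟩ : ↥(nonlinearLocus (f θ'))ᶜ) :
      ConnectedComponents ↥(nonlinearLocus (f θ'))ᶜ))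
  intro c c' hcc
  have h1 : g θ' (s c) = g θ' (s c') := affine_same_of_mk_eq (f θ') hcc
    (interior_cell_subset (hg θ' _) _ (hy2 c _ (hs c)))
    (interior_cell_subset (hg θ' _) _ (hy2 c' _ (hs c')))
  have h2 := hinj h1
  rw [← hx c, ← hx c']
  refine mk_eq_of_preconn (S := interior (C θ (s c))) (hconv _ _).interior.isPreconnected
    (hsub _ _) (hxG _ _ (hy1 c _ (hs c))) ?_
  rw [h2]
  exact hxG _ _ (hy1 c' _ (hs c'))

end AbstractPart

section NetPart

variable {nn : ℕ → ℕ} {k : (l : ℕ) → Fin (nn (l + 1)) → ℕ}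

/-- the affine piece of the network with selection pattern `σ` -/
noncomputable def netPiece
    (θ : (l : ℕ) → (j : Fin (nn (l + 1))) → Fin (k l j) → ((Fin (nn l) → ℝ) × ℝ))
    (σ : (l : ℕ) → (j : Fin (nn (l + 1))) → Fin (k l j)) :
    (L : ℕ) → (Fin (nn 0) → ℝ) → (Fin (nn L) → ℝ)
  | 0 => id
  | L + 1 => fun x j =>
      (∑ i, (θ L j (σ L j)).1 i * netPiece θ σ L x i) + (θ L j (σ L j)).2

theorem netPiece_affine
    (θ : (l : ℕ) → (j : Fin (nn (l + 1))) → Fin (k l j) → ((Fin (nn l) → ℝ) × ℝ))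
    (σ : (l : ℕ) → (j : Fin (nn (l + 1))) → Fin (k l j)) (L : ℕ) :
    ∃ g : (Fin (nn 0) → ℝ) →ᵃ[ℝ] (Fin (nn L) → ℝ), ∀ x, netPiece θ σ L x = g x := by
  induction L with
  | zero => exact ⟨AffineMap.id ℝ _, fun x => rfl⟩
  | succ L ih =>
    obtain ⟨g, hg⟩ := ih
    let M : (Fin (nn L) → ℝ) →ₗ[ℝ] (Fin (nn (L + 1)) → ℝ) :=
      Matrix.mulVecLin (Matrix.of fun j i => (θ L j (σ L j)).1 i)
    refine ⟨(M.toAffineMap.comp g) + AffineMap.const ℝ _ (fun j => (θ L j (σ L j)).2), ?_⟩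
    intro x
    funext j
    simp [netPiece, hg, M, Matrix.mulVec, dotProduct]

/-- the closed cell of pattern `σ` -/
def netCell
    (θ : (l : ℕ) → (j : Fin (nn (l + 1))) → Fin (k l j) → ((Fin (nn l) → ℝ) × ℝ))
    (σ : (l : ℕ) → (j : Fin (nn (l + 1))) → Fin (k l j)) (L : ℕ) : Set (Fin (nn 0) → ℝ) :=
  {x | ∀ l < L, ∀ j r, (∑ i, (θ l j r).1 i * netPiece θ σ l x i) + (θ l j r).2 ≤
    (∑ i, (θ l j (σ l j)).1 i * netPiece θ σ l x i) + (θ l j (σ l j)).2}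

theorem netCell_convex
    (θ : (l : ℕ) → (j : Fin (nn (l + 1))) → Fin (k l j) → ((Fin (nn l) → ℝ) × ℝ))
    (σ : (l : ℕ) → (j : Fin (nn (l + 1))) → Fin (k l j)) (L : ℕ) :
    Convex ℝ (netCell θ σ L) := by
  intro x hx y hy a b ha hb hab l hl j r
  obtain ⟨g, hg⟩ := netPiece_affine θ σ l
  have h1 := hx l hl j r
  have h2 := hy l hl j r
  have hc : g (a • x + b • y) = a • g x + b • g y := Convex.combo_affine_apply hab
  simp only [hg, hc, Pi.add_apply, Pi.smul_apply, smul_eq_mul] at h1 h2 ⊢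
  have key : ∀ (w : Fin (nn l) → ℝ) (β : ℝ),
      (∑ i, w i * (a * g x i + b * g y i)) + β =
      a * ((∑ i, w i * g x i) + β) + b * ((∑ i, w i * g y i) + β) := by
    intro w β
    have : ∑ i, w i * (a * g x i + b * g y i) =
        a * (∑ i, w i * g x i) + b * (∑ i, w i * g y i) := by
      rw [Finset.mul_sum, Finset.mul_sum, ← Finset.sum_add_distrib]
      exact Finset.sum_congr rfl fun i _ => by ring
    rw [this]
    linear_combination (-β) * hab
  rw [key, key]
  gcongr

theorem netEval_eq_piece
    (θ : (l : ℕ) → (j : Fin (nn (l + 1))) → Fin (k l j) → ((Fin (nn l) → ℝ) × ℝ))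
    (σ : (l : ℕ) → (j : Fin (nn (l + 1))) → Fin (k l j)) (L : ℕ) (x : Fin (nn 0) → ℝ)
    (hx : x ∈ netCell θ σ L) : netEval nn k θ L x = netPiece θ σ L x := by
  induction L with
  | zero => rfl
  | succ L ih =>
    have h := ih (fun l hl => hx l (hl.trans (Nat.lt_succ_self L)))
    funext j
    simp only [netEval, Function.comp, maxoutLayer, netPiece, h]
    have : Nonempty (Fin (k L j)) := ⟨σ L j⟩
    apply le_antisymm
    · exact ciSup_le fun r => hx L (Nat.lt_succ_self L) j r
    · exact le_ciSup (f := fun r => (∑ i, (θ L j r).1 i * netPiece θ σ L x i) + (θ L j r).2)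
        (Set.finite_range _).bddAbove (σ L j)

theorem netCell_cover
    (hk : ∀ l j, 1 ≤ k l j)
    (θ : (l : ℕ) → (j : Fin (nn (l + 1))) → Fin (k l j) → ((Fin (nn l) → ℝ) × ℝ))
    (x : Fin (nn 0) → ℝ) : ∃ σ, ∀ L, x ∈ netCell θ σ L := by
  have : ∀ l j, ∃ r : Fin (k l j), ∀ r' : Fin (k l j),
      (∑ i, (θ l j r').1 i * netEval nn k θ l x i) + (θ l j r').2 ≤
      (∑ i, (θ l j r).1 i * netEval nn k θ l x i) + (θ l j r).2 := by
    intro l j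
    have : Nonempty (Fin (k l j)) := ⟨⟨0, hk l j⟩⟩
    exact Finite.exists_max (fun r => (∑ i, (θ l j r).1 i * netEval nn k θ l x i) + (θ l j r).2)
  choose σ hσ using this
  refine ⟨σ, fun L => ?_⟩
  induction L with
  | zero => intro l hl; omega
  | succ L ih =>
    intro l hl j r
    rcases Nat.lt_succ_iff_lt_or_eq.1 hl with h | rfl
    · exact ih l h j r
    · rw [← netEval_eq_piece θ σ l x ih]
      exact hσ l j r

theorem netPiece_congr
    {θ θ' : (l : ℕ) → (j : Fin (nn (l + 1))) → Fin (k l j) → ((Fin (nn l) → ℝ) × ℝ)}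
    {σ σ' : (l : ℕ) → (j : Fin (nn (l + 1))) → Fin (k l j)} (L : ℕ)
    (hθ : ∀ l < L, θ l = θ' l) (hσ : ∀ l < L, σ l = σ' l) (x : Fin (nn 0) → ℝ) :
    netPiece θ σ L x = netPiece θ' σ' L x := by
  induction L with
  | zero => rfl
  | succ L ih =>
    have h := ih (fun l hl => hθ l (hl.trans (Nat.lt_succ_self L)))
      (fun l hl => hσ l (hl.trans (Nat.lt_succ_self L)))
    funext j
    simp only [netPiece, h, hθ L (Nat.lt_succ_self L), hσ L (Nat.lt_succ_self L)]

theorem netCell_congr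
    {θ : (l : ℕ) → (j : Fin (nn (l + 1))) → Fin (k l j) → ((Fin (nn l) → ℝ) × ℝ)}
    {σ σ' : (l : ℕ) → (j : Fin (nn (l + 1))) → Fin (k l j)} (L : ℕ)
    (hσ : ∀ l < L, σ l = σ' l) :
    netCell θ σ L = netCell θ σ' L := by
  ext x
  refine forall_congr' fun l => forall_congr' fun hl => forall_congr' fun j =>
    forall_congr' fun r => ?_
  rw [netPiece_congr l (fun _ _ => rfl) (fun l' hl' => hσ l' (hl'.trans hl)) x, hσ l hl]

/-- finite patterns -/
abbrev Pat (L : ℕ) (nn : ℕ → ℕ) (k : (l : ℕ) → Fin (nn (l + 1)) → ℕ) : Type :=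
  (l : Fin L) → (j : Fin (nn ((l : ℕ) + 1))) → Fin (k (l : ℕ) j)

def extPat {L : ℕ} (hk : ∀ l j, 1 ≤ k l j) (σ : Pat L nn k) :
    (l : ℕ) → (j : Fin (nn (l + 1))) → Fin (k l j) :=
  fun l j => if h : l < L then σ ⟨l, h⟩ j else ⟨0, hk l j⟩

noncomputable instance instNSP (L : ℕ) : NormedSpace ℝ (ParamSpace L nn k) :=
  inferInstanceAs (NormedSpace ℝ ((l : Fin L) → (j : Fin (nn ((l : ℕ) + 1))) →
    Fin (k (l : ℕ) j) → ((Fin (nn (l : ℕ)) → ℝ) × ℝ)))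

instance instFDP (L : ℕ) : FiniteDimensional ℝ (ParamSpace L nn k) :=
  inferInstanceAs (FiniteDimensional ℝ ((l : Fin L) → (j : Fin (nn ((l : ℕ) + 1))) →
    Fin (k (l : ℕ) j) → ((Fin (nn (l : ℕ)) → ℝ) × ℝ)))

instance instBorelP (L : ℕ) : BorelSpace (ParamSpace L nn k) :=
  inferInstanceAs (BorelSpace ((l : Fin L) → (j : Fin (nn ((l : ℕ) + 1))) →
    Fin (k (l : ℕ) j) → ((Fin (nn (l : ℕ)) → ℝ) × ℝ)))

instance instHaarProd (n : ℕ) :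
    (MeasureTheory.volume : MeasureTheory.Measure ((Fin n → ℝ) × ℝ)).IsAddHaarMeasure := by
  rw [MeasureTheory.Measure.volume_eq_prod]
  infer_instance

theorem isHaar_pi_aux {ι : Type*} [Fintype ι] {X : ι → Type*}
    [∀ i, MeasureTheory.MeasureSpace (X i)] [∀ i, AddGroup (X i)] [∀ i, TopologicalSpace (X i)]
    [∀ i, MeasureTheory.SigmaFinite (MeasureTheory.volume : MeasureTheory.Measure (X i))]
    [∀ i, MeasurableAdd (X i)]
    [∀ i, (MeasureTheory.volume : MeasureTheory.Measure (X i)).IsAddHaarMeasure] :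
    (MeasureTheory.volume : MeasureTheory.Measure (∀ i, X i)).IsAddHaarMeasure := by
  rw [MeasureTheory.volume_pi]
  infer_instance

instance instHaarP (L : ℕ) :
    (MeasureTheory.volume : MeasureTheory.Measure (ParamSpace L nn k)).IsAddHaarMeasure := by
  have h1 : ∀ (l : Fin L) (j : Fin (nn ((l : ℕ) + 1))), (MeasureTheory.volume :
      MeasureTheory.Measure (Fin (k (l : ℕ) j) →
        ((Fin (nn (l : ℕ)) → ℝ) × ℝ))).IsAddHaarMeasure := fun l j => isHaar_pi_aux
  have h2 : ∀ (l : Fin L), (MeasureTheory.volume :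
      MeasureTheory.Measure ((j : Fin (nn ((l : ℕ) + 1))) → Fin (k (l : ℕ) j) →
        ((Fin (nn (l : ℕ)) → ℝ) × ℝ))).IsAddHaarMeasure := fun l => isHaar_pi_aux
  have h3 : (MeasureTheory.volume :
      MeasureTheory.Measure ((l : Fin L) → (j : Fin (nn ((l : ℕ) + 1))) → Fin (k (l : ℕ) j) →
        ((Fin (nn (l : ℕ)) → ℝ) × ℝ))).IsAddHaarMeasure := isHaar_pi_aux
  exact h3

theorem continuous_extendParams {L : ℕ} (l : ℕ) (j : Fin (nn (l + 1))) (r : Fin (k l j)) :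
    Continuous fun θ : ParamSpace L nn k => extendParams θ l j r := by
  unfold extendParams
  by_cases h : l < L
  · simp only [h, dite_true]
    have h0 : Continuous fun θ : ((l : Fin L) → (j : Fin (nn ((l : ℕ) + 1))) →
      Fin (k (l : ℕ) j) → ((Fin (nn (l : ℕ)) → ℝ) × ℝ)) => θ ⟨l, h⟩ j r := by fun_prop
    exact h0
  · simp only [h, dite_false]
    exact continuous_const

theorem continuous_netPiece {L : ℕ} (σ : (l : ℕ) → (j : Fin (nn (l + 1))) → Fin (k l j)) (l : ℕ) :
    Continuous fun p : ParamSpace L nn k × (Fin (nn 0) → ℝ) =>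
      netPiece (extendParams p.1) σ l p.2 := by
  induction l with
  | zero => exact continuous_snd
  | succ l ih =>
    refine continuous_pi fun j => ?_
    have h := (continuous_extendParams (L := L) l j (σ l j)).comp
      (continuous_fst (Y := (Fin (nn 0) → ℝ)))
    simp only [netPiece]
    refine (continuous_finsetSum _ fun i _ => ?_).add (continuous_snd.comp h)
    exact ((continuous_apply i).comp (continuous_fst.comp h)).mul ((continuous_apply i).comp ih)

theorem isClosed_netCell {L : ℕ} (σ : (l : ℕ) → (j : Fin (nn (l + 1))) → Fin (k l j)) :
    IsClosed {p : ParamSpace L nn k × (Fin (nn 0) → ℝ) |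
      p.2 ∈ netCell (extendParams p.1) σ L} := by
  have hpre : ∀ l j r, Continuous fun p : ParamSpace L nn k × (Fin (nn 0) → ℝ) =>
      (∑ i, (extendParams p.1 l j r).1 i * netPiece (extendParams p.1) σ l p.2 i) +
        (extendParams p.1 l j r).2 := by
    intro l j r
    have h := (continuous_extendParams (L := L) l j r).comp
      (continuous_fst (Y := (Fin (nn 0) → ℝ)))
    refine (continuous_finsetSum _ fun i _ => ?_).add (continuous_snd.comp h)
    exact ((continuous_apply i).comp (continuous_fst.comp h)).mul
      ((continuous_apply i).comp (continuous_netPiece σ l))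
  have : {p : ParamSpace L nn k × (Fin (nn 0) → ℝ) | p.2 ∈ netCell (extendParams p.1) σ L} =
      ⋂ l, ⋂ (_ : l < L), ⋂ j, ⋂ r, {p |
      (∑ i, (extendParams p.1 l j r).1 i * netPiece (extendParams p.1) σ l p.2 i) +
        (extendParams p.1 l j r).2 ≤
      (∑ i, (extendParams p.1 l j (σ l j)).1 i * netPiece (extendParams p.1) σ l p.2 i) +
        (extendParams p.1 l j (σ l j)).2} := by
    ext p
    simp only [Set.mem_iInter]
    rfl
  rw [this]
  exact isClosed_iInter fun l => isClosed_iInter fun _ => isClosed_iInter fun j =>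
    isClosed_iInter fun r => isClosed_le (hpre l j r) (hpre l j (σ l j))

/-- the elementary direction -/
noncomputable def dirP {L : ℕ} (l : ℕ) (hl : l < L) (j : Fin (nn (l + 1))) (r : Fin (k l j))
    (v : (Fin (nn l) → ℝ) × ℝ) : ParamSpace L nn k :=
  fun l' => Pi.single (M := fun l' : Fin L => (j : Fin (nn ((l' : ℕ) + 1))) →
    Fin (k (l' : ℕ) j) → ((Fin (nn (l' : ℕ)) → ℝ) × ℝ)) ⟨l, hl⟩ (Pi.single j (Pi.single r v)) l'

theorem ext_dir_ne {L : ℕ} (l : ℕ) (hl : l < L) (j : Fin (nn (l + 1))) (r : Fin (k l j))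
    (v : (Fin (nn l) → ℝ) × ℝ) (θ : ParamSpace L nn k) (t : ℝ) (l' : ℕ) (h : l' ≠ l) :
    extendParams (θ + t • dirP l hl j r v) l' = extendParams θ l' := by
  funext j' r'
  unfold extendParams
  by_cases hl' : l' < L
  · simp only [hl', dite_true]
    change θ ⟨l', hl'⟩ j' r' + t • (dirP l hl j r v) ⟨l', hl'⟩ j' r' = _
    have : dirP l hl j r v ⟨l', hl'⟩ = 0 := by
      unfold dirP
      apply Pi.single_eq_of_ne
      simpa using h
    rw [this]
    simp
  · simp [hl']

theorem ext_dir_same {L : ℕ} (l : ℕ) (hl : l < L) (j : Fin (nn (l + 1))) (r : Fin (k l j))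
    (v : (Fin (nn l) → ℝ) × ℝ) (θ : ParamSpace L nn k) (t : ℝ) :
    extendParams (θ + t • dirP l hl j r v) l j r = extendParams θ l j r + t • v := by
  unfold extendParams
  simp only [hl, dite_true]
  change θ ⟨l, hl⟩ j r + t • (dirP l hl j r v) ⟨l, hl⟩ j r = _
  simp [dirP]

theorem ext_dir_ne_r {L : ℕ} (l : ℕ) (hl : l < L) (j : Fin (nn (l + 1))) (r r' : Fin (k l j))
    (v : (Fin (nn l) → ℝ) × ℝ) (θ : ParamSpace L nn k) (t : ℝ) (h : r' ≠ r) :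
    extendParams (θ + t • dirP l hl j r v) l j r' = extendParams θ l j r' := by
  unfold extendParams
  simp only [hl, dite_true]
  change θ ⟨l, hl⟩ j r' + t • (dirP l hl j r v) ⟨l, hl⟩ j r' = _
  simp [dirP, h]

theorem null_of_dir {L : ℕ} (A : Set (ParamSpace L nn k)) (hA : MeasurableSet A)
    (v : ParamSpace L nn k)
    (h : ∀ θ, {t : ℝ | θ + t • v ∈ A}.Subsingleton) : MeasureTheory.volume A = 0 := by
  have := MeasureTheory.ae_mem_of_ae_add_linearMap_mem
    (LinearMap.toSpanSingleton ℝ (ParamSpace L nn k) v)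
    (MeasureTheory.volume : MeasureTheory.Measure ℝ)
    (MeasureTheory.volume : MeasureTheory.Measure (ParamSpace L nn k)) hA.compl ?_
  · rw [MeasureTheory.ae_iff] at this
    simpa using this
  · intro θ
    rw [MeasureTheory.ae_iff]
    have h2 := (h θ).measure_zero (MeasureTheory.volume : MeasureTheory.Measure ℝ)
    simpa using h2

theorem piece_null {L : ℕ} (hpos : ∀ l < L, 0 < nn (l + 1))
    (σ τ : (l : ℕ) → (j : Fin (nn (l + 1))) → Fin (k l j)) (l : ℕ) (hl : l ≤ L)
    (hne : ∃ l' < l, σ l' ≠ τ l') :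
    MeasureTheory.volume {θ : ParamSpace L nn k |
      netPiece (extendParams θ) σ l 0 = netPiece (extendParams θ) τ l 0} = 0 := by
  have hcont : ∀ (σ : (l : ℕ) → (j : Fin (nn (l + 1))) → Fin (k l j)) (l : ℕ),
      Continuous fun θ : ParamSpace L nn k => netPiece (extendParams θ) σ l 0 := fun σ l =>
    (continuous_netPiece σ l).comp (continuous_id.prodMk continuous_const)
  induction l with
  | zero => obtain ⟨l', h, _⟩ := hne; omega
  | succ l ih =>
    have hlL : l < L := hl
    have hinv : ∀ (j : Fin (nn (l + 1))) (r : Fin (k l j)) (v : (Fin (nn l) → ℝ) × ℝ)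
        (θ : ParamSpace L nn k) (t : ℝ) (ρ : (l : ℕ) → (j : Fin (nn (l + 1))) → Fin (k l j)),
        netPiece (extendParams (θ + t • dirP l hlL j r v)) ρ l 0 =
        netPiece (extendParams θ) ρ l 0 := by
      intro j r v θ t ρ
      exact netPiece_congr l (fun l' hl' => ext_dir_ne l hlL j r v θ t l' hl'.ne)
        (fun _ _ => rfl) 0
    by_cases hs : σ l = τ l
    · have hne' : ∃ l' < l, σ l' ≠ τ l' := by
        obtain ⟨l', h, h'⟩ := hne
        rcases Nat.lt_succ_iff_lt_or_eq.1 h with h2 | rfl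
        · exact ⟨l', h2, h'⟩
        · exact absurd hs h'
      have h0 := ih hlL.le hne'
      let j : Fin (nn (l + 1)) := ⟨0, hpos l hlL⟩
      let B : Fin (nn l) → Set (ParamSpace L nn k) := fun i =>
        {θ | netPiece (extendParams θ) σ l 0 i = netPiece (extendParams θ) τ l 0 i}ᶜ ∩
        {θ | netPiece (extendParams θ) σ (l + 1) 0 j = netPiece (extendParams θ) τ (l + 1) 0 j}
      have hB : ∀ i, MeasureTheory.volume (B i) = 0 := by
        intro i
        apply null_of_dir (B i) _ (dirP l hlL j (σ l j) (Pi.single i 1, 0))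
        · rintro θ t ⟨ht1, ht2⟩ t' ⟨ht1', ht2'⟩
          simp only [Set.mem_compl_iff, Set.mem_ofPred_eq, hinv] at ht1
          simp only [Set.mem_ofPred_eq, netPiece, hinv, ← hs, ext_dir_same] at ht2 ht2'
          simp only [Prod.smul_mk, Prod.fst_add, Prod.snd_add, Pi.add_apply, Pi.smul_apply,
            smul_eq_mul, mul_zero, add_zero, add_mul, Finset.sum_add_distrib, Pi.single_apply,
            mul_ite, ite_mul, mul_one, zero_mul, Finset.sum_ite_eq', Finset.mem_univ, if_true]
            at ht2 ht2'
          have : (t - t') * (netPiece (extendParams θ) σ l 0 i -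
              netPiece (extendParams θ) τ l 0 i) = 0 := by linear_combination ht2 - ht2'
          rcases mul_eq_zero.1 this with h | h
          · linarith
          · exact absurd (sub_eq_zero.1 h) ht1
        · refine MeasurableSet.inter (MeasurableSet.compl ?_) ?_
          · exact (isClosed_eq ((continuous_apply i).comp (hcont σ l))
              ((continuous_apply i).comp (hcont τ l))).measurableSet
          · exact (isClosed_eq ((continuous_apply j).comp (hcont σ (l + 1)))
              ((continuous_apply j).comp (hcont τ (l + 1)))).measurableSet
      refine MeasureTheory.measure_mono_null ?_
        (MeasureTheory.measure_union_null h0 (MeasureTheory.measure_iUnion_null hB))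
      intro θ hθ
      by_cases h : netPiece (extendParams θ) σ l 0 = netPiece (extendParams θ) τ l 0
      · exact Or.inl h
      · right
        obtain ⟨i, hi⟩ := Function.ne_iff.1 h
        exact Set.mem_iUnion.2 ⟨i, hi, congrFun hθ j⟩
    · obtain ⟨j, hj⟩ := Function.ne_iff.1 hs
      apply null_of_dir _ (isClosed_eq (hcont σ (l + 1)) (hcont τ (l + 1))).measurableSet
        (dirP l hlL j (σ l j) (0, 1))
      intro θ t ht t' ht'
      have h1 := congrFun ht j
      have h2 := congrFun ht' j
      simp only [netPiece, hinv, ext_dir_same, ext_dir_ne_r l hlL j _ _ _ _ _ (Ne.symm hj)]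
        at h1 h2
      simp only [Prod.smul_mk, Prod.fst_add, Prod.snd_add, smul_zero, add_zero, smul_eq_mul,
        mul_one] at h1 h2
      linarith

theorem netEval_const_of_zero
    (θ : (l : ℕ) → (j : Fin (nn (l + 1))) → Fin (k l j) → ((Fin (nn l) → ℝ) × ℝ))
    (l : ℕ) (h0 : nn l = 0) (L : ℕ) (hl : l ≤ L) (x y : Fin (nn 0) → ℝ) :
    netEval nn k θ L x = netEval nn k θ L y := by
  induction L, hl using Nat.le_induction with
  | base => funext i; exact absurd i.2 (by omega)
  | succ L _ ih => simp only [netEval, Function.comp, ih]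

theorem nll_empty_of_const {n m : ℕ} (f : (Fin n → ℝ) → (Fin m → ℝ)) (h : ∀ x y, f x = f y) :
    nonlinearLocus f = ∅ := by
  ext x
  simp only [nonlinearLocus, Set.mem_ofPred_eq, Set.mem_empty_iff_false, iff_false, not_not]
  exact ⟨AffineMap.const ℝ _ (f x), Filter.Eventually.of_forall fun y => h y x⟩

end NetPart

theorem generic_perturbation_does_not_decrease_regions
    (L : ℕ) (nn : ℕ → ℕ) (k : (l : ℕ) → Fin (nn (l + 1)) → ℕ) (hk : ∀ l j, 1 ≤ k l j)
    (θ : ParamSpace L nn k) :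
    ∃ ε > (0 : ℝ), ∃ Z : Set (ParamSpace L nn k), MeasureTheory.volume Z = 0 ∧
      ∀ θ' : ParamSpace L nn k, ‖θ' - θ‖ < ε → θ' ∉ Z →
        numRegions (netEval nn k (extendParams θ) L) ≤
          numRegions (netEval nn k (extendParams θ') L) := by
  by_cases hpos : ∀ l < L, 0 < nn (l + 1)
  · choose g hg using fun (θ : ParamSpace L nn k) (σ : Pat L nn k) =>
      netPiece_affine (extendParams θ) (extPat hk σ) L
    have hmain := abstract_main (ι := Pat L nn k) (Θ := ParamSpace L nn k)
      (fun θ => netEval nn k (extendParams θ) L)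
      (fun θ σ => netCell (extendParams θ) (extPat hk σ) L)
      (fun σ => isClosed_netCell (extPat hk σ))
      (fun θ σ => netCell_convex _ _ _)
      (by
        intro θ x
        obtain ⟨σ, hσ⟩ := netCell_cover hk (extendParams θ) x
        refine ⟨fun l j => σ l j, ?_⟩
        rw [netCell_congr (σ' := σ) L]
        · exact hσ L
        · intro l hl
          funext j
          simp [extPat, hl])
      g
      (by
        intro θ σ x hx
        rw [← hg]
        exact netEval_eq_piece _ _ _ _ hx) θ
    obtain ⟨ε, hε, hball⟩ := Metric.eventually_nhds_iff.1 hmain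
    refine ⟨ε, hε, ⋃ p : {p : Pat L nn k × Pat L nn k // p.1 ≠ p.2},
      {θ | netPiece (extendParams θ) (extPat hk p.1.1) L 0 =
        netPiece (extendParams θ) (extPat hk p.1.2) L 0}, ?_, ?_⟩
    · apply MeasureTheory.measure_iUnion_null
      rintro ⟨⟨σ, τ⟩, hp⟩
      apply piece_null hpos _ _ L le_rfl
      obtain ⟨l, hl⟩ := Function.ne_iff.1 hp
      refine ⟨l, l.2, fun h => hl ?_⟩
      funext j
      have := congrFun h j
      simpa [extPat] using this
    · intro θ' hθ' hZ
      refine hball (by rwa [dist_eq_norm]) ?_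
      intro σ τ h
      by_contra hne
      apply hZ
      refine Set.mem_iUnion.2 ⟨⟨(σ, τ), hne⟩, ?_⟩
      change netPiece _ _ _ _ = netPiece _ _ _ _
      rw [hg, hg, h]
  · push Not at hpos
    obtain ⟨l, hl, h0⟩ := hpos
    have key : ∀ θ : ParamSpace L nn k,
        nonlinearLocus (netEval nn k (extendParams θ) L) = ∅ := fun θ =>
      nll_empty_of_const _ (netEval_const_of_zero _ (l + 1) (by omega) L hl)
    refine ⟨1, one_pos, ∅, by simp, fun θ' _ _ => ?_⟩
    unfold numRegions
    rw [key θ, key θ']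
end

section
/- Let f : ℝ^n → ℝ^m be the function represented by a layer of m maxout units of ranks k_1,…,k_m, where the j-th unit has preactivation features x ↦ ⟨w_{j,r}, x⟩ + b_{j,r} for r ∈ [k_j]. Then the number of linear regions of f equals the number of upper vertices of the Minkowski sum ∑_{j=1}^{m} conv{(w_{j,r}, b_{j,r}) : r ∈ [k_j]} ⊆ ℝ^{n+1}. If the layer is without biases (all b_{j,r} = 0), then the number of linear regions of f equals the number of vertices of the Minkowski sum ∑_{j=1}^{m} conv{w_{j,r} : r ∈ [k_j]} ⊆ ℝ^n. -/
open Filter Topology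

open scoped Pointwise

/-- `p` is an upper vertex of `P ⊆ ℝ^{n+1}`: its normal cone meets the open upper halfspace. -/
def IsUpperVertex {n : ℕ} (p : Fin (n + 1) → ℝ) (P : Set (Fin (n + 1) → ℝ)) : Prop :=
  p ∈ P ∧ ∃ r : Fin (n + 1) → ℝ, 0 < r (Fin.last n) ∧
    ∀ q ∈ P, q ≠ p → 0 < ∑ i, r i * (p i - q i)

/-- `p` is a vertex (`0`-dimensional face) of `P`: an exposed singleton. -/
def IsVertexOf {E : Type*} [AddCommGroup E] [Module ℝ E] (p : E) (P : Set E) : Prop :=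
  ∃ φ : E →ₗ[ℝ] ℝ, {x ∈ P | ∀ y ∈ P, φ y ≤ φ x} = {p}

theorem hull_iff {E S : Type*} [AddCommGroup E] [Module ℝ E] (v : S → E) (φ : E →ₗ[ℝ] ℝ) (p : E) :
    (p ∈ convexHull ℝ (Set.range v) ∧ ∀ q ∈ convexHull ℝ (Set.range v), q ≠ p → φ q < φ p) ↔
    (p ∈ Set.range v ∧ ∀ s, v s ≠ p → φ (v s) < φ p) := by
  constructor
  · rintro ⟨hp, h⟩
    refine ⟨?_, fun s hs => h _ (subset_convexHull ℝ _ ⟨s, rfl⟩) hs⟩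
    by_contra hn
    have hsub : Set.range v ⊆ {q | φ q < φ p} := by
      rintro _ ⟨s, rfl⟩
      exact h _ (subset_convexHull ℝ _ ⟨s, rfl⟩) (fun e => hn ⟨s, e⟩)
    have := convexHull_min hsub (convex_halfSpace_lt φ.isLinear _) hp
    exact lt_irrefl (φ p) (by simpa using this)
  · rintro ⟨hp, h⟩
    refine ⟨subset_convexHull ℝ _ hp, ?_⟩
    have hsub : Set.range v ⊆ {q | q ≠ p → φ q < φ p} := by
      rintro _ ⟨s, rfl⟩
      exact h s
    have hconv : Convex ℝ {q | q ≠ p → φ q < φ p} := by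
      rw [convex_iff_forall_pos]
      intro x hx y hy a b ha hb hab hne
      by_cases h1 : x = p
      · by_cases h2 : y = p
        · exact absurd (by rw [h1, h2, ← add_smul, hab, one_smul]) hne
        · have := hy h2
          simp only [map_add, map_smul, smul_eq_mul, h1]
          have e : φ p = a * φ p + b * φ p := by rw [← add_mul, hab, one_mul]
          nlinarith [mul_lt_mul_of_pos_left this hb]
      · have := hx h1
        have h3 : φ y ≤ φ p := by
          by_cases h2 : y = p
          · rw [h2]
          · exact (hy h2).le
        simp only [map_add, map_smul, smul_eq_mul]
        have e : φ p = a * φ p + b * φ p := by rw [← add_mul, hab, one_mul]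
        nlinarith [mul_lt_mul_of_pos_left this ha, mul_le_mul_of_nonneg_left h3 hb.le]
    exact fun q hq => convexHull_min hsub hconv hq

theorem vertex_iff {E S : Type*} [AddCommGroup E] [Module ℝ E] (v : S → E) (p : E) :
    IsVertexOf p (convexHull ℝ (Set.range v)) ↔
    ∃ φ : E →ₗ[ℝ] ℝ, (p ∈ Set.range v ∧ ∀ s, v s ≠ p → φ (v s) < φ p) := by
  unfold IsVertexOf
  refine exists_congr fun φ => ?_
  rw [← hull_iff]
  constructor
  · intro h
    have hp : p ∈ {x ∈ convexHull ℝ (Set.range v) | ∀ y ∈ convexHull ℝ (Set.range v), φ y ≤ φ x} := by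
      rw [h]; rfl
    refine ⟨hp.1, fun q hq hne => lt_of_le_of_ne (hp.2 q hq) fun e => hne ?_⟩
    have : q ∈ {x ∈ convexHull ℝ (Set.range v) | ∀ y ∈ convexHull ℝ (Set.range v), φ y ≤ φ x} :=
      ⟨hq, fun y hy => e ▸ hp.2 y hy⟩
    rw [h] at this
    exact this
  · rintro ⟨hp, h⟩
    ext x
    simp only [Set.mem_ofPred_eq, Set.mem_singleton_iff]
    constructor
    · rintro ⟨hx, hm⟩
      by_contra hne
      exact absurd (h x hx hne) (not_lt.2 (hm p hp))
    · rintro rfl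
      refine ⟨hp, fun y hy => ?_⟩
      by_cases e : y = x
      · rw [e]
      · exact (h y hy e).le

/-- evaluation of the affine function with coefficients `p` at `x`, linear in `p`. -/
noncomputable def evL {n : ℕ} (x : Fin n → ℝ) : (Fin (n + 1) → ℝ) →ₗ[ℝ] ℝ where
  toFun p := (∑ i : Fin n, p i.castSucc * x i) + p (Fin.last n)
  map_add' p q := by simp [add_mul, Finset.sum_add_distrib]; ring
  map_smul' c p := by simp [mul_add, Finset.mul_sum, mul_assoc]

theorem evL_apply {n : ℕ} (x : Fin n → ℝ) (p : Fin (n + 1) → ℝ) :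
    evL x p = (∑ i : Fin n, p i.castSucc * x i) + p (Fin.last n) := rfl

/-- the affine function with coefficients `p`. -/
noncomputable def affP {n : ℕ} (p : Fin (n + 1) → ℝ) : (Fin n → ℝ) →ᵃ[ℝ] ℝ :=
  (∑ i : Fin n, p i.castSucc • (LinearMap.proj i : (Fin n → ℝ) →ₗ[ℝ] ℝ)).toAffineMap +
    AffineMap.const ℝ _ (p (Fin.last n))

theorem affP_apply {n : ℕ} (x : Fin n → ℝ) (p : Fin (n + 1) → ℝ) : affP p x = evL x p := by
  simp [affP, evL_apply]

theorem evL_cont {n : ℕ} (p : Fin (n + 1) → ℝ) : Continuous fun x : Fin n → ℝ => evL x p := by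
  simp only [evL_apply]; fun_prop

theorem evL_ext {n : ℕ} {p q : Fin (n + 1) → ℝ} (h : ∀ x : Fin n → ℝ, evL x p = evL x q) : p = q := by
  have h0 : p (Fin.last n) = q (Fin.last n) := by simpa [evL_apply] using h 0
  funext i
  refine Fin.lastCases h0 (fun i => ?_) i
  simpa [evL_apply, h0, Pi.single_apply] using h (Pi.single i 1)

theorem upper_iff {n : ℕ} {S : Type*} (v : S → Fin (n + 1) → ℝ) (p : Fin (n + 1) → ℝ) :
    IsUpperVertex p (convexHull ℝ (Set.range v)) ↔
    p ∈ Set.range v ∧ ∃ x : Fin n → ℝ, ∀ s, v s ≠ p → evL x (v s) < evL x p := by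
  have key : IsUpperVertex p (convexHull ℝ (Set.range v)) ↔ 
      ∃ x : Fin n → ℝ, (p ∈ convexHull ℝ (Set.range v) ∧
        ∀ q ∈ convexHull ℝ (Set.range v), q ≠ p → evL x q < evL x p) := by
    unfold IsUpperVertex
    constructor
    · rintro ⟨hp, r, hr, h⟩
      refine ⟨fun i => r i.castSucc / r (Fin.last n), hp, fun q hq hne => ?_⟩
      have h1 := h q hq hne
      rw [Fin.sum_univ_castSucc] at h1
      rw [← sub_pos, ← map_sub, evL_apply]
      have : (∑ i : Fin n, (p - q) i.castSucc * (r i.castSucc / r (Fin.last n))) + (p - q) (Fin.last n)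
        = (∑ i : Fin n, r i.castSucc * (p i.castSucc - q i.castSucc) +
          r (Fin.last n) * (p (Fin.last n) - q (Fin.last n))) / r (Fin.last n) := by
        rw [add_div, Finset.sum_div]
        congr 1
        · refine Finset.sum_congr rfl fun i _ => ?_
          simp only [Pi.sub_apply]; ring
        · simp only [Pi.sub_apply]; field_simp
      rw [this]
      exact div_pos h1 hr
    · rintro ⟨x, hp, h⟩
      refine ⟨hp, Fin.snoc x 1, by simp, fun q hq hne => ?_⟩
      have h1 := h q hq hne
      rw [← sub_pos, ← map_sub, evL_apply] at h1
      rw [Fin.sum_univ_castSucc]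
      simpa [mul_comm] using h1
  rw [key]
  simp only [hull_iff]
  simp

theorem aff_touch {n : ℕ} {x : Fin n → ℝ} (h g : (Fin n → ℝ) →ᵃ[ℝ] ℝ) (hx : h x = g x)
    (hle : ∀ᶠ y in 𝓝 x, h y ≤ g y) (z : Fin n → ℝ) : h z = g z := by
  have key : ∀ (d : Fin n → ℝ), (h - g).linear d ≤ 0 := by
    intro d
    have ht : Tendsto (fun t : ℝ => x + t • d) (𝓝[>] 0) (𝓝 x) := by
      have : Continuous fun t : ℝ => x + t • d := by fun_prop
      have h2 := this.tendsto 0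
      simp only [zero_smul, add_zero] at h2
      exact h2.mono_left nhdsWithin_le_nhds
    obtain ⟨t, h1, h2⟩ := ((ht.eventually hle).and self_mem_nhdsWithin).exists
    have e : (h - g) (x + t • d) = t * (h - g).linear d := by
      have := (h - g).map_vadd x (t • d)
      simp only [vadd_eq_add, map_smul, smul_eq_mul] at this
      rw [add_comm, this]
      simp [hx]
    have e2 : (h - g) (x + t • d) ≤ 0 := by simpa using h1
    rw [e] at e2
    have h3 : (0:ℝ) < t := h2
    by_contra hc
    push Not at hc
    nlinarith [mul_pos h3 hc]
  have e : (h - g) z = (h - g).linear (z - x) + (h - g) x := by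
    have := (h - g).map_vadd x (z - x)
    simpa using this
  have e1 := key (z - x)
  have e2 := key (-(z - x))
  rw [map_neg] at e2
  have e3 : (h - g).linear (z - x) = 0 := by linarith
  rw [e3] at e
  have : h z - g z = 0 + (h x - g x) := by simpa using e
  linarith

theorem locus_iff {n m : ℕ} (k : Fin m → ℕ) (hk : ∀ j, 1 ≤ k j)
    (w : (j : Fin m) → Fin (k j) → Fin n → ℝ) (b : (j : Fin m) → Fin (k j) → ℝ) (x : Fin n → ℝ)
    (u : (j : Fin m) → Fin (k j) → Fin (n + 1) → ℝ) (hu : ∀ j r, u j r = Fin.snoc (w j r) (b j r))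
    (v : ((j : Fin m) → Fin (k j)) → Fin (n + 1) → ℝ) (hv : ∀ s, v s = ∑ j, u j (s j)) :
    x ∈ (nonlinearLocus (maxoutLayer k w b))ᶜ ↔
    ∃ p ∈ Set.range v, ∀ s, v s ≠ p → evL x (v s) < evL x p := by
  have hne : ∀ j, Nonempty (Fin (k j)) := fun j => ⟨⟨0, hk j⟩⟩
  have hf : ∀ y j, maxoutLayer k w b y j = ⨆ r, evL y (u j r) := by
    intro y j
    simp [maxoutLayer, hu, evL_apply]
  have hle : ∀ y j r, evL y (u j r) ≤ maxoutLayer k w b y j := by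
    intro y j r
    rw [hf]
    exact le_ciSup (f := fun r => evL y (u j r)) (Set.finite_range _).bddAbove r
  simp only [nonlinearLocus, Set.mem_compl_iff, Set.mem_ofPred_eq, not_not]
  constructor
  · rintro ⟨g, hg⟩
    have hex : ∀ j, ∃ r, evL x (u j r) = maxoutLayer k w b x j := by
      intro j
      rw [hf]
      exact exists_eq_ciSup_of_finite (f := fun r => evL x (u j r))
    choose s0 hs0 using hex
    let gj : Fin m → ((Fin n → ℝ) →ᵃ[ℝ] ℝ) := fun j =>
      (LinearMap.proj j : (Fin m → ℝ) →ₗ[ℝ] ℝ).toAffineMap.comp g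
    have hgj : ∀ j y, gj j y = g y j := fun j y => rfl
    have key : ∀ j r, evL x (u j r) = maxoutLayer k w b x j → ∀ y, evL y (u j r) = gj j y := by
      intro j r hr y
      rw [← affP_apply]
      refine aff_touch (x := x) _ _ ?_ ?_ y
      · rw [affP_apply, hr, hgj, ← hg.self_of_nhds]
      · filter_upwards [hg] with y hy
        rw [affP_apply, hgj, ← hy]
        exact hle _ _ _
    refine ⟨v s0, ⟨s0, rfl⟩, fun s hs => ?_⟩
    by_contra hc
    push Not at hc
    apply hs
    rw [hv, hv, map_sum, map_sum] at hc
    have hall : ∀ j ∈ Finset.univ, evL x (u j (s j)) = evL x (u j (s0 j)) := by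
      have hl : ∀ j ∈ Finset.univ, evL x (u j (s j)) ≤ evL x (u j (s0 j)) := fun j _ => by
        rw [hs0]; exact hle _ _ _
      exact (Finset.sum_eq_sum_iff_of_le hl).1 (le_antisymm (Finset.sum_le_sum hl) hc)
    rw [hv, hv]
    refine Finset.sum_congr rfl fun j hj => evL_ext fun y => ?_
    rw [key j _ (hs0 j), key j (s j) ((hall j hj).trans (hs0 j))]
  · rintro ⟨_, ⟨s0, rfl⟩, h⟩
    refine ⟨AffineMap.pi fun j => affP (u j (s0 j)), ?_⟩
    have hev : ∀ᶠ y in 𝓝 x, ∀ s, evL y (v s) ≤ evL y (v s0) := by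
      rw [eventually_all]
      intro s
      by_cases e : v s = v s0
      · rw [e]; simp
      · exact ((evL_cont _).continuousAt.eventually_lt (evL_cont _).continuousAt (h s e)).mono
          fun y hy => hy.le
    filter_upwards [hev] with y hy
    funext j
    rw [AffineMap.pi_apply, affP_apply]
    refine le_antisymm ?_ (hle _ _ _)
    rw [hf]
    refine ciSup_le fun r => ?_
    have := hy (Function.update s0 j r)
    rw [hv, hv, map_sum, map_sum, ← Finset.add_sum_erase _ _ (Finset.mem_univ j),
      ← Finset.add_sum_erase _ (fun j => evL y (u j (s0 j))) (Finset.mem_univ j)] at this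
    have e : ∑ i ∈ Finset.univ.erase j, evL y (u i (Function.update s0 j r i)) =
        ∑ i ∈ Finset.univ.erase j, evL y (u i (s0 i)) := by
      refine Finset.sum_congr rfl fun i hi => ?_
      rw [Function.update_of_ne (Finset.ne_of_mem_erase hi)]
    rw [e, Function.update_self] at this
    linarith

theorem card_comp {n : ℕ} {T : Type*} (C : Set (Fin n → ℝ)) (U : T → Set (Fin n → ℝ))
    (hne : ∀ t, (U t).Nonempty) (ho : ∀ t, IsOpen (U t)) (hc : ∀ t, Convex ℝ (U t))
    (hd : ∀ t t' x, x ∈ U t → x ∈ U t' → t = t') (hC : ∀ x, x ∈ C ↔ ∃ t, x ∈ U t) :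
    Nat.card (ConnectedComponents ↥C) = Nat.card T := by
  choose c hcU using hne
  let V : T → Set C := fun t => Subtype.val ⁻¹' U t
  have hVo : ∀ t, IsOpen (V t) := fun t => (ho t).preimage continuous_subtype_val
  have hVc : ∀ t, IsClopen (V t) := by
    intro t
    refine ⟨⟨?_⟩, hVo t⟩
    have : (V t)ᶜ = ⋃ t' ∈ {t' | t' ≠ t}, V t' := by
      ext x
      simp only [Set.mem_compl_iff, Set.mem_iUnion, Set.mem_ofPred_eq, exists_prop, V, Set.mem_preimage]
      constructor
      · intro h
        obtain ⟨t', ht'⟩ := (hC x).1 x.2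
        exact ⟨t', fun e => h (e ▸ ht'), ht'⟩
      · rintro ⟨t', h1, h2⟩ h3
        exact h1 (hd _ _ _ h2 h3)
    rw [this]
    exact isOpen_biUnion fun t' _ => hVo t'
  have hVp : ∀ t, IsPreconnected (V t) := by
    intro t
    rw [← Topology.IsInducing.subtypeVal.isPreconnected_image, Subtype.image_preimage_coe,
      Set.inter_eq_right.2 fun x hx => (hC x).2 ⟨t, hx⟩]
    exact (hc t).isPreconnected
  symm
  refine Nat.card_congr (Equiv.ofBijective
    (fun t => ((⟨c t, (hC _).2 ⟨t, hcU t⟩⟩ : C) : ConnectedComponents C)) ⟨?_, ?_⟩)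
  · intro t t' h
    have h1 := ConnectedComponents.coe_eq_coe'.1 h
    have h2 := (hVc t').connectedComponent_subset (x := ⟨c t', (hC _).2 ⟨t', hcU t'⟩⟩) (hcU t') h1
    exact hd _ _ _ (hcU t) h2
  · intro q
    obtain ⟨x, rfl⟩ := ConnectedComponents.surjective_coe q
    obtain ⟨t, ht⟩ := (hC x).1 x.2
    refine ⟨t, ConnectedComponents.coe_eq_coe'.2 ?_⟩
    exact (hVp t).subset_connectedComponent (x := x) ht (hcU t)

theorem sum_hull {E : Type*} [AddCommGroup E] [Module ℝ E] {m : ℕ} (k : Fin m → ℕ)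
    (u : (j : Fin m) → Fin (k j) → E) :
    ∑ j, convexHull ℝ (Set.range (u j)) =
      convexHull ℝ (Set.range fun s : (j : Fin m) → Fin (k j) => ∑ j, u j (s j)) := by
  rw [← convexHull_sum]
  congr 1
  ext x
  rw [Set.mem_fintype_sum]
  constructor
  · rintro ⟨g, hg, rfl⟩
    choose s hs using hg
    exact ⟨s, by simp [hs]⟩
  · rintro ⟨s, rfl⟩
    exact ⟨_, fun j => ⟨s j, rfl⟩, rfl⟩

theorem part1 {n m : ℕ} (k : Fin m → ℕ) (hk : ∀ j, 1 ≤ k j)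
    (w : (j : Fin m) → Fin (k j) → Fin n → ℝ) (b : (j : Fin m) → Fin (k j) → ℝ) :
    numRegions (maxoutLayer k w b) =
      Set.ncard {p : Fin (n + 1) → ℝ | p ∈ Set.range (fun s : (j : Fin m) → Fin (k j) =>
          ∑ j, (Fin.snoc (w j (s j)) (b j (s j)) : Fin (n + 1) → ℝ)) ∧ 
        ∃ x : Fin n → ℝ, ∀ s : (j : Fin m) → Fin (k j), 
          (∑ j, (Fin.snoc (w j (s j)) (b j (s j)) : Fin (n + 1) → ℝ)) ≠ p → 
          evL x (∑ j, (Fin.snoc (w j (s j)) (b j (s j)) : Fin (n + 1) → ℝ)) < evL x p} := by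
  set v : ((j : Fin m) → Fin (k j)) → Fin (n + 1) → ℝ := fun s => 
    ∑ j, (Fin.snoc (w j (s j)) (b j (s j)) : Fin (n + 1) → ℝ) with hv
  change _ = Set.ncard {p | p ∈ Set.range v ∧ ∃ x : Fin n → ℝ, ∀ s, v s ≠ p → evL x (v s) < evL x p}
  rw [← Nat.card_coe_set_eq]
  unfold numRegions
  refine card_comp _ (fun p => {x | ∀ s, v s ≠ p.1 → evL x (v s) < evL x p.1}) ?_ ?_ ?_ ?_ ?_
  · exact fun p => p.2.2
  · intro p
    simp only [Set.setOf_forall]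
    refine isOpen_iInter_of_finite fun s => isOpen_iInter_of_finite fun _ => 
      isOpen_lt (evL_cont _) (evL_cont _)
  · intro p
    simp only [Set.setOf_forall]
    refine convex_iInter fun s => convex_iInter fun _ => ?_
    have : {x : Fin n → ℝ | evL x (v s) < evL x p.1} = (affP (v s - p.1)) ⁻¹' Set.Iio 0 := by
      ext x
      simp [affP_apply, sub_neg]
    rw [this]
    exact (convex_Iio 0).affine_preimage _
  · rintro ⟨p, ⟨s, rfl⟩, hp⟩ ⟨_, ⟨t, rfl⟩, hq⟩ x h1 h2
    by_contra hne
    have hne' : v s ≠ v t := fun e => hne (Subtype.ext e)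
    exact lt_asymm (h1 t hne'.symm) (h2 s hne')
  · intro x
    rw [locus_iff k hk w b x _ (fun _ _ => rfl) v (fun _ => rfl)]
    constructor
    · rintro ⟨p, hp, h⟩
      exact ⟨⟨p, hp, x, h⟩, h⟩
    · rintro ⟨p, h⟩
      exact ⟨p.1, p.2.1, h⟩

theorem regions_eq_upper_vertices (n m : ℕ) (k : Fin m → ℕ) (hk : ∀ j, 1 ≤ k j)
    (w : (j : Fin m) → Fin (k j) → Fin n → ℝ) (b : (j : Fin m) → Fin (k j) → ℝ) :
    numRegions (maxoutLayer k w b) =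
      Set.ncard {p : Fin (n + 1) → ℝ | IsUpperVertex p
        (∑ j, convexHull ℝ (Set.range fun r : Fin (k j) => Fin.snoc (w j r) (b j r)))} ∧
    ((∀ j r, b j r = 0) →
      numRegions (maxoutLayer k w b) =
        Set.ncard {p : Fin n → ℝ | IsVertexOf p
          (∑ j, convexHull ℝ (Set.range (w j)))}) := by
  refine ⟨?_, fun hb => ?_⟩
  · rw [part1 k hk w b]
    congr 1
    ext p
    rw [Set.mem_ofPred_eq, Set.mem_ofPred_eq, sum_hull, upper_iff]
  · rw [part1 k hk w b]
    have hinj : Function.Injective fun p : Fin n → ℝ => (Fin.snoc p 0 : Fin (n + 1) → ℝ) := by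
      intro p q h
      funext i
      simpa using congrFun h i.castSucc
    rw [← Set.ncard_image_of_injective _ hinj]
    congr 1
    have hs : ∀ s : (j : Fin m) → Fin (k j),
        (∑ j, (Fin.snoc (w j (s j)) (b j (s j)) : Fin (n + 1) → ℝ)) = Fin.snoc (∑ j, w j (s j)) 0 := by
      intro s
      funext i
      refine Fin.lastCases ?_ (fun i => ?_) i
      · simp [hb]
      · simp
    have hev : ∀ (x p : Fin n → ℝ), evL x (Fin.snoc p 0 : Fin (n + 1) → ℝ) = ∑ i, p i * x i := by
      intro x p; simp [evL_apply]
    simp only [hs]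
    ext p
    simp only [Set.mem_ofPred_eq, Set.mem_image]
    constructor
    · rintro ⟨⟨s, rfl⟩, x, h⟩
      refine ⟨∑ j, w j (s j), ?_, rfl⟩
      rw [sum_hull, vertex_iff]
      refine ⟨∑ i, x i • (LinearMap.proj i : (Fin n → ℝ) →ₗ[ℝ] ℝ), ⟨s, rfl⟩, fun t ht => ?_⟩
      have := h t (fun e => ht (hinj e))
      rw [hev, hev] at this
      simpa only [LinearMap.sum_apply, LinearMap.smul_apply, LinearMap.proj_apply, smul_eq_mul,
        mul_comm] using this
    · rintro ⟨q, hq, rfl⟩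
      rw [sum_hull, vertex_iff] at hq
      obtain ⟨φ, ⟨s, rfl⟩, h⟩ := hq
      refine ⟨⟨s, rfl⟩, fun i => φ (Pi.single i 1), fun t ht => ?_⟩
      have hφ : ∀ p : Fin n → ℝ, φ p = ∑ i, p i * φ (Pi.single i 1) := by
        intro p
        conv_lhs => rw [pi_eq_sum_univ' p, map_sum]
        simp
      rw [hev, hev, ← hφ, ← hφ]
      exact h t (fun e => ht (by rw [e]))
end

section
/- Let m ≥ n + 1 and k_1,…,k_m ≥ n + 2. For any full-dimensional polytopes P_1,…,P_m ⊆ ℝ^{n+1} with f_0(P_i) = k_i for each i, the Minkowski sum P = P_1 + ⋯ + P_m satisfies f_0(P^+) ≤ ∑_{j=0}^{n} (−1)^{n−j} C(m−1−j, n−j) ∑_{S ⊆ [m], |S| = j} ∏_{i∈S} k_i. -/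
open scoped Pointwise RealInnerProductSpace

/-- A polytope is the convex hull of a finite set of points. -/
def IsPolytope {E : Type*} [AddCommGroup E] [Module ℝ E] (P : Set E) : Prop :=
  ∃ V : Finset E, P = convexHull ℝ (V : Set E)

/-- A face of `P` is the set of maximizers over `P` of a linear functional. -/
def IsFaceOf {E : Type*} [AddCommGroup E] [Module ℝ E] (F P : Set E) : Prop :=
  ∃ φ : E →ₗ[ℝ] ℝ, F = {x ∈ P | ∀ y ∈ P, φ y ≤ φ x}

/-- The spherical cell of directions maximized exactly on the face `F` of `P`. -/
def cellOf {n : ℕ} (F P : Set (EuclideanSpace ℝ (Fin (n + 1)))) :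
    Set (EuclideanSpace ℝ (Fin (n + 1))) :=
  {l | ‖l‖ = 1 ∧ ∀ x ∈ F, ∀ y ∈ P \ F, 0 < ⟪l, x - y⟫}

/-- `C` is a cell of the spherical complex `𝒢(P)` dual to `P`. -/
def IsCellOfComplex {n : ℕ} (C P : Set (EuclideanSpace ℝ (Fin (n + 1)))) : Prop :=
  ∃ F, IsFaceOf F P ∧ F.Nonempty ∧ C = cellOf F P

/-- Codimension (within the sphere `𝕊^n`) of a subset of `ℝ^{n+1}`. -/
noncomputable def sphCodim {n : ℕ} (C : Set (EuclideanSpace ℝ (Fin (n + 1)))) : ℕ :=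
  n + 1 - Module.finrank ℝ (Submodule.span ℝ C)

/-- A polytope is in general orientation if no great circle spanned by a one-dimensional
cell of its dual spherical complex contains a standard unit vector. -/
def GeneralOrientation {n : ℕ} (P : Set (EuclideanSpace ℝ (Fin (n + 1)))) : Prop :=
  ∀ C, IsCellOfComplex C P → Module.finrank ℝ (Submodule.span ℝ C) = 2 →
    ∀ i : Fin (n + 1), EuclideanSpace.single i (1 : ℝ) ∉ Submodule.span ℝ C

/-- A family of polytopes in general orientation. -/
def FamilyGeneralOrientation {n m : ℕ} (P : Fin m → Set (EuclideanSpace ℝ (Fin (n + 1)))) :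
    Prop :=
  (∀ i, GeneralOrientation (P i)) ∧
  ∀ (S : Finset (Fin m)) (C : Fin m → Set (EuclideanSpace ℝ (Fin (n + 1)))),
    (∀ i ∈ S, IsCellOfComplex (C i) (P i)) →
    (⋂ i ∈ S, C i) = ∅ ∨ min (∑ i ∈ S, sphCodim (C i)) n ≤ sphCodim (⋂ i ∈ S, C i)

/-- The number of `s`-dimensional upper faces of `P ⊆ ℝ^{n+1}`, i.e. faces whose dual
cell meets the open upper halfspace. -/
noncomputable def upperFaceCount {n : ℕ} (s : ℕ) (P : Set (EuclideanSpace ℝ (Fin (n + 1)))) :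
    ℕ :=
  Set.ncard {F : Set (EuclideanSpace ℝ (Fin (n + 1))) | IsFaceOf F P ∧ F.Nonempty ∧
    Module.finrank ℝ (affineSpan ℝ F).direction = s ∧
    ∃ l ∈ cellOf F P, 0 < ⟪l, EuclideanSpace.single (Fin.last n) (1 : ℝ)⟫}


/-- The number of `s`-dimensional faces of `P`. -/
noncomputable def faceCount {E : Type*} [AddCommGroup E] [Module ℝ E] (s : ℕ) (P : Set E) : ℕ :=
  Set.ncard {F : Set E | IsFaceOf F P ∧ F.Nonempty ∧
    Module.finrank ℝ (affineSpan ℝ F).direction = s}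

lemma uvb_select {E : Type*} [NormedAddCommGroup E] [InnerProductSpace ℝ E]
    [FiniteDimensional ℝ E] {m : ℕ} (K : Fin m → Set E) (hconv : ∀ i, Convex ℝ (K i))
    (hcl : ∀ i, IsClosed (K i)) (hne : (⋂ i, K i).Nonempty) :
    ∃ v ∈ ⋂ i, K i, ∃ S : Finset (Fin m), S.card ≤ Module.finrank ℝ E ∧
      ∀ w ∈ ⋂ i ∈ S, K i, w = v ∨ ‖v‖ < ‖w‖ := by
  classical
  obtain ⟨v, hv, hmin⟩ := (isClosed_iInter hcl).exists_infDist_eq_dist hne 0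
  have hle : ∀ w ∈ ⋂ i, K i, ‖v‖ ≤ ‖w‖ := by
    intro w hw
    have := Metric.infDist_le_dist_of_mem (x := (0 : E)) hw
    rw [hmin] at this
    simpa using this
  refine ⟨v, hv, ?_⟩
  let G : Option (Fin m) → Set E := fun o => o.elim (Metric.ball 0 ‖v‖) K
  have hS : ∃ I : Finset (Option (Fin m)), I.card ≤ Module.finrank ℝ E + 1 ∧
      ¬ (⋂ o ∈ I, G o).Nonempty := by
    by_contra! hcon
    have := Convex.helly_theorem' (𝕜 := ℝ) (F := G) (s := Finset.univ) ?_
      (fun I _ hI => hcon I hI)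
    · obtain ⟨w, hw⟩ := this
      simp only [Finset.mem_univ, Set.iInter_true, Set.mem_iInter] at hw
      have h1 := hle w (Set.mem_iInter.2 fun i => hw (some i))
      have h2 : w ∈ Metric.ball (0 : E) ‖v‖ := hw none
      simp at h2
      linarith
    · rintro (_ | i) _
      · exact convex_ball _ _
      · exact hconv i
  obtain ⟨I, hIc, hI⟩ := hS
  have hnone : none ∈ I := by
    by_contra hn
    apply hI
    refine ⟨v, ?_⟩
    simp only [Set.mem_iInter]
    rintro (_ | i) ho
    · exact absurd ho hn
    · exact Set.mem_iInter.1 hv i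
  refine ⟨I.eraseNone, ?_, ?_⟩
  · rw [Finset.card_eraseNone_of_mem hnone]
    omega
  · have key : ∀ w ∈ ⋂ i ∈ I.eraseNone, K i, ‖v‖ ≤ ‖w‖ := by
      intro w hw
      by_contra! hlt
      apply hI
      refine ⟨w, ?_⟩
      simp only [Set.mem_iInter] at hw ⊢
      rintro (_ | i) ho
      · simpa [G] using hlt
      · exact hw i (by simpa using ho)
    intro w hw
    by_contra! hcon
    obtain ⟨hwv, hwn⟩ := hcon
    have hvS : v ∈ ⋂ i ∈ I.eraseNone, K i := by
      simp only [Set.mem_iInter] at hv ⊢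
      exact fun i _ => hv i
    have hc : Convex ℝ (⋂ i ∈ I.eraseNone, K i) :=
      convex_iInter₂ fun i _ => hconv i
    have hmid := hc hvS hw (by norm_num : (0:ℝ) ≤ 1/2) (by norm_num : (0:ℝ) ≤ 1/2) (by norm_num)
    have h1 := key _ hmid
    have h2 := norm_combo_lt_of_ne (le_refl ‖v‖) hwn (Ne.symm hwv)
      (by norm_num : (0:ℝ) < 1/2) (by norm_num : (0:ℝ) < 1/2) (by norm_num)
    linarith

/-- monomials of low degree determine all coordinate-cylinder sums -/
lemma uvb_mono {m : ℕ} {ι : Fin m → Type*} [∀ i, Fintype (ι i)] [∀ i, DecidableEq (ι i)]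
    (z : ∀ i, ι i) (A : Finset (∀ i, ι i)) (μ : (∀ i, ι i) → ℝ) (n : ℕ)
    (h : ∀ d : ∀ i, ι i, (Finset.univ.filter fun i => d i ≠ z i).card ≤ n →
      ∑ c ∈ A, μ c * (if ∀ i, d i ≠ z i → c i = d i then 1 else 0) = 0)
    (S : Finset (Fin m)) (hS : S.card ≤ n) (p : ∀ i, ι i) :
    ∑ c ∈ A, μ c * (if ∀ i ∈ S, c i = p i then 1 else 0) = 0 := by
  classical
  -- induct on number of elements of `S` where `p = z`
  generalize hr : (S.filter fun i => p i = z i).card = r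
  induction r generalizing S p with
  | zero =>
    have hS' : ∀ i ∈ S, p i ≠ z i := by
      intro i hi hpz
      have := Finset.card_eq_zero.1 hr
      have h2 : i ∈ S.filter fun i => p i = z i := by simp [hi, hpz]
      rw [this] at h2
      simp at h2
    have hd := h (fun i => if i ∈ S then p i else z i) ?_
    · refine Eq.trans ?_ hd
      refine Finset.sum_congr rfl fun c _ => ?_
      congr 1
      refine if_congr ?_ rfl rfl
      constructor
      · intro hc i hi
        by_cases hiS : i ∈ S
        · simp [hiS, hc i hiS]
        · simp [hiS] at hi
      · intro hc i hi
        have := hc i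
        simp only [hi, if_true] at this
        exact this (hS' i hi)
    · refine le_trans (Finset.card_le_card ?_) hS
      intro i hi
      by_contra hiS
      simp [hiS] at hi
  | succ r ih =>
    obtain ⟨i, hi⟩ : (S.filter fun i => p i = z i).Nonempty := by
      rw [← Finset.card_pos]; omega
    rw [Finset.mem_filter] at hi
    obtain ⟨hiS, hiz⟩ := hi
    have hfil : ((S.erase i).filter fun j => p j = z j).card = r := by
      rw [Finset.filter_erase, Finset.card_erase_of_mem (by simp [hiS, hiz]), hr]; rfl
    have h0 := ih (S.erase i) ((Finset.card_erase_le).trans hS) p hfil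
    have hq : ∀ q, q ≠ z i → ∑ c ∈ A, μ c *
        (if ∀ j ∈ S, c j = Function.update p i q j then 1 else 0) = 0 := by
      intro q hqz
      refine ih S hS (Function.update p i q) ?_
      rw [← hfil]
      congr 1
      ext j
      by_cases hj : j = i
      · subst hj; simp [hqz]
      · simp [hj]
    have hsum : ∑ q ∈ Finset.univ.erase (z i), ∑ c ∈ A, μ c *
        (if ∀ j ∈ S, c j = Function.update p i q j then (1:ℝ) else 0) = 0 :=
      Finset.sum_eq_zero fun q hq' => hq q (Finset.ne_of_mem_erase hq')
    rw [Finset.sum_comm] at hsum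
    have : ∀ c : ∀ i, ι i, (if ∀ j ∈ S.erase i, c j = p j then (1:ℝ) else 0) =
        (if ∀ j ∈ S, c j = p j then 1 else 0) + ∑ q ∈ Finset.univ.erase (z i),
          (if ∀ j ∈ S, c j = Function.update p i q j then (1:ℝ) else 0) := by
      intro c
      have e1 : (if ∀ j ∈ S, c j = p j then (1:ℝ) else 0) =
          (if ∀ j ∈ S, c j = Function.update p i (z i) j then (1:ℝ) else 0) := by
        rw [← hiz, Function.update_eq_self]
      rw [e1, Finset.add_sum_erase _ (fun q => if ∀ j ∈ S, c j = Function.update p i q j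
        then (1:ℝ) else 0) (Finset.mem_univ _)]
      have e2 : ∀ q, (∀ j ∈ S, c j = Function.update p i q j) ↔
          (q = c i ∧ ∀ j ∈ S.erase i, c j = p j) := by
        intro q
        constructor
        · intro hh
          refine ⟨by simpa using (hh i hiS).symm, fun j hj => ?_⟩
          have := hh j (Finset.mem_of_mem_erase hj)
          rwa [Function.update_of_ne (Finset.ne_of_mem_erase hj)] at this
        · rintro ⟨rfl, hh⟩ j hj
          by_cases hji : j = i
          · subst hji; simp
          · rw [Function.update_of_ne hji]
            exact hh j (Finset.mem_erase.2 ⟨hji, hj⟩)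
      simp only [e2]
      by_cases hc : ∀ j ∈ S.erase i, c j = p j
      · have e3 : ∀ q, (q = c i ∧ ∀ j ∈ S.erase i, c j = p j) ↔ q = c i :=
          fun q => and_iff_left hc
        simp only [e3, if_pos hc]
        rw [Finset.sum_ite_eq' Finset.univ (c i) (fun _ => (1:ℝ)), if_pos (Finset.mem_univ _)]
      · have e3 : ∀ q, ¬ (q = c i ∧ ∀ j ∈ S.erase i, c j = p j) :=
          fun q h => hc h.2
        rw [if_neg hc]
        exact (Finset.sum_eq_zero fun q _ => if_neg (e3 q)).symm
    simp only [this, mul_add, Finset.sum_add_distrib, Finset.mul_sum] at h0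
    linarith

lemma uvb_count {m : ℕ} {ι : Fin m → Type*} [∀ i, Fintype (ι i)] [∀ i, DecidableEq (ι i)]
    (z : ∀ i, ι i) (n : ℕ) :
    (Finset.univ.filter fun d : ∀ i, ι i =>
      (Finset.univ.filter fun i => d i ≠ z i).card ≤ n).card ≤
    ∑ j ∈ Finset.range (n + 1), ∑ S ∈ Finset.powersetCard j (Finset.univ : Finset (Fin m)),
      ∏ i ∈ S, (Fintype.card (ι i) - 1) := by
  classical
  have hsub : (Finset.univ.filter fun d : ∀ i, ι i =>
      (Finset.univ.filter fun i => d i ≠ z i).card ≤ n) ⊆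
      (Finset.range (n+1)).biUnion fun j =>
        (Finset.powersetCard j (Finset.univ : Finset (Fin m))).biUnion fun S =>
          Fintype.piFinset fun i => if i ∈ S then Finset.univ.erase (z i) else {z i} := by
    intro d hd
    simp only [Finset.mem_filter, Finset.mem_univ, true_and] at hd
    simp only [Finset.mem_biUnion, Finset.mem_range, Finset.mem_powersetCard]
    refine ⟨_, Nat.lt_succ_of_le hd, Finset.univ.filter fun i => d i ≠ z i,
      ⟨Finset.subset_univ _, rfl⟩, ?_⟩
    rw [Fintype.mem_piFinset]
    intro i
    by_cases hi : d i = z i <;> simp [hi]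
  refine (Finset.card_le_card hsub).trans (Finset.card_biUnion_le.trans ?_)
  refine Finset.sum_le_sum fun j _ => Finset.card_biUnion_le.trans ?_
  refine Finset.sum_le_sum fun S _ => ?_
  rw [Fintype.card_piFinset]
  rw [← Finset.prod_subset (Finset.subset_univ S)]
  · refine (Finset.prod_congr rfl fun i hi => ?_).le
    simp [hi, Finset.card_erase_of_mem]
  · intro i _ hi
    simp [hi]

lemma uvb_core {E : Type*} [NormedAddCommGroup E] [InnerProductSpace ℝ E]
    [FiniteDimensional ℝ E] {m : ℕ} {ι : Fin m → Type*} [∀ i, Fintype (ι i)]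
    (z : ∀ i, ι i) (A : Finset (∀ i, ι i)) (C : ∀ i, ι i → Set E)
    (hC : ∀ i p, Convex ℝ (C i p)) (hdisj : ∀ i p q x, x ∈ C i p → x ∈ C i q → p = q)
    (hw : ∀ c ∈ A, ∃ x, ∀ i, x ∈ C i (c i)) :
    A.card ≤
    ∑ j ∈ Finset.range (Module.finrank ℝ E + 1),
      ∑ S ∈ Finset.powersetCard j (Finset.univ : Finset (Fin m)),
        ∏ i ∈ S, (Fintype.card (ι i) - 1) := by
  classical
  refine le_trans ?_ (uvb_count z _)
  choose! w hw using hw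
  let K : ∀ i, ι i → Set E := fun i p => convexHull ℝ (w '' {c | c ∈ A ∧ c i = p})
  have hKC : ∀ i p, K i p ⊆ C i p := by
    intro i p
    refine convexHull_min ?_ (hC i p)
    rintro _ ⟨c, ⟨hc, rfl⟩, rfl⟩
    exact hw c hc i
  have hKcl : ∀ i p, IsClosed (K i p) := by
    intro i p
    refine (Set.Finite.isCompact_convexHull (𝕜 := ℝ) ?_).isClosed
    exact (Set.Finite.subset A.finite_toSet (fun c hc => hc.1)).image w
  have hsel : ∀ c ∈ A, ∃ v ∈ ⋂ i, K i (c i), ∃ S : Finset (Fin m),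
      S.card ≤ Module.finrank ℝ E ∧ ∀ w ∈ ⋂ i ∈ S, K i (c i), w = v ∨ ‖v‖ < ‖w‖ := by
    intro c hc
    refine uvb_select (fun i => K i (c i)) (fun i => convex_convexHull _ _)
      (fun i => hKcl _ _) ⟨w c, Set.mem_iInter.2 fun i => ?_⟩
    exact subset_convexHull _ _ ⟨c, ⟨hc, rfl⟩, rfl⟩
  choose! v hv S hS hmin using hsel
  set D := (Finset.univ.filter fun d : ∀ i, ι i =>
      (Finset.univ.filter fun i => d i ≠ z i).card ≤ Module.finrank ℝ E) with hD
  let T : (A → ℝ) →ₗ[ℝ] (D → ℝ) :=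
    { toFun := fun μ d => ∑ c : A, μ c * (if ∀ i, d.1 i ≠ z i → c.1 i = d.1 i then 1 else 0)
      map_add' := by
        intro μ ν; ext d; simp only [Pi.add_apply, add_mul, Finset.sum_add_distrib]
      map_smul' := by
        intro r μ; ext d
        simp only [Pi.smul_apply, smul_eq_mul, RingHom.id_apply, Finset.mul_sum, mul_assoc] }
  have hT : Function.Injective T := by
    rw [injective_iff_map_eq_zero]
    intro μ hμ
    by_contra hne
    let ν : (∀ i, ι i) → ℝ := fun c => if h : c ∈ A then μ ⟨c, h⟩ else 0
    have hν : ∀ c : A, ν c = μ c := fun c => by simp [ν]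
    have hcyl := uvb_mono z A ν (Module.finrank ℝ E) (by
      intro d hd
      have := congrFun hμ ⟨d, by simp [hD, hd]⟩
      rw [← Finset.sum_coe_sort]
      simp only [hν]
      exact this)
    have hnes : (A.filter fun c => ν c ≠ 0).Nonempty := by
      by_contra he
      rw [Finset.not_nonempty_iff_eq_empty, Finset.filter_eq_empty_iff] at he
      apply hne
      ext c
      have := he c.2
      rw [hν] at this
      simpa using this
    obtain ⟨c, hc, hmax⟩ := Finset.exists_max_image _ (fun c => ‖v c‖) hnes
    rw [Finset.mem_filter] at hc
    have h0 := hcyl (S c) (hS c hc.1) c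
    rw [Finset.sum_eq_single_of_mem c hc.1] at h0
    · simp at h0
      exact hc.2 h0
    · intro c' hc' hcc
      by_contra hprod
      have h1 : ν c' ≠ 0 := left_ne_zero_of_mul hprod
      have h2 : ∀ i ∈ S c, c' i = c i := by
        by_contra h3
        simp [h3] at hprod
      have hm := hmax c' (Finset.mem_filter.2 ⟨hc', h1⟩)
      have hv' := Set.mem_iInter.1 (hv c' hc')
      rcases hmin c hc.1 (v c') (by
        simp only [Set.mem_iInter]
        intro i hi
        rw [← h2 i hi]
        exact hv' i) with h4 | h4
      · apply hcc
        ext i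
        refine hdisj i _ _ (v c') (hKC _ _ (hv' i)) ?_
        rw [h4]
        exact hKC _ _ (Set.mem_iInter.1 (hv c hc.1) i)
      · linarith
  have := LinearMap.finrank_le_finrank_of_injective hT
  simpa using this

lemma uvb_identity (n m : ℕ) (hm : n + 1 ≤ m) (k : Fin m → ℤ) :
    ∑ j ∈ Finset.range (n + 1), ∑ S ∈ Finset.powersetCard j (Finset.univ : Finset (Fin m)),
      ∏ i ∈ S, (k i - 1) =
    ∑ j ∈ Finset.range (n + 1), (-1) ^ (n - j) * ((m - 1 - j).choose (n - j)) *
        ∑ S ∈ Finset.powersetCard j (Finset.univ : Finset (Fin m)), ∏ i ∈ S, k i := by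
  classical
  have h1 : ∀ j, ∑ S ∈ Finset.powersetCard j (Finset.univ : Finset (Fin m)),
      ∏ i ∈ S, (k i - 1) = ∑ a ∈ Finset.range (j + 1), (-1) ^ (j - a) * ((m - a).choose (j - a)) *
        ∑ T ∈ Finset.powersetCard a (Finset.univ : Finset (Fin m)), ∏ i ∈ T, k i := by
    intro j
    have e1 : ∀ S ∈ Finset.powersetCard j (Finset.univ : Finset (Fin m)),
        ∏ i ∈ S, (k i - 1) = ∑ a ∈ Finset.range (j + 1), ∑ T ∈ Finset.powersetCard a Finset.univ,
          if T ⊆ S then (-1) ^ (j - a) * ∏ i ∈ T, k i else 0 := by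
      intro S hS
      rw [Finset.mem_powersetCard] at hS
      simp only [sub_eq_add_neg]
      rw [Finset.prod_add, Finset.sum_powerset, hS.2]
      refine Finset.sum_congr rfl fun a _ => ?_
      rw [← Finset.sum_filter]
      refine Finset.sum_congr ?_ ?_
      · ext T; simp [Finset.mem_powersetCard, and_comm]
      · intro T hT
        simp only [Finset.mem_filter, Finset.mem_powersetCard] at hT
        rw [Finset.prod_const, Finset.card_sdiff_of_subset hT.2, hS.2, hT.1.2, mul_comm]
    rw [Finset.sum_congr rfl e1, Finset.sum_comm]
    refine Finset.sum_congr rfl fun a ha => ?_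
    rw [Finset.sum_comm, Finset.mul_sum]
    refine Finset.sum_congr rfl fun T hT => ?_
    rw [Finset.mem_powersetCard] at hT
    rw [← Finset.sum_filter, Finset.sum_const, nsmul_eq_mul]
    have : (Finset.filter (fun S => T ⊆ S)
        (Finset.powersetCard j (Finset.univ : Finset (Fin m)))).card = (m - a).choose (j - a) := by
      have ha' : a ≤ j := Nat.lt_succ_iff.1 (Finset.mem_range.1 ha)
      have : (Finset.powersetCard (j - a) (Finset.univ \ T)).card = (m - a).choose (j - a) := by
        rw [Finset.card_powersetCard, Finset.card_sdiff_of_subset (Finset.subset_univ _), hT.2]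
        simp
      rw [← this]
      refine Finset.card_bij' (fun S _ => S \ T) (fun U _ => U ∪ T) ?_ ?_ ?_ ?_
      · intro S hS
        simp only [Finset.mem_filter, Finset.mem_powersetCard] at hS ⊢
        refine ⟨Finset.sdiff_subset_sdiff (Finset.subset_univ _) le_rfl, ?_⟩
        rw [Finset.card_sdiff_of_subset hS.2, hS.1.2, hT.2]
      · intro U hU
        simp only [Finset.mem_filter, Finset.mem_powersetCard] at hU ⊢
        refine ⟨⟨Finset.subset_univ _, ?_⟩, Finset.subset_union_right⟩
        rw [Finset.card_union_of_disjoint, hU.2, hT.2]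
        · omega
        · exact Finset.disjoint_of_subset_left hU.1 Finset.sdiff_disjoint
      · intro S hS
        simp only [Finset.mem_filter, Finset.mem_powersetCard] at hS
        exact Finset.sdiff_union_of_subset hS.2
      · intro U hU
        simp only [Finset.mem_powersetCard] at hU
        exact Finset.union_sdiff_cancel_right
          (Finset.disjoint_of_subset_left hU.1 Finset.sdiff_disjoint)
    rw [this]; ring
  simp only [h1]
  have h2 : ∀ e : ℕ → ℤ, ∀ N, N + 1 ≤ m →
      ∑ j ∈ Finset.range (N + 1), ∑ a ∈ Finset.range (j + 1),
        (-1) ^ (j - a) * ((m - a).choose (j - a) : ℤ) * e a =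
      ∑ a ∈ Finset.range (N + 1), (-1) ^ (N - a) * ((m - 1 - a).choose (N - a) : ℤ) * e a := by
    intro e N hN
    induction N with
    | zero => simp
    | succ N ih =>
      rw [Finset.sum_range_succ, ih (by omega), Finset.sum_range_succ _ (N + 1),
        Finset.sum_range_succ _ (N + 1), ← add_assoc, ← Finset.sum_add_distrib]
      congr 1
      · refine Finset.sum_congr rfl fun a ha => ?_
        have ha' : a ≤ N := Nat.lt_succ_iff.1 (Finset.mem_range.1 ha)
        obtain ⟨b, rfl⟩ := Nat.exists_eq_add_of_le ha'
        obtain ⟨c, rfl⟩ := Nat.exists_eq_add_of_le hN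
        have q1 : a + b + 1 - a = b + 1 := by omega
        have q2 : a + b - a = b := by omega
        have q3 : a + b + 1 + 1 + c - 1 - a = b + 1 + c := by omega
        have q4 : a + b + 1 + 1 + c - a = b + 1 + c + 1 := by omega
        rw [q1, q2, q3, q4, Nat.choose_succ_succ]
        push_cast
        ring
      · simp
  exact h2 _ n hm

lemma uvb_subsingleton {n : ℕ} {F : Set (EuclideanSpace ℝ (Fin (n + 1)))} (hne : F.Nonempty)
    (h : Module.finrank ℝ (affineSpan ℝ F).direction = 0) : ∃ x, F = {x} := by
  rw [Submodule.finrank_eq_zero, direction_affineSpan, vectorSpan_eq_bot_iff_subsingleton] at h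
  obtain ⟨x, hx⟩ := hne
  exact ⟨x, h.eq_singleton_of_mem hx⟩

lemma uvb_faceCount {n : ℕ} (P : Set (EuclideanSpace ℝ (Fin (n + 1)))) :
    faceCount 0 P = Set.ncard {x | IsFaceOf {x} P} := by
  unfold faceCount
  rw [← Set.ncard_image_of_injective {x | IsFaceOf {x} P} Set.singleton_injective]
  congr 1
  ext F
  constructor
  · rintro ⟨h1, h2, h3⟩
    obtain ⟨x, rfl⟩ := uvb_subsingleton h2 h3
    exact ⟨x, h1, rfl⟩
  · rintro ⟨x, hx, rfl⟩
    refine ⟨hx, Set.singleton_nonempty x, ?_⟩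
    rw [Submodule.finrank_eq_zero, direction_affineSpan, vectorSpan_eq_bot_iff_subsingleton]
    exact Set.subsingleton_singleton

lemma uvb_mem {n : ℕ} {P : Set (EuclideanSpace ℝ (Fin (n + 1)))} {x} (h : IsFaceOf {x} P) :
    x ∈ P := by
  obtain ⟨φ, hφ⟩ := h
  have : x ∈ ({x} : Set _) := rfl
  rw [hφ] at this
  exact this.1

/-- The set of dehomogenised directions exposing the point `p` of `P`. -/
def uvbCell {n : ℕ} (P : Set (EuclideanSpace ℝ (Fin (n + 1))))
    (p : EuclideanSpace ℝ (Fin (n + 1))) : Set (EuclideanSpace ℝ (Fin n)) :=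
  {y | ∀ q ∈ P, q ≠ p → 0 < ∑ j, y j * (p - q) j.castSucc + (p - q) (Fin.last n)}

lemma uvb_convex {n : ℕ} (P : Set (EuclideanSpace ℝ (Fin (n + 1))))
    (p : EuclideanSpace ℝ (Fin (n + 1))) : Convex ℝ (uvbCell P p) := by
  intro y hy y' hy' a b ha hb hab q hq hqp
  have h1 := hy q hq hqp
  have h2 := hy' q hq hqp
  have e : ∑ j, (a • y + b • y') j * (p - q) j.castSucc + (p - q) (Fin.last n) =
      a * (∑ j, y j * (p - q) j.castSucc + (p - q) (Fin.last n)) +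
      b * (∑ j, y' j * (p - q) j.castSucc + (p - q) (Fin.last n)) := by
    have e1 : ∑ j, (a • y + b • y') j * (p - q) j.castSucc =
        a * ∑ j, y j * (p - q) j.castSucc + b * ∑ j, y' j * (p - q) j.castSucc := by
      rw [Finset.mul_sum, Finset.mul_sum, ← Finset.sum_add_distrib]
      refine Finset.sum_congr rfl fun j _ => ?_
      simp only [PiLp.add_apply, PiLp.smul_apply, smul_eq_mul]
      ring
    rw [e1]
    have : b = 1 - a := by linarith
    subst this
    ring
  rw [e]
  rcases ha.eq_or_lt with rfl | ha
  · have : b = 1 := by linarith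
    subst this
    linarith
  · have := mul_pos ha h1
    have := mul_nonneg hb h2.le
    linarith

theorem upper_vertices_upper_bound_full_dimensional (n m : ℕ) (hm : n + 1 ≤ m)
    (k : Fin m → ℕ) (hk : ∀ i, n + 2 ≤ k i)
    (P : Fin m → Set (EuclideanSpace ℝ (Fin (n + 1))))
    (hpoly : ∀ i, IsPolytope (P i))
    (hfull : ∀ i, affineSpan ℝ (P i) = ⊤)
    (hvert : ∀ i, faceCount 0 (P i) = k i) :
    (upperFaceCount 0 (∑ i, P i) : ℤ) ≤
      ∑ j ∈ Finset.range (n + 1), (-1) ^ (n - j) * ((m - 1 - j).choose (n - j)) *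
        ∑ S ∈ Finset.powersetCard j (Finset.univ : Finset (Fin m)), ∏ i ∈ S, (k i : ℤ) := by
  classical
  let ι : Fin m → Type := fun i => {x // IsFaceOf {x} (P i)}
  have hcard : ∀ i, Nat.card (ι i) = k i := fun i => by
    rw [← hvert i, uvb_faceCount]; rfl
  have hfin : ∀ i, Finite (ι i) := fun i =>
    Nat.finite_of_card_ne_zero (by rw [hcard]; have := hk i; omega)
  let _ : ∀ i, Fintype (ι i) := fun i => Fintype.ofFinite _
  have hnon : ∀ i, Nonempty (ι i) := fun i =>
    (Nat.card_pos_iff.1 (by rw [hcard]; have := hk i; omega)).1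
  let z : ∀ i, ι i := fun i => (hnon i).some
  let A : Finset (∀ i, ι i) :=
    Finset.univ.filter fun c => ∃ y, ∀ i, y ∈ uvbCell (P i) (c i).1
  have hA := uvb_core z A (fun i p => uvbCell (P i) p.1) (fun i p => uvb_convex _ _)
    (by
      intro i p q y hp hq
      by_contra hpq
      have hpq' : p.1 ≠ q.1 := fun h => hpq (Subtype.ext h)
      have h1 := hp q.1 (uvb_mem q.2) hpq'.symm
      have h2 := hq p.1 (uvb_mem p.2) hpq'
      have h3 : ∑ j, y j * (p.1 - q.1) j.castSucc = -∑ j, y j * (q.1 - p.1) j.castSucc := by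
        rw [← Finset.sum_neg_distrib]
        refine Finset.sum_congr rfl fun j _ => ?_
        simp only [PiLp.sub_apply]
        ring
      rw [h3] at h1
      simp only [PiLp.sub_apply] at h1 h2
      linarith)
    (by
      intro c hc
      exact (Finset.mem_filter.1 hc).2)
  have hup : upperFaceCount 0 (∑ i, P i) ≤ A.card := by
    unfold upperFaceCount
    rw [← Set.ncard_coe_finset A]
    refine le_trans (Set.ncard_le_ncard (t := (fun c : ∀ i, ι i =>
      ({∑ i, (c i).1} : Set (EuclideanSpace ℝ (Fin (n + 1))))) '' (A : Set (∀ i, ι i))) ?_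
      (A.finite_toSet.image _)) (Set.ncard_image_le A.finite_toSet)
    rintro F ⟨hF, hFne, hF0, l, hl, hlast⟩
    obtain ⟨x, rfl⟩ := uvb_subsingleton hFne hF0
    obtain ⟨g, hg, hgx⟩ := (Set.mem_fintype_sum _ _).1 (uvb_mem hF)
    have hpos : 0 < l (Fin.last n) := by
      simpa [EuclideanSpace.inner_single_right] using hlast
    have hmax : ∀ i, ∀ q ∈ P i, q ≠ g i → 0 < ⟪l, g i - q⟫ := by
      intro i q hq hqg
      have hsum : ∑ j, Function.update g i q j = x - g i + q := by
        rw [Finset.sum_update_of_mem (Finset.mem_univ i), ← hgx,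
          ← Finset.add_sum_erase _ g (Finset.mem_univ i), Finset.sdiff_singleton_eq_erase]
        abel
      have h1 := hl.2 x rfl (x - g i + q) ⟨?_, ?_⟩
      · have : x - (x - g i + q) = g i - q := by abel
        rwa [this] at h1
      · rw [← hsum]
        refine (Set.mem_fintype_sum _ _).2 ⟨_, ?_, rfl⟩
        intro j
        by_cases hj : j = i
        · subst hj; simpa using hq
        · simpa [hj] using hg j
      · intro h2
        apply hqg
        have h3 : x - g i + q = x := h2
        have h4 : q - g i = 0 := by
          have : q - g i = (x - g i + q) - x := by abel
          rw [this, h3, sub_self]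
        exact sub_eq_zero.1 h4
    have hface : ∀ i, IsFaceOf {g i} (P i) := by
      intro i
      refine ⟨(innerSL ℝ l).toLinearMap, ?_⟩
      ext q
      simp only [Set.mem_singleton_iff, Set.mem_setOf_eq, ContinuousLinearMap.coe_coe,
        innerSL_apply_apply]
      constructor
      · rintro rfl
        refine ⟨hg i, fun y hy => ?_⟩
        by_cases hyg : y = g i
        · rw [hyg]
        · have := hmax i y hy hyg
          rw [inner_sub_right] at this
          linarith
      · rintro ⟨hq, hqm⟩
        by_contra hne
        have h1 := hmax i q hq hne
        rw [inner_sub_right] at h1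
        have h2 := hqm (g i) (hg i)
        linarith
    refine ⟨fun i => ⟨g i, hface i⟩, ?_, ?_⟩
    · rw [Finset.mem_coe, Finset.mem_filter]
      refine ⟨Finset.mem_univ _, WithLp.toLp 2 (fun j => l j.castSucc / l (Fin.last n)), ?_⟩
      intro i q hq hqg
      have h1 := hmax i q hq hqg
      rw [PiLp.inner_apply, Fin.sum_univ_castSucc] at h1
      have h2 := div_pos h1 hpos
      refine lt_of_lt_of_eq h2 ?_
      rw [add_div, Finset.sum_div]
      congr 1
      · refine Finset.sum_congr rfl fun j _ => ?_
        simp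
        ring
      · simp
        field_simp
    · simp only [hgx]
  rw [← uvb_identity n m hm (fun i => (k i : ℤ))]
  have hfr : Module.finrank ℝ (EuclideanSpace ℝ (Fin n)) = n := by simp
  rw [hfr] at hA
  have hfinal := hup.trans hA
  have hc2 : ∀ i, Fintype.card (ι i) = k i := fun i => by
    rw [← hcard i, Nat.card_eq_fintype_card]
  simp only [hc2] at hfinal
  have hcast : ((∑ j ∈ Finset.range (n + 1),
      ∑ S ∈ Finset.powersetCard j (Finset.univ : Finset (Fin m)),
        ∏ i ∈ S, (k i - 1) : ℕ) : ℤ) = ∑ j ∈ Finset.range (n + 1),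
      ∑ S ∈ Finset.powersetCard j (Finset.univ : Finset (Fin m)), ∏ i ∈ S, ((k i : ℤ) - 1) := by
    rw [Nat.cast_sum]
    refine Finset.sum_congr rfl fun j _ => ?_
    rw [Nat.cast_sum]
    refine Finset.sum_congr rfl fun S _ => ?_
    rw [Nat.cast_prod]
    refine Finset.prod_congr rfl fun i _ => ?_
    have := hk i
    rw [Nat.cast_sub (by omega), Nat.cast_one]
  rw [← hcast]
  exact_mod_cast hfinal
end

section
/- For all integers m, n, r with 0 ≤ r ≤ n < m, it holds that ∑_{j=0}^{n} (−1)^{n−j} C(m−1−j, n−j) · C(m−r, j−r) = 1, where C(a, b) = 0 whenever b < 0. -/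
theorem alternating_binomial_identity (m n r : ℕ) (hrn : r ≤ n) (hnm : n < m) :
    ∑ j ∈ Finset.range (n + 1),
        (-1 : ℤ) ^ (n - j) * ((m - 1 - j).choose (n - j)) *
          (if r ≤ j then ((m - r).choose (j - r) : ℤ) else 0) = 1 := by
  obtain ⟨N, rfl⟩ := Nat.exists_eq_add_of_le hrn
  obtain ⟨a, rfl⟩ := Nat.exists_eq_add_of_lt hnm
  have key := Ring.add_choose_eq N (Commute.all ((N + a + 1 : ℕ) : ℤ) (-((a + 1 : ℕ) : ℤ)))
  rw [show ((N + a + 1 : ℕ) : ℤ) + (-((a + 1 : ℕ) : ℤ)) = (N : ℤ) by push_cast; ring,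
    Ring.choose_natCast, Nat.choose_self, Finset.Nat.sum_antidiagonal_eq_sum_range_succ_mk] at key
  rw [add_assoc r N 1, Finset.sum_range_add, Finset.sum_eq_zero, zero_add]
  · rw [Nat.cast_one] at key
    refine Eq.trans ?_ key.symm
    refine Finset.sum_congr rfl fun i hi => ?_
    have hi' : i ≤ N := by simpa [Nat.lt_succ_iff] using hi
    obtain ⟨k, rfl⟩ := Nat.exists_eq_add_of_le hi'
    have e1 : r + (i + k) - (r + i) = k := by omega
    have e2 : r + (i + k) + a + 1 - 1 - (r + i) = a + k := by omega
    have e3 : r + (i + k) + a + 1 - r = i + k + a + 1 := by omega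
    have e4 : r + i - r = i := by omega
    have e5 : i + k - i = k := by omega
    simp only [e1, e2, e3, e4, e5, Ring.choose_natCast, Ring.choose_neg]
    rw [show ((a + 1 : ℕ) : ℤ) + (k : ℤ) - 1 = ((a + k : ℕ) : ℤ) by push_cast; ring,
      Ring.choose_natCast, if_pos (by omega)]
    simp [Units.smul_def, Int.negOnePow]
    ring
  · intro j hj
    have : j < r := by simpa using hj
    rw [if_neg (by omega), mul_zero]
end

section
/- Let m ≥ n + 1 ≥ 1 be integers and let k_1,…,k_m be real numbers with k_i ≥ 2 for all i. Then ∑_{j=0}^{n} (−1)^{n−j} C(m−1−j, n−j) ∑_{S ⊆ [m], |S| = j} ∏_{i∈S} k_i = ∑_{j=0}^{n} ∑_{S ⊆ [m], |S| = j} ∏_{i∈S} (k_i − 1), where the product over the empty set equals 1. -/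
theorem aux_esymm (m : ℕ) (k : Fin m → ℝ) (j : ℕ) :
    ∑ S ∈ Finset.powersetCard j (Finset.univ : Finset (Fin m)), ∏ i ∈ S, (k i - 1)
    = ∑ i ∈ Finset.range (j + 1), (-1 : ℝ) ^ (j - i) * ((m - i).choose (j - i)) *
      ∑ S ∈ Finset.powersetCard i (Finset.univ : Finset (Fin m)), ∏ i ∈ S, k i := by
  classical
  have h1 : ∀ S ∈ Finset.powersetCard j (Finset.univ : Finset (Fin m)),
      ∏ i ∈ S, (k i - 1) = ∑ i ∈ Finset.range (j + 1), ∑ T ∈ Finset.powersetCard i S,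
        (-1 : ℝ) ^ (j - i) * ∏ i ∈ T, k i := by
    intro S hS
    have hc := (Finset.mem_powersetCard.1 hS).2
    simp only [sub_eq_add_neg]
    rw [Finset.prod_add, Finset.sum_powerset, hc]
    refine Finset.sum_congr rfl fun i hi => Finset.sum_congr rfl fun T hT => ?_
    obtain ⟨hT1, hT2⟩ := Finset.mem_powersetCard.1 hT
    rw [Finset.prod_const, Finset.card_sdiff_of_subset hT1, hc, hT2, mul_comm]
  rw [Finset.sum_congr rfl h1, Finset.sum_comm]
  refine Finset.sum_congr rfl fun i hi => ?_
  have hij : i ≤ j := by simpa [Nat.lt_succ_iff] using hi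
  have h2 : ∑ T ∈ Finset.powersetCard i (Finset.univ : Finset (Fin m)),
      ∑ U ∈ Finset.powersetCard (j - i) Tᶜ, (-1 : ℝ) ^ (j - i) * ∏ i ∈ T, k i
      = (-1 : ℝ) ^ (j - i) * ((m - i).choose (j - i)) *
      ∑ S ∈ Finset.powersetCard i (Finset.univ : Finset (Fin m)), ∏ i ∈ S, k i := by
    rw [Finset.mul_sum]
    refine Finset.sum_congr rfl fun T hT => ?_
    have hc := (Finset.mem_powersetCard.1 hT).2
    rw [Finset.sum_const, Finset.card_powersetCard, Finset.card_compl, hc, Fintype.card_fin,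
      nsmul_eq_mul]
    ring
  rw [← h2, Finset.sum_sigma', Finset.sum_sigma']
  refine Finset.sum_bij' (fun p _ => ⟨p.2, p.1 \ p.2⟩) (fun p _ => ⟨p.1 ∪ p.2, p.1⟩) ?_ ?_ ?_ ?_ ?_
  · rintro ⟨S, T⟩ h
    simp only [Finset.mem_sigma, Finset.mem_powersetCard] at h ⊢
    obtain ⟨⟨-, h1⟩, h2, h3⟩ := h
    refine ⟨⟨Finset.subset_univ _, h3⟩, ?_, ?_⟩
    · intro x hx
      simp at hx ⊢
      exact hx.2
    · rw [Finset.card_sdiff_of_subset h2, h1, h3]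
  · rintro ⟨T, U⟩ h
    simp only [Finset.mem_sigma, Finset.mem_powersetCard] at h ⊢
    obtain ⟨⟨-, h1⟩, h2, h3⟩ := h
    refine ⟨⟨Finset.subset_univ _, ?_⟩, Finset.subset_union_left, h1⟩
    rw [Finset.card_union_of_disjoint, h1, h3]
    · omega
    · exact Finset.disjoint_left.2 fun x hx hu => (Finset.mem_compl.1 (h2 hu)) hx
  · rintro ⟨S, T⟩ h
    simp only [Finset.mem_sigma, Finset.mem_powersetCard] at h
    simp [Finset.union_eq_right.2 h.2.1]
  · rintro ⟨T, U⟩ h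
    simp only [Finset.mem_sigma, Finset.mem_powersetCard] at h
    obtain ⟨⟨-, h1⟩, h2, h3⟩ := h
    have : Disjoint T U := Finset.disjoint_left.2 fun x hx hu => (Finset.mem_compl.1 (h2 hu)) hx
    simp [Finset.union_sdiff_cancel_left this]
  · rintro ⟨S, T⟩ h
    rfl

theorem aux_alt (a b : ℕ) : ∑ t ∈ Finset.range (b + 1), (-1 : ℝ) ^ t * ((a + 1).choose t)
    = (-1 : ℝ) ^ b * (a.choose b) := by
  induction b with
  | zero => simp
  | succ b ih =>
    rw [Finset.sum_range_succ, ih, Nat.choose_succ_succ]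
    push_cast
    ring

theorem alternating_sum_reformulation (m n : ℕ) (hm : n + 1 ≤ m)
    (k : Fin m → ℝ) (hk : ∀ i, 2 ≤ k i) :
    ∑ j ∈ Finset.range (n + 1),
        (-1 : ℝ) ^ (n - j) * ((m - 1 - j).choose (n - j)) *
          ∑ S ∈ Finset.powersetCard j (Finset.univ : Finset (Fin m)), ∏ i ∈ S, k i
      = ∑ j ∈ Finset.range (n + 1),
          ∑ S ∈ Finset.powersetCard j (Finset.univ : Finset (Fin m)), ∏ i ∈ S, (k i - 1) := by
  simp only [aux_esymm m k]
  have h := Finset.sum_comm' (s := Finset.range (n + 1)) (t := fun j => Finset.range (j + 1))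
    (t' := Finset.range (n + 1)) (s' := fun i => Finset.Ico i (n + 1))
    (f := fun j i => (-1 : ℝ) ^ (j - i) * ((m - i).choose (j - i)) *
      ∑ S ∈ Finset.powersetCard i (Finset.univ : Finset (Fin m)), ∏ i ∈ S, k i)
    (by intro x y; simp only [Finset.mem_range, Finset.mem_Ico]; omega)
  rw [h]
  refine Finset.sum_congr rfl fun i hi => ?_
  have hi' : i ≤ n := by simpa [Nat.lt_succ_iff] using hi
  rw [← Finset.sum_mul, Finset.sum_Ico_eq_sum_range]
  congr 1
  simp only [Nat.add_sub_cancel_left]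
  rw [show n + 1 - i = (n - i) + 1 by omega, show m - i = (m - 1 - i) + 1 by omega, aux_alt]
end

section
/- Let 𝒜 be a simple maxout arrangement in ℝ^n arising from m ≥ n + 1 maxout units of ranks k_1,…,k_m ≥ 2. Then the number of regions satisfies r(𝒜) = ∑_{j=0}^{n} (−1)^{n−j} C(m−1−j, n−j) ∑_{S ⊆ [m], |S| = j} r(𝒜_S), where r(𝒜_∅) = 1. -/
/-- The indecision set of the pair of pre-activation features `a`, `b` of a maxout unit
with affine pre-activation features `A`. -/
def atomSet {d k : ℕ} (A : Fin k → ((Fin d → ℝ) →ᵃ[ℝ] ℝ)) (a b : Fin k) : Set (Fin d → ℝ) :=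
  {x | A a x = A b x ∧ ∀ c, A c x ≤ A a x}

/-- `H` is an atom of the maxout unit with pre-activation features `A`: a nonempty
codimension-1 indecision boundary between two distinct features. -/
def IsAtomOf {d k : ℕ} (A : Fin k → ((Fin d → ℝ) →ᵃ[ℝ] ℝ)) (H : Set (Fin d → ℝ)) : Prop :=
  H.Nonempty ∧ Module.finrank ℝ (affineSpan ℝ H).direction + 1 = d ∧
    ∃ a b, a ≠ b ∧ H = atomSet A a b

/-- The union of all atoms of the units `i ∈ S` of a maxout arrangement. -/
def arrangementUnion {d m : ℕ} {k : Fin m → ℕ}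
    (A : (i : Fin m) → Fin (k i) → ((Fin d → ℝ) →ᵃ[ℝ] ℝ)) (S : Finset (Fin m)) :
    Set (Fin d → ℝ) :=
  {x | ∃ i ∈ S, ∃ H, IsAtomOf (A i) H ∧ x ∈ H}

/-- The number of regions: connected components of the complement of the union of atoms. -/
noncomputable def regionCount {d : ℕ} (X : Set (Fin d → ℝ)) : ℕ :=
  Nat.card (ConnectedComponents ↥(Xᶜ))


open Set in
lemma open_cell {n k : ℕ} (A : Fin k → ((Fin n → ℝ) →ᵃ[ℝ] ℝ)) (f : (Fin n → ℝ) →ᵃ[ℝ] ℝ) :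
    IsOpen {z | ∀ c, A c ≠ f → A c z < f z} := by
  have : {z | ∀ c, A c ≠ f → A c z < f z} = ⋂ c, ⋂ (_ : A c ≠ f), {z | A c z < f z} := by
    ext z; simp
  rw [this]
  refine isOpen_iInter_of_finite fun c => isOpen_iInter_of_finite fun _ => ?_
  exact isOpen_lt (A c).continuous_of_finiteDimensional f.continuous_of_finiteDimensional

open Set in
lemma convex_cell {n k : ℕ} (A : Fin k → ((Fin n → ℝ) →ᵃ[ℝ] ℝ)) (f : (Fin n → ℝ) →ᵃ[ℝ] ℝ) :
    Convex ℝ {z | ∀ c, A c ≠ f → A c z < f z} := by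
  intro x hx y hy a b ha hb hab c hc
  have h1 := hx c hc
  have h2 := hy c hc
  rw [Convex.combo_affine_apply hab, Convex.combo_affine_apply hab]
  simp only [smul_eq_mul]
  rcases ha.eq_or_lt with rfl | ha'
  · have : b = 1 := by linarith
    subst this; linarith
  · nlinarith [mul_lt_mul_of_pos_left h1 ha', mul_le_mul_of_nonneg_left h2.le hb]

open Set in
lemma atom_ne {n k : ℕ} (A : Fin k → ((Fin n → ℝ) →ᵃ[ℝ] ℝ)) (H : Set (Fin n → ℝ))
    (hH : IsAtomOf A H) (x : Fin n → ℝ) (hx : x ∈ H)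
    (h : ∀ a b, (∀ c, A c x ≤ A a x) → (∀ c, A c x ≤ A b x) → A a = A b) : False := by
  obtain ⟨-, hd, a, b, -, rfl⟩ := hH
  have hb : ∀ c, A c x ≤ A b x := fun c => hx.1 ▸ hx.2 c
  have hab := h a b hx.2 hb
  have hxO : x ∈ {z | ∀ c, A c ≠ A a → A c z < A a z} := by
    intro c hc
    refine lt_of_le_of_ne (hx.2 c) fun e => hc (h c a (fun d => ?_) hx.2)
    rw [e]; exact hx.2 d
  have hsub : {z | ∀ c, A c ≠ A a → A c z < A a z} ⊆ atomSet A a b := by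
    intro z hz
    refine ⟨by rw [hab], fun c => ?_⟩
    by_cases hc : A c = A a
    · rw [hc]
    · exact (hz c hc).le
  have htop := (open_cell A (A a)).affineSpan_eq_top ⟨x, hxO⟩
  have : affineSpan ℝ (atomSet A a b) = ⊤ := by
    rw [eq_top_iff, ← htop]; exact affineSpan_mono ℝ hsub
  rw [this, AffineSubspace.direction_top, finrank_top, Module.finrank_fin_fun] at hd
  omega

open Set in
lemma dense_avoid {n : ℕ} {J : Type} [Finite J] (L : J → AffineSubspace ℝ (Fin n → ℝ))
    (hL : ∀ j, Module.finrank ℝ (L j).direction < n) : Dense {x | ∀ j, x ∉ L j} := by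
  refine MeasureTheory.Measure.dense_of_ae (μ := MeasureTheory.volume) ?_
  rw [MeasureTheory.ae_all_iff]
  intro j
  have : L j ≠ ⊤ := by
    intro e
    have := hL j
    rw [e, AffineSubspace.direction_top, finrank_top, Module.finrank_fin_fun] at this
    omega
  exact MeasureTheory.measure_eq_zero_iff_ae_notMem.1
    (MeasureTheory.Measure.addHaar_affineSubspace MeasureTheory.volume (L j) this)

open Set in
lemma affine_eq_of_max {n : ℕ} (f g : (Fin n → ℝ) →ᵃ[ℝ] ℝ) (B : Set (Fin n → ℝ)) (hB : IsOpen B)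
    (x : Fin n → ℝ) (hx : x ∈ B) (hle : ∀ y ∈ B, f y ≤ g y) (he : f x = g x) : f = g := by
  ext z
  have hcont : Continuous (fun t : ℝ => AffineMap.lineMap x z t) := AffineMap.lineMap_continuous
  have hcont' : Filter.Tendsto (fun t : ℝ => AffineMap.lineMap x z t) (nhds 0) (nhds x) := by
    simpa using hcont.tendsto (0:ℝ)
  obtain ⟨ε, hε, hb⟩ := Metric.eventually_nhds_iff.1 (hcont'.eventually (hB.mem_nhds hx))
  have h1 := hle _ (@hb (ε/2) (by simp [abs_of_pos hε]; linarith))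
  have h2 := hle _ (@hb (-(ε/2)) (by simp [abs_of_pos hε]; linarith))
  simp only [AffineMap.apply_lineMap, AffineMap.lineMap_apply_ring'] at h1 h2
  rw [he] at h1 h2
  nlinarith

open Set in
lemma purity {n k : ℕ} (A : Fin k → ((Fin n → ℝ) →ᵃ[ℝ] ℝ)) (hk : 0 < k) (x : Fin n → ℝ)
    (hx : ¬ ∃ H, IsAtomOf A H ∧ x ∈ H) (a b : Fin k)
    (ha : ∀ c, A c x ≤ A a x) (hb : ∀ c, A c x ≤ A b x) : A a = A b := by
  classical
  have : Nonempty (Fin k) := ⟨⟨0, hk⟩⟩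
  have hmax : ∀ z, ∃ c, ∀ d, A d z ≤ A c z := fun z => Finite.exists_max (fun c => A c z)
  have hclosed : ∀ c d, IsClosed (atomSet A c d) := by
    intro c d
    have : atomSet A c d = {z | A c z = A d z} ∩ ⋂ e, {z | A e z ≤ A c z} := by
      ext z; simp [atomSet]
    rw [this]
    exact (isClosed_eq (A c).continuous_of_finiteDimensional
      (A d).continuous_of_finiteDimensional).inter (isClosed_iInter fun e =>
      isClosed_le (A e).continuous_of_finiteDimensional (A c).continuous_of_finiteDimensional)
  -- a ball around x avoiding all atoms
  have hball : ∃ ε > 0, ∀ z ∈ Metric.ball x ε, ∀ c d, IsAtomOf A (atomSet A c d) →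
      z ∉ atomSet A c d := by
    have : ∀ᶠ z in nhds x, ∀ c d, IsAtomOf A (atomSet A c d) → z ∉ atomSet A c d := by
      refine Filter.eventually_all.2 fun c => Filter.eventually_all.2 fun d => ?_
      by_cases h : IsAtomOf A (atomSet A c d)
      · filter_upwards [(hclosed c d).isOpen_compl.mem_nhds (fun hh => hx ⟨_, h, hh⟩)] with z hz _
        exact hz
      · exact Filter.Eventually.of_forall fun z hz => absurd hz h
    obtain ⟨ε, hε, h⟩ := Metric.eventually_nhds_iff.1 this
    exact ⟨ε, hε, fun z hz => h hz⟩
  obtain ⟨ε, hε, hB⟩ := hball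
  set B := Metric.ball x ε with hBdef
  let J := {p : Fin k × Fin k // A p.1 ≠ A p.2 ∧ (atomSet A p.1 p.2 ∩ B).Nonempty}
  let L : J → AffineSubspace ℝ (Fin n → ℝ) := fun p => affineSpan ℝ (atomSet A p.1.1 p.1.2)
  have hdim : ∀ j, Module.finrank ℝ (L j).direction + 1 < n := by
    rintro ⟨⟨c, d⟩, hne, z, hz, hzB⟩
    have h1 : Module.finrank ℝ (affineSpan ℝ (atomSet A c d)).direction < n := by
      by_contra hcon
      have hfr : Module.finrank ℝ (affineSpan ℝ (atomSet A c d)).direction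
          = Module.finrank ℝ (Fin n → ℝ) := by
        apply le_antisymm (Submodule.finrank_le _)
        simpa using hcon
      have htop := Submodule.eq_top_of_finrank_eq hfr
      rw [AffineSubspace.direction_eq_top_iff_of_nonempty
        ((affineSpan_nonempty ℝ).2 ⟨z, hz⟩)] at htop
      apply hne
      refine AffineMap.ext_on htop ?_
      intro y hy
      exact hy.1
    have h2 : Module.finrank ℝ (affineSpan ℝ (atomSet A c d)).direction + 1 ≠ n := by
      intro he
      exact hB z hzB c d ⟨⟨z, hz⟩, he, c, d, fun e => hne (by rw [e]), rfl⟩ hz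
    change Module.finrank ℝ (affineSpan ℝ (atomSet A c d)).direction + 1 < n
    omega
  have huniq : ∀ z ∈ B, (∀ j, z ∉ L j) → ∀ c, (∀ d, A d z ≤ A c z) →
      ∀ d, A d ≠ A c → A d z < A c z := by
    intro z hzB hz c hc d hdc
    refine lt_of_le_of_ne (hc d) fun e => ?_
    have hm : z ∈ atomSet A c d := ⟨e.symm, hc⟩
    exact hz ⟨(c, d), hdc.symm, z, hm, hzB⟩ (subset_affineSpan ℝ _ hm)
  have hBo : IsOpen B := Metric.isOpen_ball
  have hxB : x ∈ B := Metric.mem_ball_self hε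
  obtain ⟨p, hpB, hp⟩ := (dense_avoid L (fun j => by have := hdim j; omega)).inter_open_nonempty
    B hBo ⟨x, hxB⟩
  obtain ⟨c, hc⟩ := hmax p
  have hpc := huniq p hpB hp c hc
  let L' : J → AffineSubspace ℝ (Fin n → ℝ) := fun j => affineSpan ℝ (insert p (L j : Set _))
  have hL' : ∀ j, Module.finrank ℝ (L' j).direction < n := by
    intro j
    have h1 := finrank_vectorSpan_insert_le (L j) p
    have h2 := hdim j
    rw [direction_affineSpan]
    omega
  have hD := dense_avoid L' hL'
  have hq : ∀ q ∈ B, (∀ j, q ∉ L' j) → ∀ d, A d q ≤ A c q := by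
    intro q hqB hq
    have hseg : segment ℝ p q ⊆ B := (convex_ball x ε).segment_subset hpB hqB
    have havoid : ∀ z ∈ segment ℝ p q, ∀ j, z ∉ L j := by
      intro z hz j hzL
      rw [segment_eq_image_lineMap] at hz
      obtain ⟨t, -, rfl⟩ := hz
      by_cases ht : t = 0
      · subst ht
        simp only [AffineMap.lineMap_apply_zero] at hzL
        exact hp j hzL
      · apply hq j
        have h1 : p ∈ L' j := subset_affineSpan ℝ _ (Set.mem_insert _ _)
        have h2 : AffineMap.lineMap p q t ∈ L' j :=
          subset_affineSpan ℝ _ (Set.mem_insert_of_mem _ hzL)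
        have h3 := AffineMap.lineMap_mem (t⁻¹) h1 h2
        rwa [show AffineMap.lineMap p (AffineMap.lineMap p q t) t⁻¹ = q by
          simp [AffineMap.lineMap_apply, smul_smul, ht]] at h3
    let O : Set (Fin n → ℝ) := {z | ∀ d, A d ≠ A c → A d z < A c z}
    let O' : Set (Fin n → ℝ) := ⋃ e, ⋃ (_ : A e ≠ A c), {z | ∀ d, A d ≠ A e → A d z < A e z}
    have hO' : IsOpen O' := isOpen_iUnion fun e => isOpen_iUnion fun _ => open_cell A (A e)
    have hdisj : Disjoint O O' := by
      rw [Set.disjoint_left]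
      intro z hz hz'
      simp only [O', mem_iUnion] at hz'
      obtain ⟨e, he, hz'⟩ := hz'
      exact lt_asymm (hz e he) (hz' c he.symm)
    have hcov : segment ℝ p q ⊆ O ∪ O' := by
      intro z hz
      obtain ⟨e, he⟩ := hmax z
      have := huniq z (hseg hz) (havoid z hz) e he
      by_cases hec : A e = A c
      · left; rw [hec] at this; exact this
      · right; simp only [O', mem_iUnion]; exact ⟨e, hec, this⟩
    have hs := (convex_segment p q).isPreconnected.subset_left_of_subset_union
      (open_cell A (A c)) hO' hdisj hcov ⟨p, left_mem_segment ℝ p q, hpc⟩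
    intro d
    by_cases hd : A d = A c
    · rw [hd]
    · exact (hs (right_mem_segment ℝ p q) d hd).le
  have hall : ∀ d, ∀ y ∈ B, A d y ≤ A c y := by
    intro d y hy
    have hcl : IsClosed {z | A d z ≤ A c z} :=
      isClosed_le (A d).continuous_of_finiteDimensional (A c).continuous_of_finiteDimensional
    have h1 : y ∈ closure (B ∩ {x | ∀ j, x ∉ L' j}) := hD.open_subset_closure_inter hBo hy
    exact closure_minimal (fun q hq' => hq q hq'.1 hq'.2 d) hcl h1
  rw [affine_eq_of_max (A a) (A c) B hBo x hxB (hall a) (le_antisymm (hall a x hxB) (ha c)),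
    affine_eq_of_max (A b) (A c) B hBo x hxB (hall b) (le_antisymm (hall b x hxB) (hb c))]

open Set in
lemma unit_lem {n k : ℕ} (A : Fin k → ((Fin n → ℝ) →ᵃ[ℝ] ℝ)) (hk : 0 < k) (s : Set (Fin k)) :
    IsOpen {x | (¬ ∃ H, IsAtomOf A H ∧ x ∈ H) ∧ {a | ∀ c, A c x ≤ A a x} = s} ∧
    Convex ℝ {x | (¬ ∃ H, IsAtomOf A H ∧ x ∈ H) ∧ {a | ∀ c, A c x ≤ A a x} = s} := by
  have : Nonempty (Fin k) := ⟨⟨0, hk⟩⟩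
  rcases Set.eq_empty_or_nonempty
    {x | (¬ ∃ H, IsAtomOf A H ∧ x ∈ H) ∧ {a | ∀ c, A c x ≤ A a x} = s} with he | ⟨x, hx, hs⟩
  · rw [he]; exact ⟨isOpen_empty, convex_empty⟩
  obtain ⟨a, ha⟩ := Finite.exists_max (fun c => A c x)
  have hs' : s = {c | A c = A a} := by
    rw [← hs]
    ext c
    constructor
    · intro hc
      exact purity A hk x hx c a hc ha
    · intro hc d
      rw [show A c = A a from hc]; exact ha d
  have : {x | (¬ ∃ H, IsAtomOf A H ∧ x ∈ H) ∧ {a | ∀ c, A c x ≤ A a x} = s}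
      = {z | ∀ c, A c ≠ A a → A c z < A a z} := by
    ext z
    constructor
    · rintro ⟨hz, hzs⟩ c hc
      rw [hs'] at hzs
      have haz : a ∈ {b | ∀ c, A c z ≤ A b z} := by rw [hzs]; rfl
      refine lt_of_le_of_ne (haz c) fun e => hc ?_
      have : c ∈ {b | ∀ c, A c z ≤ A b z} := fun d => by rw [e]; exact haz d
      rw [hzs] at this
      exact this
    · intro hz
      have haz : ∀ c, A c z ≤ A a z := by
        intro c
        by_cases hc : A c = A a
        · rw [hc]
        · exact (hz c hc).le
      have huni : ∀ b, (∀ c, A c z ≤ A b z) → A b = A a := by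
        intro b hb
        by_contra hne
        exact absurd (hb a) (not_le.2 (hz b hne))
      refine ⟨?_, ?_⟩
      · rintro ⟨H, hH, hzH⟩
        exact atom_ne A H hH z hzH fun b d hb hd => (huni b hb).trans (huni d hd).symm
      · rw [hs']
        ext b
        exact ⟨huni b, fun hb d => by rw [show A b = A a from hb]; exact haz d⟩
  rw [this]
  exact ⟨open_cell A _, convex_cell A _⟩

open Set in
lemma val1 {J : Type} [Fintype J] (I : J → Set ℝ) (c : J → ℤ)
    (ho : ∀ j, IsOpen (I j)) (hc : ∀ j, Convex ℝ (I j)) (hne : ∀ j, (I j).Nonempty)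
    (hb : ∀ j, BddAbove (I j))
    (h : ∀ t, ∑ j, (I j).indicator (fun _ => c j) t = 0) : ∑ j, c j = 0 := by
  classical
  have key : ∀ b : ℝ, ∑ j with sSup (I j) = b, c j = 0 := by
    intro b
    have ev : ∀ j, ∀ᶠ t in nhdsWithin b (Iio b),
        (I j).indicator (fun _ => c j) t
          = (I j).indicator (fun _ => c j) b + if sSup (I j) = b then c j else 0 := by
      intro j
      have hoc := (hc j).ordConnected
      have hlub := isLUB_csSup (hne j) (hb j)
      have hnot : sSup (I j) ∉ I j := by
        intro hmem
        have h1 : ∀ᶠ t in nhdsWithin (sSup (I j)) (Ioi (sSup (I j))), t ∈ I j :=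
          nhdsWithin_le_nhds ((ho j).mem_nhds hmem)
        obtain ⟨t, ht, ht'⟩ := (h1.and self_mem_nhdsWithin).exists
        exact absurd (hlub.1 ht) (not_le.2 ht')
      by_cases hbm : b ∈ I j
      · have h1 : ∀ᶠ t in nhdsWithin b (Iio b), t ∈ I j :=
          nhdsWithin_le_nhds ((ho j).mem_nhds hbm)
        filter_upwards [h1] with t ht
        have : sSup (I j) ≠ b := fun e => hnot (e ▸ hbm)
        simp [ht, hbm, this]
      · rcases lt_trichotomy (sSup (I j)) b with hlt | heq | hgt
        · have h1 : ∀ᶠ t in nhdsWithin b (Iio b), sSup (I j) < t :=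
            nhdsWithin_le_nhds (lt_mem_nhds hlt)
          filter_upwards [h1] with t ht
          have : t ∉ I j := fun hh => absurd (hlub.1 hh) (not_le.2 ht)
          simp [this, hbm, hlt.ne]
        · obtain ⟨y, hy⟩ := hne j
          have hyb : y < b := lt_of_le_of_ne (heq ▸ hlub.1 hy) (fun e => hbm (e ▸ hy))
          have h1 : ∀ᶠ t in nhdsWithin b (Iio b), y < t :=
            nhdsWithin_le_nhds (lt_mem_nhds hyb)
          filter_upwards [h1, self_mem_nhdsWithin] with t ht ht'
          have ht2 : t < sSup (I j) := by rw [heq]; exact ht'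
          obtain ⟨z, hz, hz'⟩ := (lt_isLUB_iff hlub).1 ht2
          have : t ∈ I j := hoc.out hy hz ⟨ht.le, hz'.le⟩
          simp [this, hbm, heq]
        · filter_upwards [self_mem_nhdsWithin] with t ht
          have : t ∉ I j := by
            intro hh
            obtain ⟨z, hz, hz'⟩ := (lt_isLUB_iff hlub).1 hgt
            exact hbm (hoc.out hh hz ⟨le_of_lt ht, hz'.le⟩)
          simp [this, hbm, hgt.ne']
    obtain ⟨t, ht⟩ := (Filter.eventually_all.2 ev).exists
    have := h t
    rw [Finset.sum_congr rfl (fun j _ => ht j), Finset.sum_add_distrib, h b, zero_add] at this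
    rw [Finset.sum_filter]; exact this
  rw [← Finset.sum_fiberwise_of_maps_to (g := fun j => sSup (I j))
    (t := Finset.univ.image (fun j => sSup (I j))) (by simp)]
  exact Finset.sum_eq_zero (fun b _ => key b)

open Set in
lemma val1' {J : Type} [Fintype J] (I : J → Set ℝ) (c : J → ℤ)
    (ho : ∀ j, IsOpen (I j)) (hc : ∀ j, Convex ℝ (I j)) (hne : ∀ j, (I j).Nonempty)
    (h : ∀ t, ∑ j, (I j).indicator (fun _ => c j) t = 0) : ∑ j, c j = 0 := by
  classical
  choose x hx using hne
  obtain ⟨R, hR⟩ := (Set.finite_range x).bddAbove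
  refine val1 (fun j => I j ∩ Iio (R + 1)) c (fun j => (ho j).inter isOpen_Iio)
    (fun j => (hc j).inter (convex_Iio _)) (fun j => ⟨x j, hx j, ?_⟩)
    (fun j => ⟨R + 1, fun y hy => le_of_lt hy.2⟩) ?_
  · have : x j ≤ R := hR ⟨j, rfl⟩
    exact lt_of_le_of_lt this (by linarith)
  · intro t
    by_cases ht : t < R + 1
    · rw [← h t]
      refine Finset.sum_congr rfl fun j _ => ?_
      simp [Set.indicator, ht]
    · exact Finset.sum_eq_zero fun j _ => by simp [Set.indicator, ht]

open Set in
lemma valn (n : ℕ) : ∀ {J : Type} [Fintype J] (C : J → Set (Fin n → ℝ)) (c : J → ℤ)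
    (_ : ∀ j, IsOpen (C j)) (_ : ∀ j, Convex ℝ (C j)) (_ : ∀ j, (C j).Nonempty)
    (_ : ∀ x, ∑ j, (C j).indicator (fun _ => c j) x = 0), ∑ j, c j = 0 := by
  classical
  induction n with
  | zero =>
    intro J _ C c ho hc hne h
    rw [← h 0]
    refine Finset.sum_congr rfl fun j _ => ?_
    obtain ⟨x, hx⟩ := hne j
    rw [Subsingleton.elim x 0] at hx
    rw [Set.indicator_of_mem hx]
  | succ n ih =>
    intro J _ C c ho hc hne h
    refine val1' (fun j => (fun x : Fin (n+1) → ℝ => x 0) '' C j) c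
      (fun j => isOpenMap_eval 0 _ (ho j))
      (fun j => (hc j).linear_image (LinearMap.proj (R := ℝ) (φ := fun _ : Fin (n+1) => ℝ) 0))
      (fun j => (hne j).image _) ?_
    intro t
    have hmem : ∀ j, t ∈ (fun x : Fin (n+1) → ℝ => x 0) '' C j ↔
        ∃ y : Fin n → ℝ, (Fin.cons t y : Fin (n+1) → ℝ) ∈ C j := by
      intro j
      constructor
      · rintro ⟨x, hx, rfl⟩
        exact ⟨Fin.tail x, by simpa [Fin.cons_self_tail] using hx⟩
      · rintro ⟨y, hy⟩
        exact ⟨_, hy, rfl⟩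
    have hcons : Continuous (fun y : Fin n → ℝ => (Fin.cons t y : Fin (n+1) → ℝ)) := by
      refine continuous_pi fun i => ?_
      refine Fin.cases ?_ (fun i => ?_) i
      · simpa using continuous_const
      · simpa using continuous_apply i
    let J' := {j : J // ∃ y : Fin n → ℝ, (Fin.cons t y : Fin (n+1) → ℝ) ∈ C j}
    have := ih (J := J') (fun j => {y | (Fin.cons t y : Fin (n+1) → ℝ) ∈ C j.1}) (fun j => c j.1)
      (fun j => (ho j.1).preimage hcons)
      (fun j => by
        intro y hy z hz a b ha hb hab
        have := hc j.1 hy hz ha hb hab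
        have e : (Fin.cons t (a • y + b • z) : Fin (n+1) → ℝ)
            = a • (Fin.cons t y : Fin (n+1) → ℝ) + b • (Fin.cons t z : Fin (n+1) → ℝ) := by
          funext i
          refine Fin.cases ?_ (fun i => ?_) i
          · simp [← add_mul, hab]
          · simp
        change (Fin.cons t (a • y + b • z) : Fin (n+1) → ℝ) ∈ C j.1
        rw [e]; exact this)
      (fun j => j.2)
      (fun y => by
        rw [← h (Fin.cons t y)]
        have e : ∑ j, (C j).indicator (fun _ => c j) (Fin.cons t y)
            = ∑ j with ∃ y : Fin n → ℝ, (Fin.cons t y : Fin (n+1) → ℝ) ∈ C j,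
              (C j).indicator (fun _ => c j) (Fin.cons t y) := by
          rw [Finset.sum_filter]
          refine Finset.sum_congr rfl fun j _ => ?_
          split_ifs with hj
          · rfl
          · exact Set.indicator_of_notMem (fun hh => hj ⟨y, hh⟩) _
        rw [e, Finset.sum_subtype _ (p := fun j => ∃ y : Fin n → ℝ,
          (Fin.cons t y : Fin (n+1) → ℝ) ∈ C j) (by simp)]
        rfl)
    rw [← this, ← Finset.sum_subtype (Finset.univ.filter fun j => ∃ y : Fin n → ℝ,
          (Fin.cons t y : Fin (n+1) → ℝ) ∈ C j) (by simp), Finset.sum_filter]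
    refine Finset.sum_congr rfl fun j _ => ?_
    rw [Set.indicator_apply]
    exact if_congr (hmem j) rfl rfl

open Set in
lemma comp_lem {E D : Type} [NormedAddCommGroup E] [NormedSpace ℝ E] [Finite D] (V : Set E)
    (l : E → D) (h : ∀ d, IsOpen {x | x ∈ V ∧ l x = d} ∧ Convex ℝ {x | x ∈ V ∧ l x = d}) :
    Finite (ConnectedComponents V) ∧ ∀ γ : ConnectedComponents V,
      IsOpen (Subtype.val '' {x : V | ConnectedComponents.mk x = γ}) ∧
      Convex ℝ (Subtype.val '' {x : V | ConnectedComponents.mk x = γ}) := by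
  have hl : IsLocallyConstant (fun x : V => l x) := by
    rw [IsLocallyConstant.iff_isOpen_fiber]
    intro d
    have := (h d).1.preimage (continuous_subtype_val : Continuous (Subtype.val : V → E))
    convert this using 1
    ext x
    simp
  have key : ∀ x y : V, ConnectedComponents.mk x = ConnectedComponents.mk y ↔ l x = l y := by
    intro x y
    rw [ConnectedComponents.coe_eq_coe']
    constructor
    · intro hxy
      exact hl.apply_eq_of_isPreconnected isPreconnected_connectedComponent hxy
        mem_connectedComponent
    · intro hxy
      have hp : IsPreconnected {z : V | l z = l y} := by
        rw [← Topology.IsInducing.subtypeVal.isPreconnected_image]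
        have := (h (l y)).2.isPreconnected
        convert this using 1
        ext z
        simp [and_comm]
      exact hp.subset_connectedComponent (show y ∈ {z : V | l z = l y} from rfl) hxy
  constructor
  · refine Finite.of_injective (fun γ : ConnectedComponents V =>
      l (ConnectedComponents.surjective_coe γ).choose) ?_
    intro a b hab
    have := (key _ _).2 hab
    rwa [(ConnectedComponents.surjective_coe a).choose_spec,
      (ConnectedComponents.surjective_coe b).choose_spec] at this
  · intro γ
    obtain ⟨y, rfl⟩ := ConnectedComponents.surjective_coe γ
    have : (Subtype.val '' {x : V | ConnectedComponents.mk x = ConnectedComponents.mk y})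
        = {x | x ∈ V ∧ l x = l y} := by
      ext z
      simp [key, and_comm]
    rw [this]
    exact h _

open Set in
lemma inner_alt_sum (m N : ℕ) (S : Finset (Fin m)) :
    ∑ T : Finset (Fin m) with S ⊆ T ∧ T.card ≤ N, (-1 : ℤ) ^ T.card
      = (-1) ^ S.card * ∑ i ∈ Finset.range (N + 1 - S.card), (-1) ^ i * ((m - S.card).choose i : ℤ)
      := by
  classical
  have h1 : ∑ T : Finset (Fin m) with S ⊆ T ∧ T.card ≤ N, (-1 : ℤ) ^ T.card
      = ∑ R ∈ Sᶜ.powerset with R.card < N + 1 - S.card, (-1 : ℤ) ^ (S.card + R.card) := by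
    refine Finset.sum_bij' (fun T _ => T \ S) (fun R _ => S ∪ R) ?_ ?_ ?_ ?_ ?_
    · intro T hT
      simp only [Finset.mem_filter, Finset.mem_univ, true_and] at hT
      have := Finset.card_sdiff_add_card_eq_card hT.1
      simp only [Finset.mem_filter, Finset.mem_powerset]
      refine ⟨fun x hx => by simp at hx ⊢; exact hx.2, by omega⟩
    · intro R hR
      simp only [Finset.mem_filter, Finset.mem_powerset] at hR
      simp only [Finset.mem_filter, Finset.mem_univ, true_and]
      have := Finset.card_union_le S R
      exact ⟨Finset.subset_union_left, by omega⟩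
    · intro T hT
      simp only [Finset.mem_filter, Finset.mem_univ, true_and] at hT
      exact Finset.union_sdiff_of_subset hT.1
    · intro R hR
      simp only [Finset.mem_filter, Finset.mem_powerset] at hR
      ext x
      have := @hR.1 x
      simp at this ⊢
      tauto
    · intro T hT
      simp only [Finset.mem_filter, Finset.mem_univ, true_and] at hT
      have := Finset.card_sdiff_add_card_eq_card hT.1
      congr 1
      omega
  rw [h1, Finset.mul_sum]
  rw [← Finset.sum_fiberwise_of_maps_to (g := Finset.card) (t := Finset.range (N + 1 - S.card))
    (by intro R hR; simp at hR ⊢; exact hR.2)]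
  refine Finset.sum_congr rfl fun i hi => ?_
  have e : (Finset.filter (fun R => R.card = i)
      (Finset.filter (fun R => R.card < N + 1 - S.card) Sᶜ.powerset)) = Sᶜ.powersetCard i := by
    ext R
    simp only [Finset.mem_filter, Finset.mem_powerset, Finset.mem_powersetCard]
    simp at hi
    constructor
    · tauto
    · rintro ⟨a, rfl⟩; exact ⟨⟨a, hi⟩, rfl⟩
  rw [e, Finset.sum_congr rfl (g := fun _ => (-1 : ℤ) ^ (S.card + i))
    (fun R hR => by rw [(Finset.mem_powersetCard.1 hR).2])]
  simp [Finset.card_compl]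
  ring

open Set in
lemma comb_lem (n m : ℕ) (hm : n + 1 ≤ m) (f : Finset (Fin m) → ℤ)
    (h : ∀ T : Finset (Fin m), n + 1 ≤ T.card → ∑ S ∈ T.powerset, (-1) ^ S.card * f S = 0) :
    f Finset.univ = ∑ j ∈ Finset.range (n + 1), (-1) ^ (n - j) * ((m - 1 - j).choose (n - j)) *
        ∑ S ∈ Finset.powersetCard j (Finset.univ : Finset (Fin m)), f S := by
  classical
  have swap : ∀ N : ℕ, ∑ T : Finset (Fin m) with T.card ≤ N,
      (-1) ^ T.card * ∑ S ∈ T.powerset, (-1) ^ S.card * f S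
      = ∑ S : Finset (Fin m), f S *
        ∑ i ∈ Finset.range (N + 1 - S.card), (-1) ^ i * ((m - S.card).choose i : ℤ) := by
    intro N
    simp_rw [Finset.mul_sum]
    rw [Finset.sum_comm' (t' := Finset.univ)
      (s' := fun S => Finset.univ.filter fun T => S ⊆ T ∧ T.card ≤ N) (by
        intro x y; simp; tauto)]
    refine Finset.sum_congr rfl fun S _ => ?_
    rw [← Finset.sum_mul, inner_alt_sum, ← Finset.mul_sum]
    have : (-1 : ℤ) ^ S.card * (-1) ^ S.card = 1 := by
      rw [← mul_pow]; simp
    linear_combination (f S * ∑ i ∈ Finset.range (N + 1 - S.card), (-1) ^ i * ((m - S.card).choose i : ℤ)) * this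
  have hcard : ∀ S : Finset (Fin m), S.card ≤ m := fun S => by simpa using Finset.card_le_univ S
  have h1 := swap m
  have h2 := swap n
  have h3 : ∑ T : Finset (Fin m) with T.card ≤ m,
      (-1) ^ T.card * ∑ S ∈ T.powerset, (-1) ^ S.card * f S = 
      ∑ T : Finset (Fin m) with T.card ≤ n,
      (-1) ^ T.card * ∑ S ∈ T.powerset, (-1) ^ S.card * f S := by
    rw [Finset.sum_filter, Finset.sum_filter]
    refine Finset.sum_congr rfl fun T _ => ?_
    by_cases hT : T.card ≤ n
    · simp [hT, hcard]
    · simp [hT, h T (by omega)]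
  rw [h1, h2] at h3
  have h4 : ∑ S : Finset (Fin m), f S *
        ∑ i ∈ Finset.range (m + 1 - S.card), (-1) ^ i * ((m - S.card).choose i : ℤ)
        = f Finset.univ := by
    rw [Finset.sum_eq_single Finset.univ]
    · simp
    · intro S _ hS
      have : S.card < m := by
        have := (Finset.card_lt_iff_ne_univ S).2 hS
        simpa using this
      rw [show m + 1 - S.card = (m - S.card) + 1 by omega,
        Int.alternating_sum_range_choose_of_ne (by omega), mul_zero]
    · simp
  rw [← h4, h3]
  rw [← Finset.sum_fiberwise_of_maps_to (g := Finset.card) (t := Finset.range (m + 1))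
    (by intro R hR; simpa [Nat.lt_succ_iff] using hcard R)]
  rw [← Finset.sum_subset (Finset.range_subset_range.2 (show n + 1 ≤ m + 1 by omega))]
  · refine Finset.sum_congr rfl fun j hj => ?_
    simp at hj
    rw [Finset.mul_sum]
    refine Finset.sum_congr (by ext; simp [Finset.mem_powersetCard]) fun S hS => ?_
    have hS' : S.card = j := by simpa using hS
    rw [hS', show n + 1 - j = (n - j) + 1 by omega, show m - j = (m - 1 - j) + 1 by omega,
      Int.alternating_sum_range_choose_eq_choose]
    ring
  · intro j hj hj'
    refine Finset.sum_eq_zero fun S hS => ?_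
    have hS' : S.card = j := by simpa using hS
    simp at hj hj'
    rw [hS', show n + 1 - j = 0 by omega]
    simp

open Set in
lemma region_lem {n m : ℕ} (k : Fin m → ℕ) (hk : ∀ i, 2 ≤ k i)
    (A : (i : Fin m) → Fin (k i) → ((Fin n → ℝ) →ᵃ[ℝ] ℝ)) (S : Finset (Fin m)) :
    Finite (ConnectedComponents ↥((arrangementUnion A S)ᶜ)) ∧
    ∀ γ : ConnectedComponents ↥((arrangementUnion A S)ᶜ),
      IsOpen (Subtype.val '' {x : ↥((arrangementUnion A S)ᶜ) | ConnectedComponents.mk x = γ}) ∧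
      Convex ℝ (Subtype.val '' {x : ↥((arrangementUnion A S)ᶜ) | ConnectedComponents.mk x = γ}) := by
  refine comp_lem _ (fun x => fun i : S => {a : Fin (k i) | ∀ c, A i c x ≤ A i a x}) ?_
  intro d
  have : {x | x ∈ (arrangementUnion A S)ᶜ ∧
      (fun i : S => {a : Fin (k i) | ∀ c, A i c x ≤ A i a x}) = d}
      = ⋂ i : S, {x | (¬ ∃ H, IsAtomOf (A i) H ∧ x ∈ H) ∧ {a | ∀ c, A i c x ≤ A i a x} = d i} := by
    ext x
    simp only [mem_iInter, mem_ofPred_eq, funext_iff, arrangementUnion, mem_compl_iff]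
    constructor
    · rintro ⟨h1, h2⟩ i
      exact ⟨fun hH => h1 ⟨i, i.2, hH⟩, h2 i⟩
    · intro h
      exact ⟨fun ⟨i, hi, hH⟩ => (h ⟨i, hi⟩).1 hH, fun i => (h i).2⟩
  rw [this]
  exact ⟨isOpen_iInter_of_finite fun i => (unit_lem (A i) (by have := hk i; omega) (d i)).1,
    convex_iInter fun i => (unit_lem (A i) (by have := hk i; omega) (d i)).2⟩

open Set in
lemma alt_lem {n m : ℕ} (k : Fin m → ℕ) (hk : ∀ i, 2 ≤ k i)
    (A : (i : Fin m) → Fin (k i) → ((Fin n → ℝ) →ᵃ[ℝ] ℝ)) (T : Finset (Fin m))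
    (hT : ∀ x, ∃ i ∈ T, ¬ ∃ H, IsAtomOf (A i) H ∧ x ∈ H) :
    ∑ S ∈ T.powerset, (-1) ^ S.card * (regionCount (arrangementUnion A S) : ℤ) = 0 := by
  classical
  have hfin := fun S => (region_lem k hk A S).1
  let _ : ∀ S, Fintype (ConnectedComponents ↥((arrangementUnion A S)ᶜ)) :=
    fun S => Fintype.ofFinite _
  let J := Σ S : {S // S ∈ T.powerset}, ConnectedComponents ↥((arrangementUnion A S.1)ᶜ)
  have h := valn n (J := J)
    (fun j => Subtype.val '' {x : ↥((arrangementUnion A j.1.1)ᶜ) | ConnectedComponents.mk x = j.2})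
    (fun j => (-1) ^ j.1.1.card)
    (fun j => ((region_lem k hk A j.1.1).2 j.2).1)
    (fun j => ((region_lem k hk A j.1.1).2 j.2).2)
    (fun j => by
      obtain ⟨y, hy⟩ := ConnectedComponents.surjective_coe j.2
      exact ⟨y.1, y, hy, rfl⟩)
    (fun x => by
      rw [Fintype.sum_sigma]
      have h1 : ∀ S : {S // S ∈ T.powerset},
          ∑ γ : ConnectedComponents ↥((arrangementUnion A S.1)ᶜ),
            (Subtype.val '' {x : ↥((arrangementUnion A S.1)ᶜ) |
              ConnectedComponents.mk x = γ}).indicator (fun _ => (-1 : ℤ) ^ S.1.card) x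
          = if S.1 ⊆ T.filter (fun i => ¬ ∃ H, IsAtomOf (A i) H ∧ x ∈ H)
            then (-1 : ℤ) ^ S.1.card else 0 := by
        intro S
        have hST := Finset.mem_powerset.1 S.2
        by_cases hx : x ∈ (arrangementUnion A S.1)ᶜ
        · have hsub : S.1 ⊆ T.filter (fun i => ¬ ∃ H, IsAtomOf (A i) H ∧ x ∈ H) :=
            fun i hi => Finset.mem_filter.2 ⟨hST hi, fun hH => hx ⟨i, hi, hH⟩⟩
          rw [if_pos hsub]
          rw [Finset.sum_eq_single (ConnectedComponents.mk ⟨x, hx⟩)]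
          · refine Set.indicator_of_mem ?_ _
            exact ⟨⟨x, hx⟩, rfl, rfl⟩
          · intro γ _ hγ
            refine Set.indicator_of_notMem ?_ _
            rintro ⟨y, hy, rfl⟩
            exact hγ hy.symm
          · simp
        · rw [if_neg (fun hs => hx ?_)]
          · refine Finset.sum_eq_zero fun γ _ => Set.indicator_of_notMem ?_ _
            rintro ⟨y, hy, rfl⟩
            exact hx y.2
          · rintro ⟨i, hi, hH⟩
            exact (Finset.mem_filter.1 (hs hi)).2 hH
      rw [Finset.sum_congr rfl (fun S _ => h1 S)]
      rw [Finset.sum_coe_sort T.powerset (fun S : Finset (Fin m) =>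
        if S ⊆ T.filter (fun i => ¬ ∃ H, IsAtomOf (A i) H ∧ x ∈ H)
            then (-1 : ℤ) ^ S.card else 0), ← Finset.sum_filter]
      obtain ⟨i, hi, hi'⟩ := hT x
      rw [← Finset.sum_powerset_neg_one_pow_card_of_nonempty
        (x := T.filter (fun i => ¬ ∃ H, IsAtomOf (A i) H ∧ x ∈ H))
        ⟨i, Finset.mem_filter.2 ⟨hi, hi'⟩⟩]
      refine Finset.sum_congr ?_ fun _ _ => rfl
      ext S
      simp only [Finset.mem_filter, Finset.mem_powerset]
      exact ⟨fun h => h.2, fun h => ⟨h.trans (Finset.filter_subset _ _), h⟩⟩)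
  rw [Fintype.sum_sigma] at h
  rw [← h, ← Finset.sum_coe_sort T.powerset]
  refine Finset.sum_congr rfl fun S _ => ?_
  simp only [Finset.sum_const, Finset.card_univ, regionCount, Nat.card_eq_fintype_card,
    nsmul_eq_mul]
  ring

theorem regions_of_simple_arrangement (n m : ℕ) (hm : n + 1 ≤ m)
    (k : Fin m → ℕ) (hk : ∀ i, 2 ≤ k i)
    (A : (i : Fin m) → Fin (k i) → ((Fin n → ℝ) →ᵃ[ℝ] ℝ))
    (hsimple : ∀ (S : Finset (Fin m)) (H : Fin m → Set (Fin n → ℝ)),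
      (∀ i ∈ S, IsAtomOf (A i) (H i)) →
      (⋂ i ∈ S, H i) = ∅ ∨
        Module.finrank ℝ (affineSpan ℝ (⋂ i ∈ S, H i)).direction + S.card = n) :
    (regionCount (arrangementUnion A Finset.univ) : ℤ) =
      ∑ j ∈ Finset.range (n + 1), (-1) ^ (n - j) * ((m - 1 - j).choose (n - j)) *
        ∑ S ∈ Finset.powersetCard j (Finset.univ : Finset (Fin m)),
          (regionCount (arrangementUnion A S) : ℤ) := by
  refine comb_lem n m hm (fun S => (regionCount (arrangementUnion A S) : ℤ)) ?_
  intro T hT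
  refine alt_lem k hk A T fun x => ?_
  by_contra hcon
  push Not at hcon
  choose! H hH using hcon
  rcases hsimple T H (fun i hi => (hH i hi).1) with h | h
  · have : x ∈ ⋂ i ∈ T, H i := by
      simp only [Set.mem_iInter]
      exact fun i hi => (hH i hi).2
    rw [h] at this
    exact this
  · omega
end

section
/- Let n ≥ 0 and m ≥ n + 1 be integers, and let 𝒜 be a finite set of cardinality M partitioned into m nonempty blocks 𝒜_1,…,𝒜_m. For each integer k with n + 1 ≤ k ≤ M, let N_k^* denote the number of k-element subsets of 𝒜 that intersect at least n + 1 of the blocks. Then ∑_{k=n+1}^{M} (−1)^k N_k^* = −(−1)^n C(m−1, n). -/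
open Classical in
theorem fiber_aux {α : Type} [Fintype α] {m : ℕ} (f : α → Fin m) (hf : Function.Surjective f)
    (T : Finset (Fin m)) :
    ∑ A ∈ (Finset.univ : Finset (Finset α)).filter (fun A => A.image f = T), (-1 : ℤ) ^ A.card
      = (-1) ^ T.card := by
  induction T using Finset.strongInduction with
  | H T ih =>
    have h1 : ∑ T' ∈ T.powerset, ∑ A ∈ (Finset.univ : Finset (Finset α)).filter
        (fun A => A.image f = T'), (-1 : ℤ) ^ A.card = ∑ T' ∈ T.powerset, (-1 : ℤ) ^ T'.card := by
      rw [Finset.sum_powerset_neg_one_pow_card]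
      have h2 : ∑ A ∈ (Finset.univ.filter (fun a => f a ∈ T)).powerset, (-1 : ℤ) ^ A.card
          = if T = ∅ then 1 else 0 := by
        rw [Finset.sum_powerset_neg_one_pow_card]
        congr 1
        apply propext
        constructor
        · intro h
          rw [Finset.eq_empty_iff_forall_notMem]
          intro t ht
          obtain ⟨a, rfl⟩ := hf t
          have : a ∈ (Finset.univ.filter (fun a => f a ∈ T)) := by simp [ht]
          rw [h] at this
          simp at this
        · rintro rfl
          simp
      rw [← h2]
      have key : ∀ A : Finset α, A ∈ (Finset.univ.filter (fun a => f a ∈ T)).powerset ↔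
          A.image f ∈ T.powerset := by
        intro A
        simp [Finset.subset_iff]
      rw [← Finset.sum_fiberwise_of_maps_to (g := fun A : Finset α => A.image f) (t := T.powerset)
        (fun A hA => (key A).1 hA)]
      refine Finset.sum_congr rfl fun T' hT' => Finset.sum_congr ?_ fun _ _ => rfl
      ext A
      rw [Finset.mem_filter, Finset.mem_filter, key]
      constructor
      · rintro ⟨-, rfl⟩
        exact ⟨hT', rfl⟩
      · rintro ⟨-, h⟩
        exact ⟨Finset.mem_univ _, h⟩
    rw [← Finset.sum_erase_add _ _ (Finset.mem_powerset_self T),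
      ← Finset.sum_erase_add T.powerset (fun T' : Finset (Fin m) => (-1 : ℤ) ^ T'.card)
        (Finset.mem_powerset_self T)] at h1
    rw [Finset.sum_congr rfl (g := fun T' : Finset (Fin m) => (-1 : ℤ) ^ T'.card)] at h1
    · exact add_left_cancel h1
    · intro T' hT'
      rw [Finset.mem_erase, Finset.mem_powerset] at hT'
      exact ih T' (lt_of_le_of_ne hT'.2 hT'.1)

theorem alt_aux (n m : ℕ) (hm : n + 1 ≤ m) :
    ∑ T ∈ (Finset.univ : Finset (Finset (Fin m))).filter (fun T => n + 1 ≤ T.card),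
      (-1 : ℤ) ^ T.card = -(-1 : ℤ) ^ n * ((m - 1).choose n) := by
  have h0 : ∑ T ∈ (Finset.univ : Finset (Fin m)).powerset, (-1 : ℤ) ^ T.card = 0 := by
    rw [Finset.sum_powerset_neg_one_pow_card, if_neg]
    intro h
    have := congrArg Finset.card h
    simp at this
    omega
  rw [Finset.powerset_univ, ← Finset.sum_filter_add_sum_filter_not _ (fun T => n + 1 ≤ T.card)] at h0
  have h1 : ∑ T ∈ (Finset.univ : Finset (Finset (Fin m))).filter (fun T => ¬ n + 1 ≤ T.card),
      (-1 : ℤ) ^ T.card = (-1 : ℤ) ^ n * ((m - 1).choose n) := by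
    obtain ⟨p, rfl⟩ : ∃ p, m = p + 1 := ⟨m - 1, by omega⟩
    rw [Nat.add_sub_cancel, ← Int.alternating_sum_range_choose_eq_choose,
      ← Finset.sum_fiberwise_of_maps_to (g := Finset.card) (t := Finset.range (n + 1))]
    · refine Finset.sum_congr rfl fun j hj => ?_
      rw [Finset.sum_congr rfl (g := fun _ => (-1 : ℤ) ^ j)]
      · rw [Finset.sum_const, nsmul_eq_mul, mul_comm]
        congr 2
        have : (Finset.filter (fun i : Finset (Fin (p+1)) => i.card = j)
          (Finset.univ.filter (fun T => ¬ n + 1 ≤ T.card))) = Finset.univ.powersetCard j := by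
          ext A
          simp at hj ⊢
          omega
        rw [this]
        simp
      · intro A hA
        rw [(Finset.mem_filter.1 hA).2]
    · intro A hA
      simpa using hA
  linarith

open Classical in
theorem alternating_count_subsets_meeting_many_blocks
    (n m M : ℕ) (hm : n + 1 ≤ m)
    (α : Type) [Fintype α] (hM : Fintype.card α = M)
    (B : Fin m → Finset α)
    (hne : ∀ i, (B i).Nonempty)
    (hdisj : ∀ i j, i ≠ j → Disjoint (B i) (B j))
    (hcover : Finset.univ.biUnion B = Finset.univ) :
    ∑ kk ∈ Finset.Icc (n + 1) M,
        (-1 : ℤ) ^ kk *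
          (((Finset.univ : Finset α).powersetCard kk).filter
            (fun A => n + 1 ≤ (Finset.univ.filter (fun i : Fin m => (A ∩ B i).Nonempty)).card)).card
      = -(-1 : ℤ) ^ n * ((m - 1).choose n) := by
  have hex : ∀ a, ∃ i, a ∈ B i := by
    intro a
    have := Finset.mem_univ a
    rw [← hcover] at this
    simpa using this
  choose f hf using hex
  have hfi : ∀ a i, a ∈ B i → f a = i := by
    intro a i h
    by_contra hc
    exact Finset.disjoint_left.1 (hdisj _ _ hc) (hf a) h
  have hs : Function.Surjective f := fun i => by
    obtain ⟨a, ha⟩ := hne i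
    exact ⟨a, hfi a i ha⟩
  have hS : ∀ A : Finset α, (Finset.univ.filter (fun i : Fin m => (A ∩ B i).Nonempty))
      = A.image f := by
    intro A
    ext i
    simp only [Finset.mem_filter, Finset.mem_univ, true_and, Finset.mem_image, Finset.Nonempty,
      Finset.mem_inter]
    constructor
    · rintro ⟨a, h1, h2⟩
      exact ⟨a, h1, hfi a i h2⟩
    · rintro ⟨a, h1, rfl⟩
      exact ⟨a, h1, hf a⟩
  simp only [hS]
  have h1 : ∑ A ∈ (Finset.univ : Finset (Finset α)).filter (fun A => n + 1 ≤ (A.image f).card),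
      (-1 : ℤ) ^ A.card = -(-1 : ℤ) ^ n * ((m - 1).choose n) := by
    rw [← alt_aux n m hm, ← Finset.sum_fiberwise_of_maps_to (g := fun A : Finset α => A.image f)
      (t := (Finset.univ : Finset (Finset (Fin m))).filter (fun T => n + 1 ≤ T.card))]
    · refine Finset.sum_congr rfl fun T hT => ?_
      rw [← fiber_aux f hs T]
      refine Finset.sum_congr ?_ fun _ _ => rfl
      ext A
      simp only [Finset.mem_filter, Finset.mem_univ, true_and] at hT ⊢
      constructor
      · exact fun h => h.2
      · rintro rfl
        exact ⟨hT, rfl⟩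
    · intro A hA
      simpa using hA
  rw [← h1, ← Finset.sum_fiberwise_of_maps_to (g := Finset.card) (t := Finset.Icc (n + 1) M)]
  · refine Finset.sum_congr rfl fun k hk => ?_
    symm
    rw [Finset.sum_congr rfl (g := fun _ => (-1 : ℤ) ^ k)]
    · rw [Finset.sum_const, nsmul_eq_mul, mul_comm]
      congr 3
      ext A
      simp [and_comm]
    · intro A hA
      rw [(Finset.mem_filter.1 hA).2]
  · intro A hA
    rw [Finset.mem_filter] at hA
    rw [Finset.mem_Icc, ← hM]
    exact ⟨hA.2.trans Finset.card_image_le, Finset.card_le_univ A⟩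
end
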